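/- Define the sum of prime divisors function A(n) = ∑_{j=1}^{Ω(n)} P_j(n), where P_j(n) is the j-th largest prime factor of n counted with multiplicity and Ω(n) is the number of prime factors of n with multiplicity (so A(1) = 0). Fix K ≥ 1. Then for every ε > 0 there exists x₀ such that for all x ≥ x₀, all positive integers q ≤ (log x)^K, and all integers a, one has |#{n ≤ x : A(n) ≡ a (mod q)} − x/q| ≤ ε·x/q. That is, A(n) is asymptotically uniformly distributed modulo q, uniformly for q ≤ (log x)^K. -/

import Mathlib

/-- The number of positive integers `n ≤ x` satisfying the predicate `P`. -/
noncomputable def cnt (x : ℝ) (P : ℕ → Prop) : ℕ :=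
  Set.ncard {n : ℕ | 0 < n ∧ (n : ℝ) ≤ x ∧ P n}

/-- The sum of prime divisors function `A(n) = ∑_{j=1}^{Ω(n)} P_j(n)`, the sum of the prime
factors of `n` counted with multiplicity (so `A(1) = 0`). -/
def A (n : ℕ) : ℤ :=
  ((n.primeFactorsList).map (fun p => (p : ℤ))).sum

section
open Filter Topology Finset

/-- twisted Dirichlet series -/
noncomputable def FH (f : ℕ →*₀ ℂ) (σ t : ℝ) : ℂ :=
  ∑' n : ℕ, f n * (((n : ℝ) ^ (-σ) : ℝ) : ℂ) * Complex.exp (-(t * Real.log n : ℝ) * Complex.I)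

noncomputable def termHom (f : ℕ →*₀ ℂ) (σ t : ℝ) : ℕ →*₀ ℂ where
  toFun n := f n * (((n : ℝ) ^ (-σ) : ℝ) : ℂ) * Complex.exp (-(t * Real.log n : ℝ) * Complex.I)
  map_zero' := by simp
  map_one' := by simp
  map_mul' m n := by
    rcases eq_or_ne m 0 with rfl | hm
    · simp
    rcases eq_or_ne n 0 with rfl | hn
    · simp
    have hm' : (0:ℝ) < m := by positivity
    have hn' : (0:ℝ) < n := by positivity
    push_cast
    rw [Real.mul_rpow hm'.le hn'.le, Real.log_mul hm'.ne' hn'.ne', map_mul]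
    push_cast
    rw [mul_add, neg_add, add_mul, Complex.exp_add]
    ring

lemma norm_exp_it (x : ℝ) : ‖Complex.exp (-(x : ℝ) * Complex.I)‖ = 1 := by
  rw [← Complex.ofReal_neg, Complex.norm_exp_ofReal_mul_I]

lemma norm_term_le (f : ℕ →*₀ ℂ) (hf : ∀ n, ‖f n‖ ≤ 1) (σ t : ℝ) (n : ℕ) :
    ‖termHom f σ t n‖ ≤ (n : ℝ) ^ (-σ) := by
  have : (0:ℝ) ≤ (n:ℝ)^(-σ) := by positivity
  simp only [termHom, MonoidWithZeroHom.coe_mk, ZeroHom.coe_mk, norm_mul, norm_exp_it, Complex.norm_real, Real.norm_eq_abs, abs_of_nonneg this, mul_one]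
  exact mul_le_of_le_one_left this (hf n)

lemma summ_rpow {σ : ℝ} (hσ : 1 < σ) : Summable (fun n : ℕ => (n : ℝ) ^ (-σ)) :=
  Real.summable_nat_rpow.2 (by linarith)

lemma summ_term (f : ℕ →*₀ ℂ) (hf : ∀ n, ‖f n‖ ≤ 1) {σ : ℝ} (hσ : 1 < σ) (t : ℝ) :
    Summable (fun n => ‖termHom f σ t n‖) :=
  (summ_rpow hσ).of_nonneg_of_le (fun _ => norm_nonneg _) (norm_term_le f hf σ t)

noncomputable def Zt (σ : ℝ) : ℝ := ∑' n : ℕ, (n : ℝ) ^ (-σ)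

lemma norm_FH_le (f : ℕ →*₀ ℂ) (hf : ∀ n, ‖f n‖ ≤ 1) {σ : ℝ} (hσ : 1 < σ) (t : ℝ) :
    ‖FH f σ t‖ ≤ Zt σ := by
  have := norm_tsum_le_tsum_norm (summ_term f hf hσ t)
  refine this.trans ?_
  exact (summ_term f hf hσ t).tsum_le_tsum (norm_term_le f hf σ t) (summ_rpow hσ)

lemma cont_FH (f : ℕ →*₀ ℂ) (hf : ∀ n, ‖f n‖ ≤ 1) {σ : ℝ} (hσ : 1 < σ) :
    Continuous (FH f σ) := by
  unfold FH
  refine continuous_tsum (u := fun n : ℕ => (n:ℝ)^(-σ)) ?_ (summ_rpow hσ) ?_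
  · intro n
    fun_prop
  · intro n t
    exact norm_term_le f hf σ t n

lemma euler_FH (f : ℕ →*₀ ℂ) (hf : ∀ n, ‖f n‖ ≤ 1) {σ : ℝ} (hσ : 1 < σ) (t : ℝ) :
    Tendsto (fun n => ∏ p ∈ Nat.primesBelow n, (1 - termHom f σ t p)⁻¹) atTop (𝓝 (FH f σ t)) :=
  EulerProduct.eulerProduct_completely_multiplicative (summ_term f hf hσ t)

lemma norm_one_hom (n : ℕ) : ‖(1 : ℕ →*₀ ℂ) n‖ ≤ 1 := by
  rcases eq_or_ne n 0 with rfl | hn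
  · simp
  · rw [MonoidWithZeroHom.one_apply_of_ne_zero hn]; simp

lemma FH_one {σ : ℝ} (hσ : 1 < σ) (t : ℝ) : FH 1 σ t = riemannZeta (σ + t * Complex.I) := by
  rw [zeta_eq_tsum_one_div_nat_cpow (by simpa using hσ), FH]
  congr 1; ext n
  rcases eq_or_ne n 0 with rfl | hn
  · have : (σ : ℂ) + t * Complex.I ≠ 0 := by
      intro h
      have := congrArg Complex.re h
      simp at this; linarith
    simp [Complex.zero_cpow this]
  · rw [MonoidWithZeroHom.one_apply_of_ne_zero hn]
    have hn' : (0:ℝ) < n := by positivity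
    rw [one_div, ← Complex.cpow_neg, Complex.cpow_def_of_ne_zero (by exact_mod_cast hn), Complex.ofReal_cpow hn'.le,
      Complex.cpow_def_of_ne_zero (by exact_mod_cast hn), one_mul, ← Complex.exp_add]
    simp only [Complex.ofReal_natCast, Complex.ofReal_mul, Complex.natCast_log]
    congr 1
    push_cast
    ring

lemma FH_one_zero {σ : ℝ} (hσ : 1 < σ) : FH 1 σ 0 = (Zt σ : ℂ) := by
  rw [FH, Zt, Complex.ofReal_tsum]
  congr 1; ext n
  rcases eq_or_ne n 0 with rfl | hn
  · simp; rw [Real.zero_rpow (by linarith)]; simp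
  · rw [MonoidWithZeroHom.one_apply_of_ne_zero hn]; simp

lemma Zt_ge_one {σ : ℝ} (hσ : 1 < σ) : 1 ≤ Zt σ := by
  have := (summ_rpow hσ).le_tsum 1 (fun j _ => by positivity)
  unfold Zt; simpa using this

/-- `(σ-1) ζ(σ) → 1` -/
lemma Zt_tendsto : Tendsto (fun σ : ℝ => (σ - 1) * Zt σ) (𝓝[>] 1) (𝓝 1) := by
  have h := riemannZeta_residue_one
  have h2 : Tendsto (fun σ : ℝ => (σ : ℂ)) (𝓝[>] 1) (𝓝[≠] 1) := by
    refine tendsto_nhdsWithin_iff.2 ⟨?_, ?_⟩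
    · have : Tendsto (fun σ : ℝ => (σ : ℂ)) (𝓝 1) (𝓝 ((1:ℝ):ℂ)) := Complex.continuous_ofReal.tendsto 1
      simpa using this.mono_left nhdsWithin_le_nhds
    · filter_upwards [self_mem_nhdsWithin] with σ hσ
      simp only [Set.mem_compl_iff, Set.mem_singleton_iff]
      intro h
      have : σ = 1 := by exact_mod_cast h
      rw [this] at hσ; exact lt_irrefl _ (Set.mem_Ioi.1 hσ)
  have h3 := (h.comp h2).norm
  simp only [norm_one] at h3
  refine h3.congr' ?_
  filter_upwards [self_mem_nhdsWithin] with σ hσ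
  have hσ' : (1:ℝ) < σ := hσ
  simp only [Function.comp]
  have := FH_one hσ' 0
  rw [FH_one_zero hσ'] at this
  simp only [Complex.ofReal_zero, zero_mul, add_zero] at this
  rw [← this, norm_mul, Complex.norm_real, Real.norm_eq_abs, abs_of_nonneg (by linarith [Zt_ge_one hσ'])]
  congr 1
  rw [← Complex.ofReal_one, ← Complex.ofReal_sub, Complex.norm_real, Real.norm_eq_abs, abs_of_nonneg (by linarith)]

lemma Zt_le : ∃ δ > 0, ∀ σ : ℝ, 1 < σ → σ < 1 + δ → (σ - 1) * Zt σ ≤ 2 := by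
  have := Zt_tendsto.eventually (ge_mem_nhds (show (1:ℝ) < 2 by norm_num))
  rw [eventually_nhdsWithin_iff, Metric.eventually_nhds_iff] at this
  obtain ⟨δ, hδ, h⟩ := this
  refine ⟨δ, hδ, fun σ h1 h2 => h ?_ h1⟩
  rw [Real.dist_eq, abs_lt]; constructor <;> linarith

lemma normsq_fac (x : ℝ) (z : ℂ) (hz : ‖z‖ = 1) :
    ‖1 - z * x‖ ^ 2 = (1 - x) ^ 2 + x * ‖1 - z‖ ^ 2 := by
  have h := Complex.sq_norm z
  rw [hz, Complex.normSq_apply] at h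
  rw [Complex.sq_norm, Complex.sq_norm, Complex.normSq_apply, Complex.normSq_apply]
  simp
  linear_combination (x - x^2) * h

/-- quadratic local factor -/
noncomputable def Qf (x b : ℝ) : ℝ := 1 + x * b / (1 - x) ^ 2

lemma Qf_ge {x b : ℝ} (hx : 0 ≤ x) (hb : 0 ≤ b) : 1 ≤ Qf x b := by
  unfold Qf; have : 0 ≤ x * b / (1 - x) ^ 2 := by positivity
  linarith

lemma Qf_mono {x y b : ℝ} (hx : 0 ≤ x) (hxy : x ≤ y) (hy : y < 1) (hb : 0 ≤ b) :
    Qf x b ≤ Qf y b := by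
  unfold Qf
  have : 0 < 1 - y := by linarith
  have : 0 ≤ y * b := mul_nonneg (hx.trans hxy) hb
  gcongr

lemma Qf_inv {x : ℝ} (hx0 : 0 ≤ x) (hx : x < 1) (z : ℂ) (hz : ‖z‖ = 1) :
    (‖(1 - z * x)⁻¹‖ / ‖(1 - (x:ℂ))⁻¹‖) ^ 2 = (Qf x (‖1 - z‖ ^ 2))⁻¹ := by
  have h1 : ‖(1 - (x:ℂ))‖ = 1 - x := by
    rw [← Complex.ofReal_one, ← Complex.ofReal_sub, Complex.norm_real, Real.norm_eq_abs, abs_of_nonneg (by linarith)]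
  rw [norm_inv, norm_inv, h1, div_pow, inv_pow, inv_pow, normsq_fac x z hz, Qf]
  have h2 : 0 < 1 - x := by linarith
  have h3 : 0 < (1 - x) ^ 2 + x * ‖1 - z‖ ^ 2 := by positivity
  field_simp

/-- unit twist at prime -/
noncomputable def zp (f : ℕ →*₀ ℂ) (t : ℝ) (p : ℕ) : ℂ :=
  f p * Complex.exp (-(t * Real.log p : ℝ) * Complex.I)

lemma norm_zp {f : ℕ →*₀ ℂ} {p : ℕ} (h : ‖f p‖ = 1) (t : ℝ) : ‖zp f t p‖ = 1 := by
  rw [zp, norm_mul, h, norm_exp_it, one_mul]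

lemma prime_rpow_lt {σ : ℝ} (hσ : 1 < σ) {p : ℕ} (hp : p.Prime) : (p:ℝ) ^ (-σ) < 1 :=
  Real.rpow_lt_one_of_one_lt_of_neg (by exact_mod_cast hp.one_lt) (by linarith)

lemma prod_FH (f : ℕ →*₀ ℂ) (hf : ∀ n ≠ 0, ‖f n‖ = 1) {σ : ℝ} (hσ : 1 < σ) (t : ℝ) :
    Tendsto (fun n => ∏ p ∈ Nat.primesBelow n, (Qf ((p:ℝ) ^ (-σ)) (‖1 - zp f t p‖ ^ 2))⁻¹) atTop
      (𝓝 ((‖FH f σ t‖ / Zt σ) ^ 2)) := by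
  have hf' : ∀ n, ‖f n‖ ≤ 1 := fun n => by
    rcases eq_or_ne n 0 with rfl | hn
    · simp
    · exact (hf n hn).le
  have h1 := (euler_FH f hf' hσ t).norm
  have h2 := (euler_FH 1 norm_one_hom hσ 0).norm
  rw [FH_one_zero hσ, Complex.norm_real, Real.norm_eq_abs, abs_of_nonneg (by linarith [Zt_ge_one hσ])] at h2
  have h3 := (h1.div h2 (by linarith [Zt_ge_one hσ])).pow 2
  refine h3.congr fun n => ?_
  simp only [Pi.div_apply]
  rw [norm_prod, norm_prod]
  rw [← Finset.prod_div_distrib, ← Finset.prod_pow]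
  refine Finset.prod_congr rfl fun p hp => ?_
  have hpp := Nat.prime_of_mem_primesBelow hp
  rw [← Qf_inv (by positivity) (prime_rpow_lt hσ hpp) _ (norm_zp (hf p hpp.ne_zero) t)]
  congr 5
  · simp only [termHom, zp, MonoidWithZeroHom.coe_mk, ZeroHom.coe_mk]; ring
  · simp only [termHom, MonoidWithZeroHom.coe_mk, ZeroHom.coe_mk,MonoidWithZeroHom.one_apply_of_ne_zero hpp.ne_zero]; simp

lemma R_mono (f : ℕ →*₀ ℂ) (hf : ∀ n ≠ 0, ‖f n‖ = 1) {σ σ' : ℝ} (hσ : 1 < σ) (h : σ ≤ σ') (t : ℝ) :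
    (‖FH f σ t‖ / Zt σ) ^ 2 ≤ (‖FH f σ' t‖ / Zt σ') ^ 2 := by
  refine le_of_tendsto_of_tendsto' (prod_FH f hf hσ t) (prod_FH f hf (hσ.trans_le h) t) fun n => ?_
  refine Finset.prod_le_prod (fun p _ => ?_) fun p hp => ?_
  · have := Qf_ge (x := (p:ℝ)^(-σ)) (b := ‖1 - zp f t p‖ ^ 2) (by positivity) (by positivity)
    positivity
  · have hpp := Nat.prime_of_mem_primesBelow hp
    have := Qf_ge (x := (p:ℝ)^(-σ')) (b := ‖1 - zp f t p‖ ^ 2) (by positivity) (by positivity)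
    apply inv_anti₀ (by linarith)
    refine Qf_mono (by positivity) ?_ (prime_rpow_lt hσ hpp) (by positivity)
    exact Real.rpow_le_rpow_of_exponent_le (by exact_mod_cast hpp.one_le) (by linarith)

lemma norm_one_sub_pow (z : ℂ) (hz : ‖z‖ = 1) (d : ℕ) : ‖1 - z ^ d‖ ≤ d * ‖1 - z‖ := by
  induction d with
  | zero => simp
  | succ d ih =>
    have : 1 - z ^ (d+1) = (1 - z ^ d) + z ^ d * (1 - z) := by ring
    rw [this]
    refine (norm_add_le _ _).trans ?_
    rw [norm_mul, norm_pow, hz, one_pow]; push_cast; linarith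

lemma zp_pow {f : ℕ →*₀ ℂ} {d p : ℕ} (h : f p ^ d = 1) (hp : p ≠ 0) (t : ℝ) : zp f t p ^ d = zp 1 (d * t) p := by
  rw [zp, zp, mul_pow, h, MonoidWithZeroHom.one_apply_of_ne_zero hp, ← Complex.exp_nat_mul]
  congr 2; push_cast; ring

lemma R_pow (f : ℕ →*₀ ℂ) (hf : ∀ n ≠ 0, ‖f n‖ = 1) {d : ℕ} (hd : ∀ n ≠ 0, f n ^ d = 1)
    {σ : ℝ} (hσ : 1 < σ) (t : ℝ) :
    ((‖FH f σ t‖ / Zt σ) ^ 2) ^ (d ^ 2) ≤ (‖FH 1 σ (d * t)‖ / Zt σ) ^ 2 := by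
  refine le_of_tendsto_of_tendsto' ((prod_FH f hf hσ t).pow (d^2)) (prod_FH 1 (fun n hn => by simp [MonoidWithZeroHom.one_apply_of_ne_zero hn]) hσ (d * t)) fun n => ?_
  rw [← Finset.prod_pow]
  refine Finset.prod_le_prod (fun p _ => ?_) fun p hp => ?_
  · have := Qf_ge (x := (p:ℝ)^(-σ)) (b := ‖1 - zp f t p‖ ^ 2) (by positivity) (by positivity)
    positivity
  · have hpp := Nat.prime_of_mem_primesBelow hp
    have h1 := Qf_ge (x := (p:ℝ)^(-σ)) (b := ‖1 - zp 1 (d * t) p‖ ^ 2) (by positivity) (by positivity)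
    rw [inv_pow]
    apply inv_anti₀ (by linarith)
    rw [← zp_pow (hd p hpp.ne_zero) hpp.ne_zero]
    have h2 := norm_one_sub_pow _ (norm_zp (hf p hpp.ne_zero) t) d
    have h3 : 0 ≤ (p:ℝ)^(-σ) * ‖1 - zp f t p‖ ^ 2 / (1 - (p:ℝ)^(-σ)) ^ 2 := by positivity
    have h4 := one_add_mul_le_pow (show (-2:ℝ) ≤ _ by linarith) (d^2)
    refine le_trans ?_ h4
    unfold Qf
    have h5 : ‖1 - zp f t p ^ d‖ ^ 2 ≤ (d * ‖1 - zp f t p‖) ^ 2 := by gcongr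
    have : ((d^2 : ℕ):ℝ) * ((p:ℝ)^(-σ) * ‖1 - zp f t p‖ ^ 2 / (1 - (p:ℝ)^(-σ)) ^ 2) = (p:ℝ)^(-σ) * (d * ‖1 - zp f t p‖) ^ 2 / (1 - (p:ℝ)^(-σ)) ^ 2 := by
      push_cast; ring
    rw [this]
    gcongr

end

section
open Filter Topology Finset

lemma R_pt_ne (f : ℕ →*₀ ℂ) (hf : ∀ n ≠ 0, ‖f n‖ = 1) {d : ℕ} (hd0 : d ≠ 0) (hd : ∀ n ≠ 0, f n ^ d = 1)
    {t : ℝ} (ht : t ≠ 0) {ε : ℝ} (hε : 0 < ε) : ∃ σ : ℝ, 1 < σ ∧ (‖FH f σ t‖ / Zt σ) ^ 2 < ε := by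
  have h1 : Tendsto (fun σ : ℝ => (‖riemannZeta (σ + (d * t : ℝ) * Complex.I)‖ * (σ - 1) / ((σ - 1) * Zt σ)) ^ 2) (𝓝[>] 1) (𝓝 ((‖riemannZeta ((1:ℝ) + (d * t : ℝ) * Complex.I)‖ * ((1:ℝ) - 1) / 1) ^ 2)) := by
    refine ((Tendsto.mul ?_ ?_).div Zt_tendsto one_ne_zero).pow 2
    · refine (Tendsto.norm ?_)
      have hc : ContinuousAt riemannZeta ((1:ℝ) + (d * t : ℝ) * Complex.I) := by
        refine (differentiableAt_riemannZeta ?_).continuousAt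
        intro h
        have := congrArg Complex.im h
        simp [hd0, ht] at this
      have h2 : Tendsto (fun σ : ℝ => (σ : ℂ) + (d * t : ℝ) * Complex.I) (𝓝[>] 1) (𝓝 ((1:ℝ) + (d * t : ℝ) * Complex.I)) := by
        refine Tendsto.mono_left ?_ nhdsWithin_le_nhds
        apply Continuous.tendsto
        fun_prop
      exact hc.tendsto.comp h2
    · refine Tendsto.mono_left ?_ nhdsWithin_le_nhds
      exact (continuous_id.sub continuous_const).tendsto _
  simp only [sub_self, mul_zero, zero_div, ne_eq, OfNat.ofNat_ne_zero, not_false_eq_true, zero_pow] at h1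
  have h3 := h1.eventually (gt_mem_nhds (show 0 < ε ^ (d^2) by positivity))
  obtain ⟨σ, h4, h5⟩ := (h3.and self_mem_nhdsWithin).exists
  have h5' : (1:ℝ) < σ := h5
  refine ⟨σ, h5', ?_⟩
  have h6 := R_pow f hf hd h5' t
  rw [FH_one h5'] at h6
  have h7 : ‖riemannZeta (σ + (d * t : ℝ) * Complex.I)‖ * (σ - 1) / ((σ - 1) * Zt σ) = ‖riemannZeta (σ + (d * t : ℝ) * Complex.I)‖ / Zt σ := by
    have : σ - 1 ≠ 0 := by linarith
    have : Zt σ ≠ 0 := by linarith [Zt_ge_one h5']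
    field_simp
  rw [h7] at h4
  exact lt_of_pow_lt_pow_left₀ (d^2) hε.le (h6.trans_lt h4)

lemma prod_inv_le (s : Finset ℕ) (a : ℕ → ℝ) (ha : ∀ i ∈ s, 0 ≤ a i) :
    1 + ∑ i ∈ s, a i ≤ ∏ i ∈ s, (1 + a i) := by
  classical
  induction s using Finset.induction_on with
  | empty => simp
  | insert x s hx ih =>
    rw [Finset.sum_insert hx, Finset.prod_insert hx]
    have h1 := ih (fun i hi => ha i (Finset.mem_insert_of_mem hi))
    have h2 := ha x (Finset.mem_insert_self _ _)
    have h3 : 0 ≤ ∑ i ∈ s, a i := Finset.sum_nonneg fun i hi => ha i (Finset.mem_insert_of_mem hi)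
    nlinarith

lemma prod_le_sub {ι : Type*} {s t : Finset ι} {a : ι → ℝ} (h : s ⊆ t) (h0 : ∀ i ∈ t, 0 ≤ a i)
    (h1 : ∀ i ∈ t, i ∉ s → a i ≤ 1) : ∏ i ∈ t, a i ≤ ∏ i ∈ s, a i := by
  classical
  rw [← Finset.prod_sdiff h]
  refine mul_le_of_le_one_left (Finset.prod_nonneg fun i hi => h0 i (h hi)) ?_
  refine Finset.prod_le_one (fun i hi => h0 i (Finset.sdiff_subset hi)) fun i hi => ?_
  exact h1 i (Finset.mem_sdiff.1 hi).1 (Finset.mem_sdiff.1 hi).2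

lemma R_pt_zero (f : ℕ →*₀ ℂ) (hf : ∀ n ≠ 0, ‖f n‖ = 1) {c : ℝ} (hc : 0 < c) (m0 : ℕ)
    (hfc : ∀ p : ℕ, p.Prime → m0 < p → c ≤ ‖1 - f p‖ ^ 2) 
    {ε : ℝ} (hε : 0 < ε) : ∃ σ : ℝ, 1 < σ ∧ (‖FH f σ 0‖ / Zt σ) ^ 2 < ε := by
  classical
  -- divergence
  set K := 1 / (c * ε) with hK
  obtain ⟨n, hn⟩ : ∃ n : ℕ, K + 1 < ∑ p ∈ (Nat.primesBelow n).filter (fun p => m0 < p), (1 / p : ℝ) := by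
    by_contra hcon
    push Not at hcon
    refine not_summable_one_div_on_primes ?_
    refine summable_of_sum_range_le (c := K + 1 + ∑ p ∈ range (m0+1), (1 / p : ℝ)) ?_ ?_
    · intro i; unfold Set.indicator; split_ifs <;> positivity
    · intro N
      have h1 := hcon N
      have h2 : ∑ i ∈ range N, ({p : ℕ | p.Prime}.indicator (fun n => (1 / n : ℝ)) i) = ∑ p ∈ Nat.primesBelow N, (1 / p : ℝ) := by
        rw [Nat.primesBelow, Finset.sum_filter]
        exact Finset.sum_congr rfl fun i _ => by simp [Set.indicator]
      rw [h2, ← Finset.sum_filter_add_sum_filter_not (Nat.primesBelow N) (fun p => m0 < p)]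
      gcongr
      · intro p hp
        simp at hp ⊢
        omega
  set s := (Nat.primesBelow n).filter (fun p => m0 < p) with hs
  have h1 : Tendsto (fun σ : ℝ => ∑ p ∈ s, (p:ℝ) ^ (-σ)) (𝓝[>] 1) (𝓝 (∑ p ∈ s, (p:ℝ) ^ (-(1:ℝ)))) := by
    refine Tendsto.mono_left ?_ nhdsWithin_le_nhds
    refine tendsto_finsetSum _ fun p hp => ?_
    have hp0 : (p:ℝ) ≠ 0 := by
      have := Nat.prime_of_mem_primesBelow (Finset.mem_filter.1 hp).1
      exact_mod_cast this.ne_zero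
    exact (Real.continuous_const_rpow hp0).tendsto _ |>.comp (continuous_neg.tendsto _)
  have h2 : K < ∑ p ∈ s, (p:ℝ) ^ (-(1:ℝ)) := by
    have : ∑ p ∈ s, (p:ℝ) ^ (-(1:ℝ)) = ∑ p ∈ s, (1 / p : ℝ) := by
      refine Finset.sum_congr rfl fun p _ => ?_
      rw [Real.rpow_neg_one, one_div]
    linarith
  obtain ⟨σ, h3, h4⟩ := ((h1.eventually (lt_mem_nhds h2)).and self_mem_nhdsWithin).exists
  have h4' : (1:ℝ) < σ := h4
  refine ⟨σ, h4', ?_⟩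
  have h5 : (‖FH f σ 0‖ / Zt σ) ^ 2 ≤ ∏ p ∈ Nat.primesBelow n, (Qf ((p:ℝ) ^ (-σ)) (‖1 - zp f 0 p‖ ^ 2))⁻¹ := by
    refine Antitone.le_of_tendsto ?_ (prod_FH f hf h4' 0) n
    intro a b hab
    refine prod_le_sub ?_ ?_ ?_
    · intro p hp
      simp [Nat.primesBelow] at hp ⊢
      exact ⟨by omega, hp.2⟩
    · intro p hp
      have := Qf_ge (x := (p:ℝ)^(-σ)) (b := ‖1 - zp f 0 p‖ ^ 2) (by positivity) (by positivity)
      positivity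
    · intro p hp _
      have := Qf_ge (x := (p:ℝ)^(-σ)) (b := ‖1 - zp f 0 p‖ ^ 2) (by positivity) (by positivity)
      exact inv_le_one_of_one_le₀ this
  have h6 : ∏ p ∈ Nat.primesBelow n, (Qf ((p:ℝ) ^ (-σ)) (‖1 - zp f 0 p‖ ^ 2))⁻¹ ≤ ∏ p ∈ s, (1 + c * (p:ℝ) ^ (-σ))⁻¹ := by
    refine (prod_le_sub (Finset.filter_subset (fun p => m0 < p) _) ?_ ?_).trans ?_
    · intro p hp
      have := Qf_ge (x := (p:ℝ)^(-σ)) (b := ‖1 - zp f 0 p‖ ^ 2) (by positivity) (by positivity)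
      positivity
    · intro p hp _
      have := Qf_ge (x := (p:ℝ)^(-σ)) (b := ‖1 - zp f 0 p‖ ^ 2) (by positivity) (by positivity)
      exact inv_le_one_of_one_le₀ this
    · refine Finset.prod_le_prod (fun p hp => ?_) (fun p hp => ?_)
      · have := Qf_ge (x := (p:ℝ)^(-σ)) (b := ‖1 - zp f 0 p‖ ^ 2) (by positivity) (by positivity)
        positivity
      · have hp' := Finset.mem_filter.1 hp
        have hpp := Nat.prime_of_mem_primesBelow hp'.1
        apply inv_anti₀ (by positivity)
        have h7 := hfc p hpp hp'.2
        have h8 : zp f 0 p = f p := by simp [zp]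
        rw [h8, Qf]
        have h9 := prime_rpow_lt h4' hpp
        have h10 : 0 < (p:ℝ)^(-σ) := by have := hpp.pos; positivity
        have h11 : (1 - (p:ℝ)^(-σ)) ^ 2 ≤ 1 := by
          apply pow_le_one₀ <;> linarith
        have h12 : 0 < (1 - (p:ℝ)^(-σ)) ^ 2 := by
          have : 0 < 1 - (p:ℝ)^(-σ) := by linarith
          positivity
        have : c * (p:ℝ)^(-σ) ≤ (p:ℝ)^(-σ) * ‖1 - f p‖ ^ 2 / (1 - (p:ℝ)^(-σ)) ^ 2 := by
          rw [le_div_iff₀ h12]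
          calc c * (p:ℝ)^(-σ) * (1 - (p:ℝ)^(-σ)) ^ 2 ≤ c * (p:ℝ)^(-σ) * 1 := by gcongr
            _ ≤ _ := by rw [mul_one, mul_comm]; gcongr
        linarith
  refine (h5.trans h6).trans_lt ?_
  rw [Finset.prod_inv_distrib]
  have h7 := prod_inv_le s (fun p => c * (p:ℝ) ^ (-σ)) (fun p _ => by positivity)
  rw [← Finset.mul_sum] at h7
  have h8 : 1 / ε < 1 + c * ∑ p ∈ s, (p:ℝ) ^ (-σ) := by
    have : c * K = 1 / ε := by rw [hK]; field_simp
    nlinarith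
  have h9 : 0 < 1 / ε := by positivity
  calc _ ≤ (1 + c * ∑ p ∈ s, (p:ℝ) ^ (-σ))⁻¹ := inv_anti₀ (by linarith) h7
    _ < (1 / ε)⁻¹ := by
      apply inv_strictAnti₀ h9 h8
    _ = ε := by simp

/-- uniform decay -/
lemma R_unif (f : ℕ →*₀ ℂ) (hf : ∀ n ≠ 0, ‖f n‖ = 1) {d : ℕ} (hd0 : d ≠ 0) (hd : ∀ n ≠ 0, f n ^ d = 1)
    {c : ℝ} (hc : 0 < c) (m0 : ℕ)
    (hfc : ∀ p : ℕ, p.Prime → m0 < p → c ≤ ‖1 - f p‖ ^ 2) (T : ℝ)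
    {ε : ℝ} (hε : 0 < ε) : ∃ δ : ℝ, 0 < δ ∧ ∀ σ, 1 < σ → σ < 1 + δ → ∀ t : ℝ, |t| ≤ T → ‖FH f σ t‖ * (σ - 1) ≤ ε := by
  have hf' : ∀ n, ‖f n‖ ≤ 1 := fun n => by
    rcases eq_or_ne n 0 with rfl | hn
    · simp
    · exact (hf n hn).le
  obtain ⟨δ0, hδ0, hZ⟩ := Zt_le
  have key : ∃ δ : ℝ, 0 < δ ∧ ∀ σ, 1 < σ → σ < 1 + δ → ∀ t ∈ Set.Icc (-T) T, (‖FH f σ t‖ / Zt σ) ^ 2 < (ε/2) ^ 2 := by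
    refine isCompact_Icc.induction_on (p := fun s => ∃ δ : ℝ, 0 < δ ∧ ∀ σ, 1 < σ → σ < 1 + δ → ∀ t ∈ s, (‖FH f σ t‖ / Zt σ) ^ 2 < (ε/2) ^ 2) ?_ ?_ ?_ ?_
    · exact ⟨1, one_pos, by simp⟩
    · rintro s t hst ⟨δ, h1, h2⟩
      exact ⟨δ, h1, fun σ a b u hu => h2 σ a b u (hst hu)⟩
    · rintro s t ⟨δ, h1, h2⟩ ⟨δ', h1', h2'⟩
      refine ⟨min δ δ', lt_min h1 h1', fun σ a b u hu => ?_⟩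
      rcases hu with hu | hu
      · exact h2 σ a (by linarith [min_le_left δ δ']) u hu
      · exact h2' σ a (by linarith [min_le_right δ δ']) u hu
    · intro t _
      obtain ⟨σ0, h0, h1⟩ : ∃ σ : ℝ, 1 < σ ∧ (‖FH f σ t‖ / Zt σ) ^ 2 < (ε/2)^2 := by
        rcases eq_or_ne t 0 with rfl | ht
        · exact R_pt_zero f hf hc m0 hfc (by positivity)
        · exact R_pt_ne f hf hd0 hd ht (by positivity)
      have hcont : Continuous (fun u => (‖FH f σ0 u‖ / Zt σ0) ^ 2) := by
        have := cont_FH f hf' h0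
        fun_prop
      have h2 := hcont.tendsto t |>.eventually (gt_mem_nhds h1)
      refine ⟨_, mem_nhdsWithin_of_mem_nhds h2, σ0 - 1, by linarith, fun σ a b u hu => ?_⟩
      exact (R_mono f hf a (by linarith) u).trans_lt hu
  obtain ⟨δ, h1, h2⟩ := key
  refine ⟨min δ δ0, lt_min h1 hδ0, fun σ a b t ht => ?_⟩
  have h3 := h2 σ a (by linarith [min_le_left δ δ0]) t (abs_le.1 ht)
  have h4 := hZ σ a (by linarith [min_le_right δ δ0])
  have h5 := lt_of_pow_lt_pow_left₀ 2 (by positivity) h3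
  have h6 := Zt_ge_one a
  rw [div_lt_iff₀ (by linarith)] at h5
  have : 0 < σ - 1 := by linarith
  calc ‖FH f σ t‖ * (σ - 1) ≤ (ε / 2 * Zt σ) * (σ - 1) := by gcongr
    _ = ε / 2 * ((σ - 1) * Zt σ) := by ring
    _ ≤ ε / 2 * 2 := by gcongr
    _ = ε := by ring

end

section
open Filter Topology Finset MeasureTheory ComplexConjugate

lemma integrable_tsum_aux {ι : Type*} [Countable ι] {F : ι → ℝ → ℂ}
    (hm : AEStronglyMeasurable (fun x => ∑' i, F i x) volume)
    (hF : ∀ i, Integrable (F i)) (hsum : Summable fun i => ∫ x, ‖F i x‖) :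
    Integrable (fun x => ∑' i, F i x) := by
  refine ⟨hm, ?_⟩
  have this (i : ι) : ∫⁻ a, ‖F i a‖ₑ = ‖∫ a, ‖F i a‖‖ₑ := by
    dsimp [enorm]
    rw [lintegral_coe_eq_integral _ (hF i).norm, ENNReal.coe_nnreal_eq, coe_nnnorm,
      Real.norm_of_nonneg (integral_nonneg (fun a ↦ norm_nonneg (F i a)))]
    simp only [coe_nnnorm]
  calc ∫⁻ a, ‖∑' i, F i a‖ₑ ≤ ∫⁻ a, ∑' i, ‖F i a‖ₑ := lintegral_mono fun a => enorm_tsum_le_tsum_enorm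
    _ = ∑' i, ∫⁻ a, ‖F i a‖ₑ := lintegral_tsum fun i => (hF i).1.enorm
    _ < ⊤ := by
      rw [funext this]
      exact (ENNReal.tsum_coe_ne_top_iff_summable.2 <| NNReal.summable_coe.1 hsum.abs).lt_top

lemma pl_gen {g : ℕ → ℝ → ℂ} {ω : ℝ → ℝ} {a : ℕ → ℂ} (hω : ∀ w, 0 ≤ ω w) (hωc : Continuous ω)
    (hgc : ∀ n, Continuous (g n)) (hg1 : ∀ n w, ‖g n w‖ ≤ 1) (ha : Summable fun n => ‖a n‖) {C : ℝ}
    (hintegr : ∀ m n, Integrable (fun w => g m w * conj (g n w) * ω w))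
    (hC : ∀ m n, ∫ w, ‖g m w * conj (g n w) * ω w‖ ≤ C) :
    Integrable (fun w => ‖∑' n, a n * g n w‖ ^ 2 * ω w) ∧
    ((∫ w, ‖∑' n, a n * g n w‖ ^ 2 * ω w : ℝ) : ℂ) =
      ∑' p : ℕ × ℕ, a p.1 * conj (a p.2) * ∫ w, g p.1 w * conj (g p.2 w) * ω w := by
  have hs : ∀ w, Summable fun n => ‖a n * g n w‖ := fun w =>
    ha.of_nonneg_of_le (fun _ => norm_nonneg _) fun n => by
      rw [norm_mul]; exact mul_le_of_le_one_right (norm_nonneg _) (hg1 n w)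
  have hcont : Continuous fun w => ∑' n, a n * g n w :=
    continuous_tsum (fun n => continuous_const.mul (hgc n)) ha fun n w => by
      rw [norm_mul]; exact mul_le_of_le_one_right (norm_nonneg _) (hg1 n w)
  have hexp : ∀ w, ((‖∑' n, a n * g n w‖ ^ 2 * ω w : ℝ) : ℂ) =
      ∑' p : ℕ × ℕ, a p.1 * conj (a p.2) * (g p.1 w * conj (g p.2 w) * ω w) := by
    intro w
    have h2 : Summable fun n => ‖conj (a n * g n w)‖ := by simpa using hs w
    have h1 := tsum_mul_tsum_of_summable_norm (hs w) h2
    have h3 : ((‖∑' n, a n * g n w‖ ^ 2 : ℝ) : ℂ) = (∑' n, a n * g n w) * ∑' n, conj (a n * g n w) := by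
      rw [← Complex.conj_tsum, Complex.mul_conj, Complex.normSq_eq_norm_sq]
    rw [Complex.ofReal_mul, h3, h1, ← tsum_mul_right]
    congr 1; ext p
    simp only [map_mul]; ring
  have hS : Summable fun p : ℕ × ℕ => ‖a p.1‖ * ‖a p.2‖ := by
    have := ha.mul_norm ha
    simpa using this
  have hi : ∀ p : ℕ × ℕ, Integrable fun w => a p.1 * conj (a p.2) * (g p.1 w * conj (g p.2 w) * ω w) :=
    fun p => (hintegr p.1 p.2).const_mul _
  have hsm : Summable fun p : ℕ × ℕ => ∫ w, ‖a p.1 * conj (a p.2) * (g p.1 w * conj (g p.2 w) * ω w)‖ := by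
    refine (hS.mul_right C).of_nonneg_of_le (fun p => integral_nonneg fun w => norm_nonneg _) fun p => ?_
    simp_rw [norm_mul (a p.1 * conj (a p.2))]
    rw [integral_const_mul, norm_mul, RCLike.norm_conj]
    exact mul_le_mul_of_nonneg_left (hC p.1 p.2) (by positivity)
  have hc2 : Continuous fun w => ‖∑' n, a n * g n w‖ ^ 2 * ω w := by fun_prop
  constructor
  · have h4 := integrable_tsum_aux (by simp_rw [← hexp]; exact (Complex.continuous_ofReal.comp hc2).aestronglyMeasurable) hi hsm
    simp_rw [← hexp] at h4
    exact (h4.re).congr (ae_of_all _ fun w => Complex.ofReal_re _)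
  · rw [← integral_complex_ofReal]
    simp_rw [hexp]
    rw [← integral_tsum_of_summable_integral_norm hi hsm]
    congr 1; ext p
    rw [integral_const_mul]

noncomputable def gau (B u : ℝ) : ℝ := Real.exp (-B * u ^ 2)

lemma gau_shift_int {B : ℝ} (hB : 0 < B) (α β : ℝ) :
    Integrable (fun w => gau B (w - α) * gau B (w - β)) ∧
    ∫ w, gau B (w - α) * gau B (w - β) = √(Real.pi / (2 * B)) * Real.exp (-B * (α - β) ^ 2 / 2) := by
  have h : ∀ w, gau B (w - α) * gau B (w - β) = Real.exp (-B * (α - β) ^ 2 / 2) * Real.exp (-(2 * B) * (w - (α + β)/2) ^ 2) := by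
    intro w; rw [gau, gau, ← Real.exp_add, ← Real.exp_add]; congr 1; ring
  simp_rw [h]
  have hI := integrable_exp_neg_mul_sq (show 0 < 2 * B by positivity)
  refine ⟨(hI.comp_sub_right ((α+β)/2)).const_mul _, ?_⟩
  rw [integral_const_mul, integral_sub_right_eq_self (fun x => Real.exp (-(2*B) * x^2)), integral_gaussian, mul_comm]

lemma gau_four {B : ℝ} (hB : 0 < B) (α β : ℝ) :
    ∫ t : ℝ, Complex.exp (-(t * α : ℝ) * Complex.I) * conj (Complex.exp (-(t * β : ℝ) * Complex.I)) * (Real.exp (- t ^ 2 / (2 * B)) : ℝ) =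
      ((√(2 * Real.pi * B) * Real.exp (-B * (α - β) ^ 2 / 2) : ℝ) : ℂ) := by
  have h := fourierIntegral_gaussian (b := ((1 / (2 * B) : ℝ) : ℂ)) (by rw [Complex.ofReal_re]; positivity) ((β - α : ℝ) : ℂ)
  have e1 : ∀ t : ℝ, Complex.exp (-(t * α : ℝ) * Complex.I) * conj (Complex.exp (-(t * β : ℝ) * Complex.I)) * (Real.exp (- t ^ 2 / (2 * B)) : ℝ) = Complex.exp (Complex.I * ((β - α : ℝ) : ℂ) * t) * Complex.exp (-((1 / (2 * B) : ℝ) : ℂ) * t ^ 2) := by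
    intro t
    rw [← Complex.exp_conj, ← Complex.exp_add, Complex.ofReal_exp, ← Complex.exp_add, ← Complex.exp_add]
    congr 1
    simp only [map_mul, Complex.conj_I, map_neg, Complex.conj_ofReal]
    push_cast; ring
  simp_rw [e1]
  rw [h]
  push_cast
  congr 1
  · rw [Real.sqrt_eq_rpow, Complex.ofReal_cpow (by positivity)]
    congr 1
    · push_cast
      have : (B:ℂ) ≠ 0 := by exact_mod_cast hB.ne'
      field_simp
    · norm_num
  · congr 1
    have : (B:ℂ) ≠ 0 := by exact_mod_cast hB.ne'
    field_simp
    ring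

lemma pl {B : ℝ} (hB : 0 < B) {a : ℕ → ℂ} (ha : Summable fun n => ‖a n‖) (l : ℕ → ℝ) :
    Integrable (fun w => ‖∑' n, a n * (gau B (w - l n) : ℝ)‖ ^ 2) ∧
    Integrable (fun t : ℝ => ‖∑' n, a n * Complex.exp (-(t * l n : ℝ) * Complex.I)‖ ^ 2 * Real.exp (- t ^ 2 / (2 * B))) ∧
    ∫ w, ‖∑' n, a n * (gau B (w - l n) : ℝ)‖ ^ 2 =
      1 / (2 * B) * ∫ t : ℝ, ‖∑' n, a n * Complex.exp (-(t * l n : ℝ) * Complex.I)‖ ^ 2 * Real.exp (- t ^ 2 / (2 * B)) := by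
  have hp : ∀ u, 0 < gau B u := fun u => Real.exp_pos _
  have hp1 : ∀ u, gau B u ≤ 1 := fun u => Real.exp_le_one_iff.2 (by nlinarith [sq_nonneg u])
  obtain ⟨i1, e1⟩ := pl_gen (g := fun n w => ((gau B (w - l n) : ℝ) : ℂ)) (ω := fun _ => 1) (a := a) (C := √(Real.pi / (2 * B)))
    (fun _ => zero_le_one) continuous_const (fun n => by unfold gau; fun_prop) (fun n w => by
      rw [Complex.norm_real, Real.norm_eq_abs, abs_of_pos (hp _)]; exact hp1 _) ha
    (fun m n => by
      have := (gau_shift_int hB (l m) (l n)).1.ofReal (𝕜 := ℂ)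
      simpa using this)
    (fun m n => by
      have h := (gau_shift_int hB (l m) (l n)).2
      have : ∀ w, ‖((gau B (w - l m) : ℝ) : ℂ) * conj ((gau B (w - l n) : ℝ) : ℂ) * ((1:ℝ):ℂ)‖ = gau B (w - l m) * gau B (w - l n) := by
        intro w
        rw [Complex.conj_ofReal, norm_mul, norm_mul, Complex.norm_real, Complex.norm_real, Real.norm_eq_abs, Real.norm_eq_abs, abs_of_pos (hp _), abs_of_pos (hp _)]; simp
      simp_rw [this]
      rw [h]
      exact mul_le_of_le_one_right (Real.sqrt_nonneg _) (Real.exp_le_one_iff.2 (by nlinarith [sq_nonneg (l m - l n)])))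
  have hI : Integrable (fun t : ℝ => Real.exp (-t ^ 2 / (2 * B))) := by
    have := integrable_exp_neg_mul_sq (show 0 < 1 / (2 * B) by positivity)
    refine this.congr (ae_of_all _ fun t => ?_)
    simp only; congr 1; ring
  have hn : ∀ m n, ∀ t : ℝ, ‖Complex.exp (-(t * l m : ℝ) * Complex.I) * conj (Complex.exp (-(t * l n : ℝ) * Complex.I)) * (Real.exp (- t ^ 2 / (2 * B)) : ℝ)‖ = Real.exp (- t ^ 2 / (2 * B)) := by
    intro m n t
    rw [norm_mul, norm_mul, RCLike.norm_conj, norm_exp_it, norm_exp_it, Complex.norm_real, Real.norm_eq_abs, abs_of_pos (Real.exp_pos _)]; simp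
  obtain ⟨i2, e2⟩ := pl_gen (g := fun n t => Complex.exp (-(t * l n : ℝ) * Complex.I)) (ω := fun t => Real.exp (- t ^ 2 / (2 * B))) (a := a) (C := ∫ t : ℝ, Real.exp (-t ^ 2 / (2 * B)))
    (fun _ => (Real.exp_pos _).le) (by fun_prop) (fun n => by fun_prop) (fun n w => (norm_exp_it _).le) ha
    (fun m n => by
      refine hI.mono' (by apply Continuous.aestronglyMeasurable; fun_prop) (ae_of_all _ fun t => (hn m n t).le))
    (fun m n => by simp_rw [hn m n]; exact le_rfl)
  simp only [mul_one] at i1 e1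
  refine ⟨i1, i2, ?_⟩
  rw [← Complex.ofReal_inj, e1, Complex.ofReal_mul, e2, ← tsum_mul_left]
  congr 1; ext p
  rw [gau_four hB]
  have : ∀ w, ((gau B (w - l p.1) : ℝ) : ℂ) * conj ((gau B (w - l p.2) : ℝ) : ℂ) * ((1:ℝ):ℂ) = ((gau B (w - l p.1) * gau B (w - l p.2) : ℝ) : ℂ) := by
    intro w; simp
  simp_rw [this]
  rw [integral_complex_ofReal, (gau_shift_int hB _ _).2, mul_left_comm, ← Complex.ofReal_mul]
  congr 2
  rw [← mul_assoc]
  congr 1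
  rw [show Real.pi / (2 * B) = (2 * Real.pi * B) / (2 * B) ^ 2 by field_simp, Real.sqrt_div (by positivity), Real.sqrt_sq (by positivity)]
  ring

end

section
open Filter Topology Finset MeasureTheory ComplexConjugate

lemma norm_tsum_le_of_range {a : ℕ → ℂ} {b : ℕ → ℝ} {C : ℝ} (hab : ∀ n, ‖a n‖ ≤ b n)
    (hb : ∀ N, ∑ n ∈ range N, b n ≤ C) : ‖∑' n, a n‖ ≤ C := by
  have hb0 : ∀ n, 0 ≤ b n := fun n => (norm_nonneg _).trans (hab n)
  have hs : Summable b := summable_of_sum_range_le hb0 hb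
  have h1 : Summable fun n => ‖a n‖ := hs.of_nonneg_of_le (fun _ => norm_nonneg _) hab
  exact ((norm_tsum_le_tsum_norm h1).trans (h1.tsum_le_tsum hab hs)).trans (Real.tsum_le_of_sum_range_le hb0 hb)

/-- pointwise dyadic majorant -/
lemma C1_pt (y : ℝ) (hy : 0 < y) (n : ℕ) (hn : 0 < n) (J : ℕ) (hJ : (n:ℝ) ≤ 2 ^ J * y) :
    (n:ℝ)⁻¹ * Real.exp (-2 * |Real.log y - Real.log n|) ≤
      y⁻¹ * (8 * ∑ j ∈ range (J+1), if (n:ℝ) ≤ 2 ^ j * y then (1/8:ℝ) ^ j else 0) := by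
  classical
  have hn' : (0:ℝ) < n := by exact_mod_cast hn
  rcases le_or_gt (n:ℝ) y with h | h
  · have h1 : (1:ℝ) ≤ ∑ j ∈ range (J+1), if (n:ℝ) ≤ 2 ^ j * y then (1/8:ℝ) ^ j else 0 := by
      have := Finset.single_le_sum (f := fun j => if (n:ℝ) ≤ 2 ^ j * y then (1/8:ℝ) ^ j else 0) (s := range (J+1))
        (fun j _ => by positivity) (show 0 ∈ range (J+1) by simp)
      simpa [h] using this
    have h2 : Real.exp (-2 * |Real.log y - Real.log n|) = (n / y) ^ 2 := by
      rw [abs_of_nonneg (by linarith [Real.log_le_log hn' h]), show -2 * (Real.log y - Real.log n) = 2 * (Real.log n - Real.log y) by ring,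
        ← Real.log_div hn'.ne' hy.ne', two_mul, Real.exp_add, Real.exp_log (by positivity)]; ring
    rw [h2]
    calc (n:ℝ)⁻¹ * (n / y) ^ 2 = y⁻¹ * (n / y) := by field_simp
      _ ≤ y⁻¹ * 1 := by gcongr; rw [div_le_one hy]; exact h
      _ ≤ _ := by gcongr; linarith
  · have hex : ∃ j, (n:ℝ) ≤ 2 ^ j * y := ⟨J, hJ⟩
    set j := Nat.find hex with hj
    have h1 : (n:ℝ) ≤ 2 ^ j * y := Nat.find_spec hex
    have hj0 : j ≠ 0 := by intro h0; rw [h0] at h1; simp at h1; linarith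
    obtain ⟨i, hi⟩ := Nat.exists_eq_succ_of_ne_zero hj0
    have h3 : ¬ (n:ℝ) ≤ 2 ^ i * y := Nat.find_min hex (by rw [← hj]; omega)
    push Not at h3
    have hjJ : j ≤ J := Nat.find_min' hex hJ
    have h4 : (1/8:ℝ)^j ≤ ∑ j ∈ range (J+1), if (n:ℝ) ≤ 2 ^ j * y then (1/8:ℝ) ^ j else 0 := by
      have := Finset.single_le_sum (f := fun j => if (n:ℝ) ≤ 2 ^ j * y then (1/8:ℝ) ^ j else 0) (s := range (J+1))
        (fun j _ => by positivity) (show j ∈ range (J+1) by simp; omega)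
      simpa [h1] using this
    have h2 : Real.exp (-2 * |Real.log y - Real.log n|) = (y / n) ^ 2 := by
      rw [abs_of_nonpos (by linarith [Real.log_le_log hy h.le]), show -2 * -(Real.log y - Real.log n) = 2 * (Real.log y - Real.log n) by ring,
        ← Real.log_div hy.ne' hn'.ne', two_mul, Real.exp_add, Real.exp_log (by positivity)]; ring
    rw [h2]
    have h5 : y / n ≤ (1/2)^i := by
      rw [div_le_iff₀ hn', one_div, inv_pow, ← div_eq_inv_mul, le_div_iff₀ (by positivity)]
      linarith
    calc (n:ℝ)⁻¹ * (y / n) ^ 2 = y⁻¹ * (y / n)^3 := by field_simp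
      _ ≤ y⁻¹ * ((1/2)^i)^3 := by gcongr
      _ = y⁻¹ * (8 * (1/8)^j) := by
        rw [hi, ← pow_mul, mul_comm i 3, pow_mul, pow_succ]; norm_num; left; ring
      _ ≤ _ := by gcongr

lemma C1_fin {c : ℕ → ℝ} {C0 : ℝ} (hc : ∀ n, 0 ≤ c n) 
    (hC : ∀ y : ℝ, 0 < y → ∑ n ∈ Ioc 0 ⌊y⌋₊, c n ≤ C0 * y) {η : ℝ} (h0 : 0 < η) (h1 : η ≤ 1) (w : ℝ) (N : ℕ) :
    ∑ n ∈ range N, c n * (n:ℝ) ^ (-(1 + η)) * Real.exp (-3 * |w - Real.log n|) ≤ 11 * C0 * Real.exp (-η * |w|) := by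
  set y := Real.exp w with hy
  have hy0 : 0 < y := Real.exp_pos w
  have hw : w = Real.log y := by rw [hy, Real.log_exp]
  have hC0 : 0 ≤ C0 := by
    have := hC 1 one_pos
    have h2 := Finset.sum_nonneg (s := Ioc 0 ⌊(1:ℝ)⌋₊) (fun n _ => hc n)
    linarith
  obtain ⟨J, hJ⟩ : ∃ J : ℕ, (N:ℝ) ≤ 2 ^ J * y := by
    obtain ⟨J, hJ⟩ := pow_unbounded_of_one_lt ((N:ℝ)/y) (one_lt_two)
    exact ⟨J, by rw [div_lt_iff₀ hy0] at hJ; exact hJ.le⟩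
  have hpt : ∀ n ∈ range N, c n * (n:ℝ) ^ (-(1 + η)) * Real.exp (-3 * |w - Real.log n|) ≤
      Real.exp (-η * |w|) * (y⁻¹ * 8) * ∑ j ∈ range (J+1), (1/8:ℝ)^j * (if (0 < n ∧ (n:ℝ) ≤ 2 ^ j * y) then c n else 0) := by
    intro n hn
    rcases Nat.eq_zero_or_pos n with rfl | hn0
    · rw [Nat.cast_zero, Real.zero_rpow (by linarith)]; simp
    have hn' : (0:ℝ) < n := by exact_mod_cast hn0
    have hl : 0 ≤ Real.log n := Real.log_natCast_nonneg n
    have hnJ : (n:ℝ) ≤ 2 ^ J * y := by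
      have : (n:ℝ) ≤ N := by exact_mod_cast (Finset.mem_range.1 hn).le
      linarith
    have e1 : (n:ℝ) ^ (-(1 + η)) * Real.exp (-3 * |w - Real.log n|) ≤ Real.exp (-η * |w|) * ((n:ℝ)⁻¹ * Real.exp (-2 * |w - Real.log n|)) := by
      rw [Real.rpow_def_of_pos hn', ← Real.exp_add]
      have : (n:ℝ)⁻¹ = Real.exp (- Real.log n) := by rw [Real.exp_neg, Real.exp_log hn']
      rw [this, ← Real.exp_add, ← Real.exp_add]
      apply Real.exp_le_exp.2
      have h2 : |w| - Real.log n ≤ |w - Real.log n| := by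
        have := abs_sub_abs_le_abs_sub w (Real.log n)
        rwa [abs_of_nonneg hl] at this
      have h3 : η * (|w| - Real.log n) ≤ |w - Real.log n| := by
        have h4 := abs_nonneg (w - Real.log n)
        calc η * (|w| - Real.log n) ≤ η * |w - Real.log n| := by gcongr
          _ ≤ 1 * |w - Real.log n| := by gcongr
          _ = _ := one_mul _
      linarith
    have e2 := C1_pt y hy0 n hn0 J hnJ
    rw [← hw] at e2
    calc c n * (n:ℝ) ^ (-(1 + η)) * Real.exp (-3 * |w - Real.log n|) = c n * ((n:ℝ) ^ (-(1 + η)) * Real.exp (-3 * |w - Real.log n|)) := by ring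
      _ ≤ c n * (Real.exp (-η * |w|) * (y⁻¹ * (8 * ∑ j ∈ range (J+1), if (n:ℝ) ≤ 2 ^ j * y then (1/8:ℝ) ^ j else 0))) := by
        exact mul_le_mul_of_nonneg_left (e1.trans (mul_le_mul_of_nonneg_left e2 (Real.exp_pos _).le)) (hc n)
      _ = _ := by
        simp only [Finset.mul_sum]
        refine Finset.sum_congr rfl fun j _ => ?_
        by_cases h : (n:ℝ) ≤ 2 ^ j * y
        · simp [h, hn0]; ring
        · simp [h]
  refine (Finset.sum_le_sum hpt).trans ?_
  rw [← Finset.mul_sum, Finset.sum_comm]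
  have e3 : ∀ j ∈ range (J+1), ∑ n ∈ range N, (1/8:ℝ)^j * (if (0 < n ∧ (n:ℝ) ≤ 2 ^ j * y) then c n else 0) ≤ C0 * y * (1/4)^j := by
    intro j _
    rw [← Finset.mul_sum, ← Finset.sum_filter]
    have e4 : ∑ n ∈ (range N).filter (fun n : ℕ => 0 < n ∧ (n:ℝ) ≤ 2 ^ j * y), c n ≤ ∑ n ∈ Ioc 0 ⌊2 ^ j * y⌋₊, c n := by
      refine Finset.sum_le_sum_of_subset_of_nonneg ?_ fun n _ _ => hc n
      intro n hn
      simp only [Finset.mem_filter, Finset.mem_Ioc] at hn ⊢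
      exact ⟨hn.2.1, Nat.le_floor hn.2.2⟩
    calc _ ≤ (1/8:ℝ)^j * (C0 * (2 ^ j * y)) := by
          gcongr; exact e4.trans (hC _ (by positivity))
      _ = C0 * y * ((1/8)^j * 2^j) := by ring
      _ = _ := by rw [← mul_pow]; norm_num
  have e5 : ∑ j ∈ range (J+1), (1/4:ℝ)^j ≤ 4/3 := by
    rw [geom_sum_eq (by norm_num), div_le_iff_of_neg (by norm_num)]
    have : (0:ℝ) < (1/4)^(J+1) := by positivity
    linarith
  calc _ ≤ Real.exp (-η * |w|) * (y⁻¹ * 8) * ∑ j ∈ range (J+1), C0 * y * (1/4)^j := by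
        gcongr with j hj; exact e3 j hj
    _ = Real.exp (-η * |w|) * 8 * C0 * ∑ j ∈ range (J+1), (1/4:ℝ)^j := by
        rw [← Finset.mul_sum]; linear_combination (Real.exp (-η * |w|) * 8 * C0 * ∑ j ∈ range (J+1), (1/4:ℝ)^j) * (inv_mul_cancel₀ hy0.ne')
    _ ≤ Real.exp (-η * |w|) * 8 * C0 * (4/3) := by gcongr
    _ ≤ _ := by
      have : 0 ≤ Real.exp (-η * |w|) * C0 := by positivity
      linarith

lemma C1 {c : ℕ → ℝ} {C0 : ℝ} (hc : ∀ n, 0 ≤ c n) 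
    (hC : ∀ y : ℝ, 0 < y → ∑ n ∈ Ioc 0 ⌊y⌋₊, c n ≤ C0 * y) {η : ℝ} (h0 : 0 < η) (h1 : η ≤ 1)
    {a : ℕ → ℂ} (ha : ∀ n, ‖a n‖ ≤ c n * (n:ℝ) ^ (-(1 + η))) {k : ℝ → ℝ} {Ck : ℝ}
    (hk : ∀ u, |k u| ≤ Ck * Real.exp (-3 * |u|)) (w : ℝ) :
    ‖∑' n, a n * ((k (w - Real.log n) : ℝ) : ℂ)‖ ≤ 11 * C0 * Ck * Real.exp (-η * |w|) := by
  have hCk : 0 ≤ Ck := by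
    have := (abs_nonneg _).trans (hk 0); simpa using this
  refine norm_tsum_le_of_range (b := fun n => Ck * (c n * (n:ℝ) ^ (-(1 + η)) * Real.exp (-3 * |w - Real.log n|))) ?_ ?_
  · intro n
    rw [norm_mul, Complex.norm_real, Real.norm_eq_abs]
    have := hc n
    calc _ ≤ (c n * (n:ℝ) ^ (-(1 + η))) * (Ck * Real.exp (-3 * |w - Real.log n|)) := by
          gcongr
          · exact ha n
          · exact hk _
      _ = _ := by ring
  · intro N
    rw [← Finset.mul_sum]
    calc _ ≤ Ck * (11 * C0 * Real.exp (-η * |w|)) := by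
          gcongr; exact C1_fin hc hC h0 h1 w N
      _ = _ := by ring

lemma gau_le {B : ℝ} (hB : 1 ≤ B) (u : ℝ) : |gau B u| ≤ Real.exp 4 * Real.exp (-3 * |u|) := by
  rw [gau, abs_of_pos (Real.exp_pos _), ← Real.exp_add]
  apply Real.exp_le_exp.2
  rw [← sq_abs u]
  nlinarith [sq_nonneg (|u| - 3/2), sq_nonneg (|u|)]

lemma ugau_le {B : ℝ} (hB : 1 ≤ B) (u : ℝ) : |u * gau B u| ≤ Real.exp 4 * Real.exp (-3 * |u|) := by
  rw [abs_mul, gau, abs_of_pos (Real.exp_pos _), ← Real.exp_add]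
  have : |u| ≤ Real.exp |u| := by linarith [Real.add_one_le_exp |u|]
  calc _ ≤ Real.exp |u| * Real.exp (-B * u ^ 2) := by gcongr
    _ = Real.exp (|u| + -B * u^2) := by rw [Real.exp_add]
    _ ≤ _ := by
      apply Real.exp_le_exp.2
      rw [← sq_abs u]
      nlinarith [sq_nonneg (|u| - 2), sq_nonneg (|u|)]

end

section
open Filter Topology Finset MeasureTheory ComplexConjugate

noncomputable def aD (f : ℕ →*₀ ℂ) (η : ℝ) (n : ℕ) : ℂ := f n * (((n:ℝ) ^ (-(1+η)) : ℝ) : ℂ)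
noncomputable def DD (f : ℕ →*₀ ℂ) (η B w : ℝ) : ℂ := ∑' n : ℕ, aD f η n * ((gau B (w - Real.log n) : ℝ) : ℂ)
noncomputable def EE (f : ℕ →*₀ ℂ) (η B w : ℝ) : ℂ := ∑' n : ℕ, (aD f η n * ((Real.log n : ℝ) : ℂ)) * ((gau B (w - Real.log n) : ℝ) : ℂ)

lemma integral_exp_abs {a : ℝ} (ha : 0 < a) : ∫ w : ℝ, Real.exp (-a * |w|) = 2 / a := by
  rw [integral_comp_abs (f := fun w => Real.exp (-a * w)), integral_exp_mul_Ioi (by linarith)]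
  simp; ring

lemma integrable_exp_abs {a : ℝ} (ha : 0 < a) : Integrable fun w : ℝ => Real.exp (-a * |w|) := by
  by_contra h
  have h1 := integral_undef h
  rw [integral_exp_abs ha] at h1
  have : 0 < 2 / a := by positivity
  linarith

lemma norm_aD_le {f : ℕ →*₀ ℂ} (hf : ∀ n, ‖f n‖ ≤ 1) (η : ℝ) (n : ℕ) : ‖aD f η n‖ ≤ (n:ℝ) ^ (-(1+η)) := by
  have h : (0:ℝ) ≤ (n:ℝ) ^ (-(1+η)) := Real.rpow_nonneg (Nat.cast_nonneg _) _
  rw [aD, norm_mul, Complex.norm_real, Real.norm_of_nonneg h]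
  exact mul_le_of_le_one_left h (hf n)

lemma summ_aD {f : ℕ →*₀ ℂ} (hf : ∀ n, ‖f n‖ ≤ 1) {η : ℝ} (h0 : 0 < η) : Summable fun n => ‖aD f η n‖ :=
  (summ_rpow (by linarith : 1 < 1 + η)).of_nonneg_of_le (fun _ => norm_nonneg _) (norm_aD_le hf η)

lemma summ_log_rpow {η : ℝ} (h0 : 0 < η) : Summable fun n : ℕ => Real.log n * (n:ℝ) ^ (-(1+η)) := by
  refine ((summ_rpow (by linarith : 1 < 1 + η/2)).mul_left (2/η)).of_nonneg_of_le (fun n => ?_) fun n => ?_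
  · exact mul_nonneg (Real.log_natCast_nonneg n) (Real.rpow_nonneg (Nat.cast_nonneg _) _)
  · rcases Nat.eq_zero_or_pos n with rfl | hn
    · simp; positivity
    have hn' : (0:ℝ) < n := by exact_mod_cast hn
    calc _ ≤ ((n:ℝ) ^ (η/2) / (η/2)) * (n:ℝ) ^ (-(1+η)) := by
          gcongr; exact Real.log_le_rpow_div hn'.le (by positivity)
      _ = (2/η) * ((n:ℝ) ^ (η/2) * (n:ℝ) ^ (-(1+η))) := by field_simp
      _ = _ := by rw [← Real.rpow_add hn']; ring_nf

lemma summ_aD_mul {f : ℕ →*₀ ℂ} (hf : ∀ n, ‖f n‖ ≤ 1) {η : ℝ} (h0 : 0 < η) (g : ℕ → ℝ) (hg0 : ∀ n, 0 ≤ g n) (hg : ∀ n, g n ≤ Real.log n) :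
    Summable fun n => ‖aD f η n * ((g n : ℝ) : ℂ)‖ := by
  refine (summ_log_rpow h0).of_nonneg_of_le (fun _ => norm_nonneg _) fun n => ?_
  rw [norm_mul, Complex.norm_real, Real.norm_of_nonneg (hg0 n), mul_comm]
  have := hg0 n
  have := norm_aD_le hf η n
  have := hg n
  gcongr

lemma sum_one_le (y : ℝ) (hy : 0 < y) : ∑ n ∈ Ioc 0 ⌊y⌋₊, (1:ℝ) ≤ 1 * y := by
  simp; exact Nat.floor_le hy.le

lemma gau_nn (B u : ℝ) : 0 ≤ gau B u := (Real.exp_pos _).le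
lemma gau_le1 {B : ℝ} (hB : 0 ≤ B) (u : ℝ) : gau B u ≤ 1 := by
  rw [gau]; apply Real.exp_le_one_iff.2; nlinarith [sq_nonneg u, mul_nonneg hB (sq_nonneg u)]

lemma gau_cont (B : ℝ) : Continuous (gau B) := by unfold gau; fun_prop

lemma DD_le {f : ℕ →*₀ ℂ} (hf : ∀ n, ‖f n‖ ≤ 1) {η B : ℝ} (h0 : 0 < η) (h1 : η ≤ 1) (hB : 1 ≤ B) (w : ℝ) :
    ‖DD f η B w‖ ≤ 11 * Real.exp 4 * Real.exp (-η * |w|) := by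
  have := C1 (c := fun _ => 1) (C0 := 1) (fun _ => zero_le_one) sum_one_le h0 h1 (a := aD f η) (fun n => by simpa using norm_aD_le hf η n)
    (gau_le hB) w
  simpa [DD] using this

lemma DD_le' {f : ℕ →*₀ ℂ} (hf : ∀ n, ‖f n‖ ≤ 1) {η B : ℝ} (h0 : 0 < η) (h1 : η ≤ 1) (hB : 1 ≤ B) (w : ℝ) :
    ‖DD f η B w‖ ≤ 11 * Real.exp 4 := by
  refine (DD_le hf h0 h1 hB w).trans (mul_le_of_le_one_right (by positivity) ?_)
  apply Real.exp_le_one_iff.2; nlinarith [abs_nonneg w]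

lemma summ_mul_gau {a : ℕ → ℂ} (ha : Summable fun n => ‖a n‖) {B : ℝ} (hB : 0 ≤ B) (w : ℝ) :
    Summable fun n : ℕ => a n * ((gau B (w - Real.log n) : ℝ) : ℂ) := by
  refine Summable.of_norm (ha.of_nonneg_of_le (fun _ => norm_nonneg _) fun n => ?_)
  rw [norm_mul, Complex.norm_real, Real.norm_of_nonneg (gau_nn _ _)]
  exact mul_le_of_le_one_right (norm_nonneg _) (gau_le1 hB _)

lemma DD_cont {f : ℕ →*₀ ℂ} (hf : ∀ n, ‖f n‖ ≤ 1) {η B : ℝ} (h0 : 0 < η) (hB : 1 ≤ B) : Continuous (DD f η B) := by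
  unfold DD
  refine continuous_tsum (fun n => ?_) (summ_aD hf h0) fun n w => ?_
  · have := gau_cont B
    fun_prop
  · rw [norm_mul, Complex.norm_real, Real.norm_of_nonneg (gau_nn _ _)]
    exact mul_le_of_le_one_right (norm_nonneg _) (gau_le1 (by linarith) _)

lemma wD_sub_E {f : ℕ →*₀ ℂ} (hf : ∀ n, ‖f n‖ ≤ 1) {η B : ℝ} (h0 : 0 < η) (h1 : η ≤ 1) (hB : 1 ≤ B) (w : ℝ) :
    |w| * ‖DD f η B w‖ ≤ ‖EE f η B w‖ + 11 * Real.exp 4 := by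
  have h := C1 (c := fun _ => 1) (C0 := 1) (fun _ => zero_le_one) sum_one_le h0 h1 (a := aD f η) (fun n => by simpa using norm_aD_le hf η n)
    (ugau_le hB) w
  have e : ∑' n : ℕ, aD f η n * (((w - Real.log n) * gau B (w - Real.log n) : ℝ) : ℂ) = w * DD f η B w - EE f η B w := by
    rw [DD, EE, ← tsum_mul_left, ← Summable.tsum_sub]
    · refine tsum_congr fun n => ?_
      push_cast; ring
    · exact (summ_mul_gau (summ_aD hf h0) (by linarith) w).mul_left _
    · exact summ_mul_gau (summ_aD_mul hf h0 _ (fun n => Real.log_natCast_nonneg n) fun n => le_rfl) (by linarith) w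
  rw [e] at h
  have h2 : Real.exp (-η * |w|) ≤ 1 := by
    apply Real.exp_le_one_iff.2; nlinarith [abs_nonneg w]
  have h3 : ‖(w:ℂ) * DD f η B w‖ ≤ ‖(w:ℂ) * DD f η B w - EE f η B w‖ + ‖EE f η B w‖ := by
    have := norm_add_le ((w:ℂ) * DD f η B w - EE f η B w) (EE f η B w)
    simpa using this
  rw [norm_mul, Complex.norm_real, Real.norm_eq_abs] at h3
  have h4 : 11 * 1 * Real.exp 4 * Real.exp (-η * |w|) ≤ 11 * Real.exp 4 := by
    have := Real.exp_pos 4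
    nlinarith
  linarith

open ArithmeticFunction in
lemma term_conv (f : ℕ →*₀ ℂ) (g : ℕ → ℝ) (η t : ℝ) (n : ℕ) :
    LSeries.term (fun n => f n * g n) (((1 + η : ℝ) : ℂ) + t * Complex.I) n = aD f η n * ((g n : ℝ) : ℂ) * Complex.exp (-(t * Real.log n : ℝ) * Complex.I) := by
  rw [LSeries.term_def]
  split_ifs with h
  · subst h; simp [aD]
  have hn : (0:ℝ) < n := by exact_mod_cast Nat.pos_of_ne_zero h
  have e : ((n:ℂ)) ^ (((1 + η : ℝ) : ℂ) + t * Complex.I) = (((n:ℝ) ^ (1+η) : ℝ) : ℂ) * Complex.exp ((t * Real.log n : ℝ) * Complex.I) := by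
    rw [Complex.cpow_add _ _ (by exact_mod_cast h), Complex.ofReal_cpow hn.le]
    congr 1
    rw [Complex.cpow_def_of_ne_zero (by exact_mod_cast h), ← Complex.natCast_log]
    congr 1; push_cast; ring
  rw [e, aD, Real.rpow_neg hn.le, neg_mul, Complex.exp_neg]
  push_cast
  field_simp

open ArithmeticFunction in
lemma logD_eq {f : ℕ →*₀ ℂ} (hf : ∀ n, ‖f n‖ ≤ 1) {η : ℝ} (h0 : 0 < η) (t : ℝ) :
    ∑' n : ℕ, (aD f η n * ((Real.log n : ℝ) : ℂ)) * Complex.exp (-(t * Real.log n : ℝ) * Complex.I) =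
      FH f (1+η) t * ∑' n : ℕ, (aD f η n * ((Λ n : ℝ) : ℂ)) * Complex.exp (-(t * Real.log n : ℝ) * Complex.I) := by
  set s : ℂ := ((1 + η : ℝ) : ℂ) + t * Complex.I
  have e1 : ∑' n : ℕ, (aD f η n * ((Real.log n : ℝ) : ℂ)) * Complex.exp (-(t * Real.log n : ℝ) * Complex.I) = LSeries (fun n => f n * ((Real.log n : ℝ) : ℂ)) s :=
    tsum_congr fun n => (term_conv f (fun n => Real.log n) η t n).symm
  have e2 : ∑' n : ℕ, (aD f η n * ((Λ n : ℝ) : ℂ)) * Complex.exp (-(t * Real.log n : ℝ) * Complex.I) = LSeries (fun n => f n * ((Λ n : ℝ) : ℂ)) s :=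
    tsum_congr fun n => (term_conv f (fun n => Λ n) η t n).symm
  have t3 : ∀ n, LSeries.term (fun n => f n) s n = f n * (((n:ℝ) ^ (-(1+η)) : ℝ) : ℂ) * Complex.exp (-(t * Real.log n : ℝ) * Complex.I) := by
    intro n
    have := term_conv f (fun _ => 1) η t n
    simp only [Complex.ofReal_one, mul_one, aD] at this
    exact this
  have e3 : FH f (1+η) t = LSeries (fun n => f n) s := tsum_congr fun n => (t3 n).symm
  rw [e1, e2, e3, ← LSeries_convolution']
  · apply LSeries_congr
    intro n hn
    rw [LSeries.convolution_def]
    simp only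
    have : ∀ p ∈ n.divisorsAntidiagonal, f p.1 * (f p.2 * ((Λ p.2 : ℝ) : ℂ)) = f n * ((Λ p.2 : ℝ) : ℂ) := by
      intro p hp
      rw [← (Nat.mem_divisorsAntidiagonal.1 hp).1, map_mul]; ring
    rw [Finset.sum_congr rfl this, ← Finset.mul_sum, ← vonMangoldt_sum]
    rw [Nat.sum_divisorsAntidiagonal' (f := fun a b => ((Λ b : ℝ) : ℂ))]
    push_cast; rfl
  · unfold LSeriesSummable
    have := summ_term f hf (by linarith : 1 < 1 + η) t
    refine (Summable.of_norm ?_)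
    refine (summ_aD hf h0).congr fun n => ?_
    rw [t3, norm_mul (_ * _), norm_exp_it, mul_one]; rfl
  · unfold LSeriesSummable
    refine (Summable.of_norm ?_)
    refine (summ_aD_mul hf h0 (fun n => Λ n) (fun n => vonMangoldt_nonneg) fun n => vonMangoldt_le_log).congr fun n => ?_
    rw [term_conv f (fun n => Λ n) η t n, norm_mul (_ * _), norm_exp_it, mul_one]

open ArithmeticFunction in
lemma sum_Lam_le (y : ℝ) (hy : 0 < y) : ∑ n ∈ Ioc 0 ⌊y⌋₊, Λ n ≤ 6 * y := by
  have h := Chebyshev.psi_le_const_mul_self hy.le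
  rw [Chebyshev.psi] at h
  have : Real.log 4 ≤ 2 := by
    rw [show (4:ℝ) = 2 * 2 by norm_num, Real.log_mul (by norm_num) (by norm_num)]
    linarith [Real.log_two_lt_d9]
  nlinarith

open ArithmeticFunction in
/-- mean square of the smoothed von Mangoldt sum -/
lemma PP_sq {f : ℕ →*₀ ℂ} (hf : ∀ n, ‖f n‖ ≤ 1) {η B : ℝ} (h0 : 0 < η) (h1 : η ≤ 1) (hB : 1 ≤ B) :
    ∫ w, ‖∑' n : ℕ, (aD f η n * ((Λ n : ℝ) : ℂ)) * ((gau B (w - Real.log n) : ℝ) : ℂ)‖ ^ 2 ≤ (66 * Real.exp 4)^2 / η := by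
  have hb : ∀ w, ‖∑' n : ℕ, (aD f η n * ((Λ n : ℝ) : ℂ)) * ((gau B (w - Real.log n) : ℝ) : ℂ)‖ ≤ 66 * Real.exp 4 * Real.exp (-η * |w|) := by
    intro w
    have := C1 (c := fun n => Λ n) (C0 := 6) (fun _ => vonMangoldt_nonneg) sum_Lam_le h0 h1 (a := fun n => aD f η n * ((Λ n : ℝ) : ℂ)) (fun n => by
      rw [norm_mul, Complex.norm_real, Real.norm_of_nonneg vonMangoldt_nonneg, mul_comm]
      exact mul_le_mul_of_nonneg_left (norm_aD_le hf η n) vonMangoldt_nonneg) (gau_le hB) w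
    linarith
  have hi := (integrable_exp_abs (by linarith : 0 < 2 * η)).const_mul ((66 * Real.exp 4)^2)
  refine (integral_mono_of_nonneg (Eventually.of_forall fun w => by positivity) hi (Eventually.of_forall fun w => ?_)).trans (le_of_eq ?_)
  · simp only
    calc _ ≤ (66 * Real.exp 4 * Real.exp (-η * |w|))^2 := by gcongr; exact hb w
      _ = _ := by rw [mul_pow, ← Real.exp_nat_mul]; congr 2; push_cast; ring
  · rw [integral_const_mul, integral_exp_abs (by linarith)]
    field_simp

open ArithmeticFunction in
lemma EE_sq_aux {f : ℕ →*₀ ℂ} (hf : ∀ n, ‖f n‖ ≤ 1) {η B X : ℝ} (h0 : 0 < η) (h1 : η ≤ 1) (hB : 1 ≤ B)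
    (hX : ∀ t, ‖FH f (1+η) t‖ ^ 2 * Real.exp (-t^2/(2*(2*B))) ≤ X) :
    Integrable (fun w => ‖EE f η B w‖^2) ∧ ∫ w, ‖EE f η B w‖^2 ≤ 2 * X * ((66 * Real.exp 4)^2 / η) := by
  have hX0 : 0 ≤ X := le_trans (by positivity) (hX 0)
  have s1 := summ_aD_mul hf h0 (fun n => Real.log n) (fun n => Real.log_natCast_nonneg n) fun n => le_rfl
  have s2 := summ_aD_mul hf h0 (fun n => Λ n) (fun n => vonMangoldt_nonneg) fun n => vonMangoldt_le_log
  obtain ⟨a1, a2, a3⟩ := pl (by linarith : 0 < B) s1 (fun n => Real.log n)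
  obtain ⟨b1, b2, b3⟩ := pl (by linarith : 0 < 2 * B) s2 (fun n => Real.log n)
  refine ⟨a1, ?_⟩
  have hP := PP_sq hf h0 h1 (by linarith : 1 ≤ 2 * B)
  rw [b3] at hP
  set IP := ∫ t : ℝ, ‖∑' n : ℕ, (aD f η n * ((Λ n : ℝ) : ℂ)) * Complex.exp (-(t * Real.log n : ℝ) * Complex.I)‖^2 * Real.exp (-t^2/(2*(2*B))) with hIP
  have h4 : ∫ w, ‖EE f η B w‖^2 ≤ 1 / (2 * B) * (X * IP) := by
    unfold EE
    rw [a3]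
    refine mul_le_mul_of_nonneg_left (b := ∫ t : ℝ, ‖∑' n : ℕ, (aD f η n * ((Real.log n : ℝ) : ℂ)) * Complex.exp (-(t * Real.log n : ℝ) * Complex.I)‖^2 * Real.exp (-t^2/(2*B))) ?_ (by positivity)
    rw [hIP, ← integral_const_mul]
    refine integral_mono_of_nonneg (Eventually.of_forall fun w => by positivity) (b2.const_mul X) (Eventually.of_forall fun t => ?_)
    simp only
    rw [logD_eq hf h0, norm_mul, mul_pow]
    have e : Real.exp (-t^2/(2*B)) = Real.exp (-t^2/(2*(2*B))) * Real.exp (-t^2/(2*(2*B))) := by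
      rw [← Real.exp_add]; congr 1; field_simp; ring
    rw [e]
    calc _ = (‖FH f (1+η) t‖ ^ 2 * Real.exp (-t^2/(2*(2*B)))) * (‖∑' n : ℕ, (aD f η n * ((Λ n : ℝ) : ℂ)) * Complex.exp (-(t * Real.log n : ℝ) * Complex.I)‖^2 * Real.exp (-t^2/(2*(2*B)))) := by ring
      _ ≤ _ := by gcongr; exact hX t
  refine h4.trans ?_
  have hB0 : 0 < B := by linarith
  calc 1 / (2 * B) * (X * IP) = 2 * X * (1 / (2 * (2 * B)) * IP) := by field_simp
    _ ≤ _ := by gcongr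

lemma EE_sq {f : ℕ →*₀ ℂ} (hf : ∀ n, ‖f n‖ ≤ 1)
    (hR : ∀ T ε : ℝ, 0 < ε → ∃ δ, 0 < δ ∧ ∀ σ : ℝ, 1 < σ → σ < 1 + δ → ∀ t : ℝ, |t| ≤ T → ‖FH f σ t‖ * (σ - 1) ≤ ε)
    {B : ℝ} (hB : 1 ≤ B) {δ : ℝ} (hδ : 0 < δ) :
    ∃ η0, 0 < η0 ∧ ∀ η, 0 < η → η < η0 → Integrable (fun w => ‖EE f η B w‖^2) ∧ ∫ w, ‖EE f η B w‖^2 ≤ δ / η^3 := by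
  set C := 2 * (66 * Real.exp 4)^2 with hC
  have hC0 : 0 < C := by positivity
  set κ := δ / (2 * C) with hκ
  have hκ0 : 0 < κ := by positivity
  obtain ⟨T, hT0, hT⟩ : ∃ T : ℝ, 0 ≤ T ∧ 4 * Real.exp (-T^2/(2*(2*B))) ≤ κ := by
    have ht : Tendsto (fun T : ℝ => 4 * Real.exp (-T^2/(2*(2*B)))) atTop (𝓝 0) := by
      have : Tendsto (fun T : ℝ => -T^2/(2*(2*B))) atTop atBot := by
        apply Tendsto.atBot_div_const (by positivity)
        exact tendsto_neg_atTop_atBot.comp (tendsto_pow_atTop two_ne_zero)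
      simpa using (Real.tendsto_exp_atBot.comp this).const_mul 4
    obtain ⟨T, h1, h2⟩ := ((ht.eventually_le_const hκ0).and (eventually_ge_atTop 0)).exists
    exact ⟨T, h2, h1⟩
  obtain ⟨δ1, hδ1, h1⟩ := hR T (Real.sqrt κ) (Real.sqrt_pos.2 hκ0)
  obtain ⟨δ2, hδ2, h2⟩ := Zt_le
  refine ⟨min 1 (min δ1 δ2), by positivity, fun η h0 hη => ?_⟩
  have g1 := lt_of_lt_of_le hη (min_le_left _ _)
  have g2 := lt_of_lt_of_le hη ((min_le_right _ _).trans (min_le_left _ _))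
  have g3 := lt_of_lt_of_le hη ((min_le_right _ _).trans (min_le_right _ _))
  have hX : ∀ t, ‖FH f (1+η) t‖ ^ 2 * Real.exp (-t^2/(2*(2*B))) ≤ κ / η^2 := by
    intro t
    rw [le_div_iff₀ (by positivity)]
    rcases le_or_gt |t| T with ht | ht
    · have k1 := h1 (1+η) (by linarith) (by linarith) t ht
      have k2 : Real.exp (-t^2/(2*(2*B))) ≤ 1 := by
        apply Real.exp_le_one_iff.2
        have : 0 ≤ t^2/(2*(2*B)) := by positivity
        rw [neg_div]; linarith
      rw [add_sub_cancel_left] at k1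
      calc _ = (‖FH f (1+η) t‖ * η)^2 * Real.exp (-t^2/(2*(2*B))) := by ring
        _ ≤ (Real.sqrt κ)^2 * 1 := by gcongr
        _ = κ := by rw [Real.sq_sqrt hκ0.le, mul_one]
    · have k1 := norm_FH_le f hf (by linarith : 1 < 1 + η) t
      have k2 := h2 (1+η) (by linarith) (by linarith)
      rw [add_sub_cancel_left] at k2
      have k3 : ‖FH f (1+η) t‖ * η ≤ 2 := by nlinarith
      have k4 : Real.exp (-t^2/(2*(2*B))) ≤ Real.exp (-T^2/(2*(2*B))) := by
        apply Real.exp_le_exp.2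
        have : T^2 ≤ t^2 := by rw [← sq_abs t]; gcongr
        gcongr
      calc _ = (‖FH f (1+η) t‖ * η)^2 * Real.exp (-t^2/(2*(2*B))) := by ring
        _ ≤ 2^2 * Real.exp (-T^2/(2*(2*B))) := by gcongr
        _ ≤ κ := by linarith
  obtain ⟨i1, i2⟩ := EE_sq_aux hf h0 g1.le hB hX
  refine ⟨i1, i2.trans ?_⟩
  calc _ = κ * C / η^3 := by rw [hC]; field_simp
    _ ≤ δ / η^3 := by
      gcongr
      rw [hκ, div_mul_eq_mul_div, div_le_iff₀ (by positivity)]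
      nlinarith

end

section
open Filter Topology Finset MeasureTheory ComplexConjugate

noncomputable def Gs (B s : ℝ) : ℝ := ∫ u : ℝ, Real.exp (s * u) * gau B u

lemma exp_gau_eq {B : ℝ} (hB : 0 < B) (s u : ℝ) : Real.exp (s * u) * gau B u = Real.exp (s^2/(4*B)) * gau B (u - s/(2*B)) := by
  rw [gau, gau, ← Real.exp_add, ← Real.exp_add]; congr 1; field_simp; ring

lemma exp_gau_int {B : ℝ} (hB : 0 < B) (s : ℝ) : Integrable fun u : ℝ => Real.exp (s * u) * gau B u := by
  simp_rw [exp_gau_eq hB]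
  have : Integrable fun u : ℝ => gau B u := integrable_exp_neg_mul_sq hB
  exact (this.comp_sub_right _).const_mul _

lemma Gs_eq {B : ℝ} (hB : 0 < B) (s : ℝ) : Gs B s = Real.exp (s^2/(4*B)) * √(Real.pi / B) := by
  unfold Gs
  simp_rw [exp_gau_eq hB]
  rw [integral_const_mul, integral_sub_right_eq_self (fun u => gau B u)]
  unfold gau
  rw [integral_gaussian]

lemma Gs_pos {B : ℝ} (hB : 0 < B) (s : ℝ) : 0 < Gs B s := by
  rw [Gs_eq hB]; have := Real.pi_pos; positivity

lemma exp_gau_nn (B s u : ℝ) : 0 ≤ Real.exp (s * u) * gau B u := mul_nonneg (Real.exp_pos _).le (gau_nn _ _)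

noncomputable def Phi (B σ v : ℝ) : ℝ := (Gs B σ)⁻¹ * ∫ u in Set.Iic v, Real.exp (σ * u) * gau B u

lemma Gs_ratio {M σ s : ℝ} (hM : 2 ≤ M) (hσ : 0 ≤ σ) (hσ2 : σ ≤ 2) (hs : s = σ + M ∨ s = σ - M) : (Gs (M^2) σ)⁻¹ * Gs (M^2) s ≤ 3 := by
  have hM0 : 0 < M := by linarith
  have hB : 0 < M^2 := by positivity
  rw [Gs_eq hB, Gs_eq hB]
  have h1 : 0 < √(Real.pi / M^2) := by have := Real.pi_pos; positivity
  have e : (Real.exp (σ^2/(4*M^2)) * √(Real.pi / M^2))⁻¹ * (Real.exp (s^2/(4*M^2)) * √(Real.pi / M^2)) = Real.exp ((s^2 - σ^2)/(4*M^2)) := by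
    rw [sub_div, Real.exp_sub]; field_simp
  rw [e]
  have h2 : (s^2 - σ^2)/(4*M^2) ≤ 3/4 := by
    rw [div_le_iff₀ (by positivity)]
    rcases hs with rfl | rfl <;> nlinarith
  calc _ ≤ Real.exp (3/4) := Real.exp_le_exp.2 h2
    _ ≤ Real.exp 1 := Real.exp_le_exp.2 (by norm_num)
    _ ≤ 3 := by linarith [Real.exp_one_lt_d9]

lemma Phi_pos_err {M σ : ℝ} (hM : 2 ≤ M) (hσ : 0 ≤ σ) (hσ2 : σ ≤ 2) (v : ℝ) :
    |1 - Phi (M^2) σ v| ≤ 3 * Real.exp (-M * v) := by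
  have hB : 0 < M^2 := by positivity
  have hG := Gs_pos hB σ
  have e1 : 1 - Phi (M^2) σ v = (Gs (M^2) σ)⁻¹ * ∫ u in Set.Ioi v, Real.exp (σ * u) * gau (M^2) u := by
    have h := intervalIntegral.integral_Iic_add_Ioi (b := v) (exp_gau_int hB σ).integrableOn (exp_gau_int hB σ).integrableOn
    have h2 : Gs (M^2) σ = ∫ u : ℝ, Real.exp (σ * u) * gau (M^2) u := rfl
    rw [← h2] at h
    rw [Phi]
    have : (Gs (M^2) σ)⁻¹ * Gs (M^2) σ = 1 := inv_mul_cancel₀ hG.ne'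
    rw [← this]; nth_rewrite 2 [← h]; ring
  have h2 : ∫ u in Set.Ioi v, Real.exp (σ * u) * gau (M^2) u ≤ Real.exp (-M * v) * Gs (M^2) (σ + M) := by
    calc _ ≤ ∫ u in Set.Ioi v, Real.exp (-M * v) * (Real.exp ((σ+M) * u) * gau (M^2) u) := by
          refine setIntegral_mono_on (exp_gau_int hB σ).integrableOn ((exp_gau_int hB _).const_mul _).integrableOn measurableSet_Ioi fun u hu => ?_
          have hu : v < u := hu
          rw [← mul_assoc, ← Real.exp_add]
          refine mul_le_mul_of_nonneg_right (Real.exp_le_exp.2 ?_) (gau_nn _ _)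
          nlinarith
      _ ≤ ∫ u, Real.exp (-M * v) * (Real.exp ((σ+M) * u) * gau (M^2) u) := by
          refine setIntegral_le_integral ((exp_gau_int hB _).const_mul _) (Eventually.of_forall fun u => ?_)
          exact mul_nonneg (Real.exp_pos _).le (exp_gau_nn _ _ _)
      _ = _ := by rw [integral_const_mul]; rfl
  rw [e1, abs_of_nonneg (mul_nonneg (inv_pos.2 hG).le (setIntegral_nonneg measurableSet_Ioi fun u _ => exp_gau_nn _ _ _))]
  calc _ ≤ (Gs (M^2) σ)⁻¹ * (Real.exp (-M * v) * Gs (M^2) (σ + M)) := by gcongr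
    _ = ((Gs (M^2) σ)⁻¹ * Gs (M^2) (σ + M)) * Real.exp (-M * v) := by ring
    _ ≤ _ := by gcongr; exact Gs_ratio hM hσ hσ2 (Or.inl rfl)

lemma Phi_neg_err {M σ : ℝ} (hM : 2 ≤ M) (hσ : 0 ≤ σ) (hσ2 : σ ≤ 2) (v : ℝ) :
    |Phi (M^2) σ v| ≤ 3 * Real.exp (M * v) := by
  have hB : 0 < M^2 := by positivity
  have hG := Gs_pos hB σ
  have h2 : ∫ u in Set.Iic v, Real.exp (σ * u) * gau (M^2) u ≤ Real.exp (M * v) * Gs (M^2) (σ - M) := by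
    calc _ ≤ ∫ u in Set.Iic v, Real.exp (M * v) * (Real.exp ((σ-M) * u) * gau (M^2) u) := by
          refine setIntegral_mono_on (exp_gau_int hB σ).integrableOn ((exp_gau_int hB _).const_mul _).integrableOn measurableSet_Iic fun u hu => ?_
          have hu : u ≤ v := hu
          rw [← mul_assoc, ← Real.exp_add]
          refine mul_le_mul_of_nonneg_right (Real.exp_le_exp.2 ?_) (gau_nn _ _)
          nlinarith
      _ ≤ ∫ u, Real.exp (M * v) * (Real.exp ((σ-M) * u) * gau (M^2) u) := by
          refine setIntegral_le_integral ((exp_gau_int hB _).const_mul _) (Eventually.of_forall fun u => ?_)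
          exact mul_nonneg (Real.exp_pos _).le (exp_gau_nn _ _ _)
      _ = _ := by rw [integral_const_mul]; rfl
  rw [Phi, abs_of_nonneg (mul_nonneg (inv_pos.2 hG).le (setIntegral_nonneg measurableSet_Iic fun u _ => exp_gau_nn _ _ _))]
  calc _ ≤ (Gs (M^2) σ)⁻¹ * (Real.exp (M * v) * Gs (M^2) (σ - M)) := by gcongr
    _ = ((Gs (M^2) σ)⁻¹ * Gs (M^2) (σ - M)) * Real.exp (M * v) := by ring
    _ ≤ _ := by gcongr; exact Gs_ratio hM hσ hσ2 (Or.inr rfl)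

/-- telescoping sum -/
lemma tele {a : ℝ} (ha : 0 < a) (N : ℕ) : ∑ j ∈ range N, (1 / (1 + a * j)^2 : ℝ) ≤ 1 + 1 / a := by
  have h : ∀ N : ℕ, ∑ j ∈ range (N+1), (1 / (1 + a * j)^2 : ℝ) ≤ 1 + 1/a - 1/(a * (1 + a * N)) := by
    intro N
    induction N with
    | zero => simp
    | succ N ih =>
      rw [Finset.sum_range_succ]
      have h1 : (0:ℝ) < 1 + a * N := by positivity
      have h2 : (0:ℝ) < 1 + a * (N+1) := by positivity
      have : (1 / (1 + a * (N+1))^2 : ℝ) ≤ 1/(a * (1 + a * N)) - 1/(a * (1 + a * (N+1))) := by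
        have e : 1/(a * (1 + a * N)) - 1/(a * (1 + a * (N+1))) = 1 / ((1 + a * N) * (1 + a * (N+1))) := by
          field_simp; ring
        rw [e]
        apply one_div_le_one_div_of_le (by positivity)
        nlinarith
      push_cast
      linarith
  cases N with
  | zero => simp; positivity
  | succ N =>
    have := h N
    have h3 : 0 ≤ 1/(a * (1 + a * N)) := by positivity
    linarith

lemma exp_log_pt {y : ℝ} (hy : 0 < y) (M' : ℕ) (n : ℕ) (hn : 0 < n) :
    Real.exp (-(2 * M') * |Real.log y - Real.log n|) ≤ 1 / (1 + (M'/y) * |y - n|)^2 := by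
  have hn' : (0:ℝ) < n := by exact_mod_cast hn
  have key : 1 + (M'/y) * |y - n| ≤ Real.exp (M' * |Real.log y - Real.log n|) := by
    rw [← Real.log_div hy.ne' hn'.ne']
    have hl : |y - n| / y ≤ Real.exp |Real.log (y/n)| - 1 := by
      rcases le_total (n:ℝ) y with h | h
      · have : 1 ≤ y / n := by rwa [one_le_div hn']
        rw [abs_of_nonneg (by linarith : 0 ≤ y - n), abs_of_nonneg (Real.log_nonneg this), Real.exp_log (by positivity), div_le_iff₀ hy]
        have e : (y / n - 1) * y - (y - n) = (y-n)^2 / n := by field_simp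
        have : 0 ≤ (y-n)^2/n := by positivity
        linarith
      · have : y / n ≤ 1 := by rwa [div_le_one hn']
        rw [abs_of_nonpos (by linarith : y - n ≤ 0), abs_of_nonpos (Real.log_nonpos (by positivity) this), Real.exp_neg, Real.exp_log (by positivity)]
        apply le_of_eq; field_simp; ring
    have h2 := one_add_mul_le_pow (a := Real.exp |Real.log (y/n)| - 1) (by linarith [Real.exp_pos |Real.log (y/n)|]) M'
    rw [add_sub_cancel, ← Real.exp_nat_mul] at h2
    refine le_trans ?_ h2
    have : (M':ℝ) * (|y - n| / y) ≤ M' * (Real.exp |Real.log (y/n)| - 1) := by gcongr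
    have e : (M':ℝ) / y * |y - n| = M' * (|y-n|/y) := by ring
    linarith
  have h0 : 0 < 1 + (M'/y) * |y - n| := by positivity
  rw [le_div_iff₀ (by positivity)]
  have e : Real.exp (-(2 * M') * |Real.log y - Real.log n|) = (Real.exp (M' * |Real.log y - Real.log n|)^2)⁻¹ := by
    rw [← Real.exp_nat_mul, ← Real.exp_neg]; congr 1; push_cast; ring
  rw [e, inv_mul_le_iff₀ (by positivity), mul_one]
  gcongr

lemma sum_pt {y : ℝ} (hy : 0 < y) (M' : ℕ) (hM : 1 ≤ M') (N : ℕ) :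
    ∑ n ∈ range N, (1 / (1 + (M'/y) * |y - n|)^2 : ℝ) ≤ 2 + 2 * y / M' := by
  have hM0 : (0:ℝ) < M' := by exact_mod_cast hM
  set a := (M':ℝ)/y with ha
  have ha0 : 0 < a := by positivity
  have e : 2 + 2 * y / M' = 2 * (1 + 1/a) := by rw [ha]; field_simp
  rw [e]
  set Y := ⌊y⌋₊
  have hY : (Y:ℝ) ≤ y := Nat.floor_le hy.le
  have hY2 : y < Y + 1 := Nat.lt_floor_add_one y
  calc _ ≤ ∑ n ∈ range (Y + 1 + N), (1 / (1 + a * |y - n|)^2 : ℝ) := by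
        refine Finset.sum_le_sum_of_subset_of_nonneg (fun n hn => ?_) fun n _ _ => by positivity
        simp at hn ⊢; omega
    _ = ∑ n ∈ range (Y + 1), (1 / (1 + a * |y - n|)^2 : ℝ) + ∑ n ∈ range N, (1 / (1 + a * |y - (Y + 1 + n : ℕ)|)^2 : ℝ) := by
        rw [Finset.sum_range_add]
    _ ≤ ∑ n ∈ range (Y + 1), (1 / (1 + a * n)^2 : ℝ) + ∑ n ∈ range N, (1 / (1 + a * n)^2 : ℝ) := by
        refine add_le_add ?_ (Finset.sum_le_sum fun n hn => ?_)
        · rw [← Finset.sum_range_reflect]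
          refine Finset.sum_le_sum fun n hn => ?_
          have hn : n ≤ Y := by simp at hn; omega
          gcongr
          rw [show Y + 1 - 1 - n = Y - n by omega, Nat.cast_sub hn]
          refine le_trans ?_ (le_abs_self _)
          linarith
        · gcongr
          refine le_trans ?_ (neg_le_abs _)
          push_cast; linarith
    _ ≤ _ := by linarith [tele ha0 (Y+1), tele ha0 N]

lemma Phi_shift {B : ℝ} (hB : 0 < B) {η : ℝ} (v : ℝ) (n : ℕ) (hn : 0 < n) :
    (n:ℝ) ^ (-(1+η)) * ∫ w in Set.Iic v, Real.exp ((1+η) * w) * gau B (w - Real.log n) = Gs B (1+η) * Phi B (1+η) (v - Real.log n) := by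
  have hn' : (0:ℝ) < n := by exact_mod_cast hn
  rw [Phi, mul_inv_cancel_left₀ (Gs_pos hB _).ne', ← integral_indicator measurableSet_Iic, ← integral_indicator measurableSet_Iic,
    ← integral_sub_right_eq_self ((Set.Iic (v - Real.log n)).indicator _) (Real.log n), ← integral_const_mul]
  congr 1
  ext w
  by_cases h : w ≤ v
  · rw [Set.indicator_of_mem (by exact h), Set.indicator_of_mem (by simpa using h), Real.rpow_def_of_pos hn', ← mul_assoc, ← Real.exp_add]
    congr 2; ring
  · rw [Set.indicator_of_notMem (by exact h), Set.indicator_of_notMem (by simpa using h), mul_zero]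

lemma int_eD {f : ℕ →*₀ ℂ} (hf : ∀ n, ‖f n‖ ≤ 1) {η B : ℝ} (h0 : 0 < η) (hB : 1 ≤ B) (v : ℝ) :
    HasSum (fun n : ℕ => f n * ((Gs B (1+η) * Phi B (1+η) (v - Real.log n) : ℝ) : ℂ)) (∫ w in Set.Iic v, ((Real.exp ((1+η) * w) : ℝ) : ℂ) * DD f η B w) := by
  set F : ℕ → ℝ → ℂ := fun n w => ((Real.exp ((1+η) * w) : ℝ) : ℂ) * (aD f η n * ((gau B (w - Real.log n) : ℝ) : ℂ)) with hF
  have hexp : IntegrableOn (fun w => Real.exp ((1+η) * w)) (Set.Iic v) := integrableOn_exp_mul_Iic (by linarith) v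
  have hFb : ∀ n w, ‖F n w‖ ≤ ‖aD f η n‖ * Real.exp ((1+η) * w) := by
    intro n w
    rw [hF]; simp only
    rw [norm_mul, norm_mul, Complex.norm_real, Complex.norm_real, Real.norm_of_nonneg (Real.exp_pos _).le, Real.norm_of_nonneg (gau_nn _ _), mul_comm]
    gcongr
    exact mul_le_of_le_one_right (norm_nonneg _) (gau_le1 (by linarith) _)
  have hFc : ∀ n, Continuous (F n) := by
    intro n
    have := gau_cont B
    rw [hF]; fun_prop
  have hFi : ∀ n, Integrable (F n) (volume.restrict (Set.Iic v)) := fun n =>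
    (hexp.const_mul ‖aD f η n‖).mono' (hFc n).aestronglyMeasurable (Eventually.of_forall (hFb n))
  have hs : Summable fun n => ∫ w in Set.Iic v, ‖F n w‖ := by
    refine ((summ_aD hf h0).mul_right (∫ w in Set.Iic v, Real.exp ((1+η) * w))).of_nonneg_of_le (fun n => integral_nonneg fun w => norm_nonneg _) fun n => ?_
    rw [← integral_const_mul]
    exact integral_mono (hFi n).norm (hexp.const_mul _) (hFb n)
  have h := hasSum_integral_of_summable_integral_norm hFi hs
  have e : (fun w => ∑' n, F n w) = fun w => ((Real.exp ((1+η) * w) : ℝ) : ℂ) * DD f η B w := by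
    ext w; rw [DD, ← tsum_mul_left]
  rw [e] at h
  refine Eq.subst (motive := fun g : ℕ → ℂ => HasSum g (∫ w in Set.Iic v, ((Real.exp ((1+η) * w) : ℝ) : ℂ) * DD f η B w)) (funext fun n => ?_) h
  symm
  rcases Nat.eq_zero_or_pos n with rfl | hn
  · simp [hF, aD]
  rw [← Phi_shift (by linarith) v n hn, hF]
  simp only [aD]
  rw [Complex.ofReal_mul, ← mul_assoc, ← integral_complex_ofReal, ← integral_const_mul]
  congr 1; ext w; push_cast; ring

lemma smooth {f : ℕ →*₀ ℂ} (hf : ∀ n, ‖f n‖ ≤ 1) {η : ℝ} (h0 : 0 < η) (h1 : η ≤ 1) (M' : ℕ) (hM : 1 ≤ M') {y : ℝ} (hy : 0 < y) :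
    ‖∑ n ∈ Ioc 0 ⌊y⌋₊, f n - ((Gs ((2*M':ℝ)^2) (1+η))⁻¹ : ℝ) * ∫ w in Set.Iic (Real.log y), ((Real.exp ((1+η) * w) : ℝ) : ℂ) * DD f η ((2*M':ℝ)^2) w‖ ≤ 6 + 6 * y / M' := by
  have hM0 : (1:ℝ) ≤ M' := by exact_mod_cast hM
  have hM2 : (2:ℝ) ≤ 2 * M' := by linarith
  set B := (2*M':ℝ)^2 with hBdef
  have hB : 1 ≤ B := by nlinarith
  have hG := Gs_pos (by linarith : 0 < B) (1+η)
  have hI := (int_eD hf h0 hB (Real.log y)).mul_left (((Gs B (1+η))⁻¹ : ℝ) : ℂ)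
  have hS : HasSum (fun n : ℕ => if n ∈ Ioc 0 ⌊y⌋₊ then f n else 0) (∑ n ∈ Ioc 0 ⌊y⌋₊, f n) := by
    have := hasSum_sum_of_ne_finset_zero (L := SummationFilter.unconditional ℕ) (s := Ioc 0 ⌊y⌋₊) (f := fun n : ℕ => if n ∈ Ioc 0 ⌊y⌋₊ then f n else 0) (fun b hb => by simp only [if_neg hb])
    rwa [Finset.sum_congr rfl (g := fun n => f n) (fun n hn => by simp only [if_pos hn])] at this
  rw [← (hS.sub hI).tsum_eq]
  refine norm_tsum_le_of_range (b := fun n : ℕ => 3 * (1 / (1 + (M'/y) * |y - n|)^2 : ℝ)) (fun n => ?_) fun N => ?_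
  · rcases Nat.eq_zero_or_pos n with rfl | hn
    · simp; positivity
    have hn' : (0:ℝ) < n := by exact_mod_cast hn
    have hpt := exp_log_pt hy M' n hn
    have e : (((Gs B (1+η))⁻¹ : ℝ) : ℂ) * (f n * ((Gs B (1+η) * Phi B (1+η) (Real.log y - Real.log n) : ℝ) : ℂ)) = f n * (Phi B (1+η) (Real.log y - Real.log n) : ℝ) := by
      have : (((Gs B (1+η))⁻¹ : ℝ) : ℂ) * ((Gs B (1+η) : ℝ) : ℂ) = 1 := by
        rw [← Complex.ofReal_mul, inv_mul_cancel₀ hG.ne']; simp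
      rw [Complex.ofReal_mul]; linear_combination (f n * (Phi B (1+η) (Real.log y - Real.log n) : ℝ)) * this
    rw [e]
    refine le_trans ?_ (mul_le_mul_of_nonneg_left hpt (by norm_num))
    by_cases h : (n:ℝ) ≤ y
    · rw [if_pos (by simp; exact ⟨hn, Nat.le_floor h⟩)]
      rw [show f n - f n * ((Phi B (1+η) (Real.log y - Real.log n) : ℝ) : ℂ) = f n * ((1 - Phi B (1+η) (Real.log y - Real.log n) : ℝ) : ℂ) by push_cast; ring,
        norm_mul, Complex.norm_real, Real.norm_eq_abs, abs_of_nonneg (sub_nonneg.2 (Real.log_le_log hn' h))]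
      refine (mul_le_of_le_one_left (abs_nonneg _) (hf n)).trans ?_
      exact Phi_pos_err hM2 (by linarith) (by linarith) _
    · rw [if_neg (by simp; intro _; exact (Nat.floor_lt hy.le).2 (not_le.1 h))]
      push Not at h
      rw [zero_sub, norm_neg, norm_mul, Complex.norm_real, Real.norm_eq_abs, abs_of_nonpos (sub_nonpos.2 (Real.log_le_log hy h.le))]
      refine (mul_le_of_le_one_left (abs_nonneg _) (hf n)).trans ?_
      refine (Phi_neg_err hM2 (by linarith) (by linarith) _).trans (le_of_eq ?_)
      congr 2; ring
  · rw [← Finset.mul_sum]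
    have := sum_pt hy M' hM N
    calc _ ≤ 3 * (2 + 2 * y / M') := by gcongr
      _ = _ := by ring

end

section
open Filter Topology Finset MeasureTheory ComplexConjugate ArithmeticFunction

lemma log_fact_ge (N : ℕ) (hN : 0 < N) : (N:ℝ) * Real.log N - ∑ n ∈ Ioc 0 N, Real.log n ≤ N := by
  have hN' : (0:ℝ) < N := by exact_mod_cast hN
  have h := Real.pow_div_factorial_le_exp (N:ℝ) hN'.le N
  have h2 : ∑ n ∈ Ioc 0 N, Real.log n = Real.log (N.factorial) := by
    clear h hN hN'
    induction N with
    | zero => simp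
    | succ N ih =>
      rw [Finset.sum_Ioc_succ_top (by omega), ih, Nat.factorial_succ, Nat.cast_mul, Real.log_mul (by positivity) (by positivity), add_comm]
  rw [h2, sub_le_iff_le_add, ← Real.log_pow, ← Real.log_exp (N:ℝ), ← Real.log_mul (Real.exp_pos _).ne' (by positivity), Real.log_exp]
  apply Real.log_le_log (by positivity)
  rwa [div_le_iff₀ (by positivity)] at h

lemma norm_sum_log_diff {f : ℕ →*₀ ℂ} (hf : ∀ n, ‖f n‖ ≤ 1) (N : ℕ) (hN : 0 < N) :
    Real.log N * ‖∑ n ∈ Ioc 0 N, f n‖ ≤ N + ‖∑ n ∈ Ioc 0 N, f n * ((Real.log n : ℝ) : ℂ)‖ := by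
  have e : ((Real.log N : ℝ) : ℂ) * ∑ n ∈ Ioc 0 N, f n = ∑ n ∈ Ioc 0 N, f n * ((Real.log N - Real.log n : ℝ) : ℂ) + ∑ n ∈ Ioc 0 N, f n * ((Real.log n : ℝ) : ℂ) := by
    rw [← Finset.sum_add_distrib, Finset.mul_sum]
    refine Finset.sum_congr rfl fun n _ => ?_
    push_cast; ring
  have h1 : ‖∑ n ∈ Ioc 0 N, f n * ((Real.log N - Real.log n : ℝ) : ℂ)‖ ≤ N := by
    calc _ ≤ ∑ n ∈ Ioc 0 N, (Real.log N - Real.log n) := by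
          refine norm_sum_le_of_le _ fun n hn => ?_
          simp at hn
          have hl : Real.log n ≤ Real.log N := Real.log_le_log (by exact_mod_cast hn.1) (by exact_mod_cast hn.2)
          rw [norm_mul, Complex.norm_real, Real.norm_of_nonneg (by linarith)]
          exact mul_le_of_le_one_left (by linarith) (hf n)
      _ = N * Real.log N - ∑ n ∈ Ioc 0 N, Real.log n := by rw [Finset.sum_sub_distrib]; simp
      _ ≤ N := log_fact_ge N hN
  calc Real.log N * ‖∑ n ∈ Ioc 0 N, f n‖ = ‖((Real.log N : ℝ) : ℂ) * ∑ n ∈ Ioc 0 N, f n‖ := by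
        rw [norm_mul, Complex.norm_real, Real.norm_of_nonneg (Real.log_natCast_nonneg N)]
    _ ≤ _ := by rw [e]; exact (norm_add_le _ _).trans (by linarith)

lemma sum_flog (f : ℕ →*₀ ℂ) (N : ℕ) : ∑ n ∈ Ioc 0 N, f n * ((Real.log n : ℝ) : ℂ) = ∑ k ∈ Ioc 0 N, f k * ((Λ k : ℝ) : ℂ) * ∑ m ∈ Ioc 0 (N/k), f m := by
  let a : ArithmeticFunction ℂ := ⟨fun n => f n * ((Λ n : ℝ) : ℂ), by simp⟩
  let b : ArithmeticFunction ℂ := ⟨fun n => f n, by simp⟩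
  have h := sum_Ioc_mul_eq_sum_sum a b N
  have e : ∀ n, (a * b) n = f n * ((Real.log n : ℝ) : ℂ) := by
    intro n
    rw [ArithmeticFunction.mul_apply]
    have : ∀ p ∈ n.divisorsAntidiagonal, a p.1 * b p.2 = f n * ((Λ p.1 : ℝ) : ℂ) := by
      intro p hp
      rw [← (Nat.mem_divisorsAntidiagonal.1 hp).1, map_mul]
      change f p.1 * ((Λ p.1 : ℝ) : ℂ) * f p.2 = _
      ring
    rw [Finset.sum_congr rfl this, ← Finset.mul_sum, ← vonMangoldt_sum]
    rw [Nat.sum_divisorsAntidiagonal (f := fun a b => ((Λ a : ℝ) : ℂ))]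
    push_cast; rfl
  simp only [e] at h
  exact h

lemma sum_Lam_div (N : ℕ) (hN : 0 < N) : ∑ k ∈ Ioc 0 N, Λ k / k ≤ Real.log N + 6 := by
  have hN' : (0:ℝ) < N := by exact_mod_cast hN
  have h := sum_flog 1 N
  have h1 : ∑ n ∈ Ioc 0 N, Real.log n = ∑ k ∈ Ioc 0 N, Λ k * ((N/k : ℕ) : ℝ) := by
    have e1 : ∀ m ∈ Ioc 0 N, (1 : ℕ →*₀ ℂ) m = 1 := fun m hm => by
      rw [MonoidWithZeroHom.one_apply_of_ne_zero]; simp at hm; omega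
    have e2 : ∀ k ∈ Ioc 0 N, (1 : ℕ →*₀ ℂ) k * ((Λ k : ℝ) : ℂ) * ∑ m ∈ Ioc 0 (N/k), (1 : ℕ →*₀ ℂ) m = ((Λ k * ((N/k : ℕ) : ℝ) : ℝ) : ℂ) := by
      intro k hk
      rw [e1 k hk, Finset.sum_congr rfl (g := fun _ => (1:ℂ)) (fun m hm => by
        rw [e1]; simp at hm ⊢; exact ⟨hm.1, hm.2.trans (Nat.div_le_self _ _)⟩)]
      simp
    have e3 : ∀ n ∈ Ioc 0 N, (1 : ℕ →*₀ ℂ) n * ((Real.log n : ℝ) : ℂ) = ((Real.log n : ℝ) : ℂ) := fun n hn => by rw [e1 n hn, one_mul]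
    rw [Finset.sum_congr rfl e2, Finset.sum_congr rfl e3] at h
    exact_mod_cast h
  have h2 : ∑ n ∈ Ioc 0 N, Real.log n ≤ N * Real.log N := by
    calc _ ≤ ∑ n ∈ Ioc 0 N, Real.log N := by
          refine Finset.sum_le_sum fun n hn => ?_
          simp at hn
          exact Real.log_le_log (by exact_mod_cast hn.1) (by exact_mod_cast hn.2)
      _ = _ := by simp
  have h3 : ∑ k ∈ Ioc 0 N, Λ k * (N / k - 1 : ℝ) ≤ ∑ k ∈ Ioc 0 N, Λ k * ((N/k : ℕ) : ℝ) := by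
    refine Finset.sum_le_sum fun k hk => mul_le_mul_of_nonneg_left ?_ vonMangoldt_nonneg
    simp at hk
    have : (N:ℝ) < k * ((N/k : ℕ) + 1) := by exact_mod_cast Nat.lt_mul_div_succ N hk.1
    have hk' : (0:ℝ) < k := by exact_mod_cast hk.1
    rw [sub_le_iff_le_add, div_le_iff₀ hk']; linarith
  have h4 : ∑ k ∈ Ioc 0 N, Λ k ≤ 6 * N := by
    have := sum_Lam_le N hN'; rwa [Nat.floor_natCast] at this
  have h5 : ∑ k ∈ Ioc 0 N, Λ k * (N / k - 1 : ℝ) = N * ∑ k ∈ Ioc 0 N, Λ k / k - ∑ k ∈ Ioc 0 N, Λ k := by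
    rw [Finset.mul_sum, ← Finset.sum_sub_distrib]
    refine Finset.sum_congr rfl fun k _ => by ring
  have h6 : N * ∑ k ∈ Ioc 0 N, Λ k / k ≤ N * (Real.log N + 6) := by linarith
  exact le_of_mul_le_mul_left h6 hN'

lemma Gs_inv_le {η : ℝ} (M' : ℕ) (hM : 1 ≤ M') : (Gs ((2*M':ℝ)^2) (1+η))⁻¹ ≤ 2 * M' := by
  have hM0 : (1:ℝ) ≤ M' := by exact_mod_cast hM
  have hB : 0 < (2*M':ℝ)^2 := by positivity
  rw [Gs_eq hB]
  rw [inv_le_comm₀ (by have := Real.pi_pos; positivity) (by positivity), Real.sqrt_div Real.pi_pos.le, Real.sqrt_sq (by positivity)]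
  have h1 : 1 ≤ Real.exp ((1+η)^2/(4*(2*M':ℝ)^2)) := Real.one_le_exp (by positivity)
  have h2 : 1 ≤ √Real.pi := by rw [Real.one_le_sqrt]; linarith [Real.pi_gt_three]
  calc (2 * M' : ℝ)⁻¹ = 1 * (1 / (2 * M')) := by ring
    _ ≤ _ := by gcongr

lemma int_D_short {f : ℕ →*₀ ℂ} (hf : ∀ n, ‖f n‖ ≤ 1) {η B ε V : ℝ} (h1 : η ≤ 1) (hB : 1 ≤ B) (hε : 0 < ε) (hV : 0 < V) (hVη : η = 1/V)
    (hEi : Integrable (fun w => ‖EE f η B w‖^2)) (hE : ∫ w, ‖EE f η B w‖^2 ≤ ε^4 / η^3) :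
    ∫ w in Set.Ioc 0 V, ‖DD f η B w‖ ≤ ε * V * (11 * Real.exp 4 + 1) + 11 * Real.exp 4 / ε := by
  have h0 : 0 < η := by rw [hVη]; positivity
  set K := 11 * Real.exp 4 with hK
  have hK0 : 0 < K := by positivity
  set l := ε^2 * V with hl
  have hl0 : 0 < l := by positivity
  have hpt : ∀ w ∈ Set.Ioc 0 V, ‖DD f η B w‖ ≤ (Set.Ioc 0 (ε*V)).indicator (fun _ => K) w + ((K + l/2)/(ε*V) + 1/(2*l*(ε*V)) * ‖EE f η B w‖^2) := by
    intro w hw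
    have hp : 0 ≤ (K + l/2)/(ε*V) + 1/(2*l*(ε*V)) * ‖EE f η B w‖^2 := by positivity
    by_cases h : w ≤ ε*V
    · rw [Set.indicator_of_mem (show w ∈ Set.Ioc 0 (ε*V) from ⟨hw.1, h⟩)]
      linarith [DD_le' hf h0 h1 hB w]
    · rw [Set.indicator_of_notMem (fun hh => h hh.2), zero_add]
      push Not at h
      have k1 := wD_sub_E hf h0 h1 hB w
      rw [abs_of_pos hw.1] at k1
      have k2 : ‖EE f η B w‖ ≤ l/2 + ‖EE f η B w‖^2/(2*l) := by
        have : l/2 + ‖EE f η B w‖^2/(2*l) - ‖EE f η B w‖ = (‖EE f η B w‖ - l)^2/(2*l) := by field_simp; ring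
        have : 0 ≤ (‖EE f η B w‖ - l)^2/(2*l) := by positivity
        linarith
      have k3 : ε*V*‖DD f η B w‖ ≤ w * ‖DD f η B w‖ := by gcongr
      have e : (K + l/2)/(ε*V) + 1/(2*l*(ε*V)) * ‖EE f η B w‖^2 = (K + l/2 + ‖EE f η B w‖^2/(2*l))/(ε*V) := by field_simp
      rw [e, le_div_iff₀ (by positivity)]
      linarith
  have i1 : Integrable ((Set.Ioc 0 (ε*V)).indicator (fun _ => K)) :=
    (integrable_indicator_iff measurableSet_Ioc).2 (by simp)
  have i2 : IntegrableOn (fun _ : ℝ => (K + l/2)/(ε*V)) (Set.Ioc 0 V) := by simp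
  have i3 := hEi.const_mul (1/(2*l*(ε*V)))
  have iD : IntegrableOn (fun w => ‖DD f η B w‖) (Set.Ioc 0 V) := by
    have := (DD_cont hf h0 hB).norm.integrableOn_Icc (a := 0) (b := V) (μ := volume)
    exact this.mono_set Set.Ioc_subset_Icc_self
  calc _ ≤ ∫ w in Set.Ioc 0 V, ((Set.Ioc 0 (ε*V)).indicator (fun _ => K) w + ((K + l/2)/(ε*V) + 1/(2*l*(ε*V)) * ‖EE f η B w‖^2)) :=
        setIntegral_mono_on iD (i1.integrableOn.add (i2.add i3.integrableOn)) measurableSet_Ioc hpt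
    _ = (∫ w in Set.Ioc 0 V, (Set.Ioc 0 (ε*V)).indicator (fun _ => K) w) + ((K + l/2)/(ε*V) * V + ∫ w in Set.Ioc 0 V, 1/(2*l*(ε*V)) * ‖EE f η B w‖^2) := by
        have e1 := integral_add (μ := volume.restrict (Set.Ioc 0 V)) i1.integrableOn (i2.add i3.integrableOn)
        have e2 := integral_add (μ := volume.restrict (Set.Ioc 0 V)) i2 i3.integrableOn
        simp only [Pi.add_apply] at e1
        rw [e1, e2]
        congr 2
        simp [hV.le]; ring
    _ ≤ K * (ε*V) + ((K + l/2)/(ε*V) * V + 1/(2*l*(ε*V)) * (ε^4 / η^3)) := by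
        gcongr
        · refine (setIntegral_le_integral i1 (Eventually.of_forall fun w => Set.indicator_nonneg (fun _ _ => hK0.le) w)).trans ?_
          rw [integral_indicator measurableSet_Ioc]
          have : 0 ≤ ε * V := by positivity
          simp [this]; linarith
        · refine (setIntegral_le_integral i3 (Eventually.of_forall fun w => by positivity)).trans ?_
          rw [integral_const_mul]; gcongr
    _ = _ := by rw [hVη, hl]; field_simp; ring

lemma sum_Lam_int {f : ℕ →*₀ ℂ} (hf : ∀ n, ‖f n‖ ≤ 1) {η B : ℝ} (h1 : η ≤ 1) (hB : 1 ≤ B) (N : ℕ) (hV : 0 < Real.log N) (hVη : η = 1/Real.log N) (hN : 0 < N) :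
    ∑ k ∈ Ioc 0 N, Λ k * ∫ w in Set.Iic (Real.log (N/k)), Real.exp ((1+η) * w) * ‖DD f η B w‖ ≤
      6 * N * (11 * Real.exp 4 + 3 * ∫ w in Set.Ioc 0 (Real.log N), ‖DD f η B w‖) := by
  have h0 : 0 < η := by rw [hVη]; positivity
  have hN' : (0:ℝ) < N := by exact_mod_cast hN
  set V := Real.log N with hVd
  set K := 11 * Real.exp 4 with hK
  have hK0 : 0 < K := by positivity
  set g : ℝ → ℝ := fun w => Real.exp ((1+η) * w) * ‖DD f η B w‖ with hg
  have hgc : Continuous g := by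
    have := DD_cont hf h0 hB
    rw [hg]; fun_prop
  have hg0 : ∀ w, 0 ≤ g w := fun w => by positivity
  have hexp : ∀ v, IntegrableOn (fun w => Real.exp ((1+η) * w)) (Set.Iic v) := fun v => integrableOn_exp_mul_Iic (by linarith) v
  have hgb : ∀ w, g w ≤ K * Real.exp ((1+η) * w) := fun w => by
    rw [hg, mul_comm]; simp only; gcongr; exact DD_le' hf h0 h1 hB w
  have hgi : ∀ v, IntegrableOn g (Set.Iic v) := fun v =>
    ((hexp v).const_mul K).mono' hgc.aestronglyMeasurable (Eventually.of_forall fun w => by rw [Real.norm_of_nonneg (hg0 w)]; exact hgb w)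
  have hneg : ∫ w in Set.Iic 0, g w ≤ K := by
    calc _ ≤ ∫ w in Set.Iic 0, K * Real.exp ((1+η) * w) := integral_mono (hgi 0) ((hexp 0).const_mul K) hgb
      _ = K * (1 / (1+η)) := by rw [integral_const_mul, integral_exp_mul_Iic (by linarith)]; simp
      _ ≤ K * 1 := by gcongr; rw [div_le_one (by linarith)]; linarith
      _ = K := mul_one K
  have hpsi : ∑ k ∈ Ioc 0 N, Λ k ≤ 6 * N := by
    have := sum_Lam_le N hN'; rwa [Nat.floor_natCast] at this
  have hk : ∀ k ∈ Ioc 0 N, Λ k * ∫ w in Set.Iic (Real.log (N/k)), g w ≤ Λ k * K + ∫ w in Set.Ioc 0 V, (Set.Iic (Real.log (N/k))).indicator (fun w => Λ k * g w) w := by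
    intro k hk
    simp at hk
    have hk' : (0:ℝ) < k := by exact_mod_cast hk.1
    have hkN : (k:ℝ) ≤ N := by exact_mod_cast hk.2
    have hv : 0 ≤ Real.log (N/k) := Real.log_nonneg (by rwa [one_le_div hk'])
    have hvV : Real.log (N/k) ≤ V := by
      rw [hVd]; apply Real.log_le_log (by positivity)
      apply div_le_self hN'.le; exact_mod_cast hk.1
    rw [setIntegral_indicator measurableSet_Iic, integral_const_mul]
    have e : Set.Ioc 0 V ∩ Set.Iic (Real.log (N/k)) = Set.Ioc 0 (Real.log (N/k)) := by
      ext w; simp only [Set.mem_inter_iff, Set.mem_Ioc, Set.mem_Iic]; constructor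
      · rintro ⟨⟨a, b⟩, c⟩; exact ⟨a, c⟩
      · rintro ⟨a, b⟩; exact ⟨⟨a, b.trans hvV⟩, b⟩
    rw [e, ← mul_add]
    refine mul_le_mul_of_nonneg_left ?_ vonMangoldt_nonneg
    have := setIntegral_union (Set.Iic_disjoint_Ioc (le_refl 0)) measurableSet_Ioc (hgi 0) ((hgi (Real.log (N/k))).mono_set (Set.Ioc_subset_Iic_self)) (μ := volume)
    rw [Set.Iic_union_Ioc_eq_Iic hv] at this
    rw [this]; linarith
  have hVi : IntegrableOn g (Set.Ioc 0 V) := (hgi V).mono_set Set.Ioc_subset_Iic_self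
  have iD : IntegrableOn (fun w => ‖DD f η B w‖) (Set.Ioc 0 V) := by
    have := (DD_cont hf h0 hB).norm.integrableOn_Icc (a := 0) (b := V) (μ := volume)
    exact this.mono_set Set.Ioc_subset_Icc_self
  have hpt : ∀ w ∈ Set.Ioc 0 V, ∑ k ∈ Ioc 0 N, (Set.Iic (Real.log (N/k))).indicator (fun w => Λ k * g w) w ≤ 6 * N * 3 * ‖DD f η B w‖ := by
    intro w hw
    have hy : 0 < N * Real.exp (-w) := by positivity
    have e : ∑ k ∈ Ioc 0 N, (Set.Iic (Real.log (N/k))).indicator (fun w => Λ k * g w) w ≤ (∑ k ∈ Ioc 0 ⌊N * Real.exp (-w)⌋₊, Λ k) * g w := by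
      rw [Finset.sum_mul]
      calc _ = ∑ k ∈ (Ioc 0 N).filter (fun k : ℕ => w ≤ Real.log (N/k)), Λ k * g w := by
            rw [Finset.sum_filter]; rfl
        _ ≤ _ := by
            refine Finset.sum_le_sum_of_subset_of_nonneg (fun k hk => ?_) fun k _ _ => mul_nonneg vonMangoldt_nonneg (hg0 w)
            simp only [Finset.mem_filter, Finset.mem_Ioc] at hk ⊢
            have hk' : (0:ℝ) < k := by exact_mod_cast hk.1.1
            refine ⟨hk.1.1, Nat.le_floor ?_⟩
            have := hk.2
            rw [Real.le_log_iff_exp_le (by positivity), le_div_iff₀ hk'] at this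
            rw [Real.exp_neg, ← div_eq_mul_inv, le_div_iff₀ (Real.exp_pos _)]; linarith
    refine e.trans ?_
    have e3 : Real.exp (η * w) ≤ 3 := by
      have : η * w ≤ 1 := by rw [hVη, one_div, inv_mul_le_iff₀ hV]; linarith [hw.2]
      exact (Real.exp_le_exp.2 this).trans (by linarith [Real.exp_one_lt_d9])
    calc _ ≤ (6 * (N * Real.exp (-w))) * g w := mul_le_mul_of_nonneg_right (sum_Lam_le _ hy) (hg0 w)
      _ = 6 * N * Real.exp (η * w) * ‖DD f η B w‖ := by
        rw [hg]; simp only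
        rw [show η * w = -w + (1+η)*w by ring, Real.exp_add]; ring
      _ ≤ _ := by gcongr
  have hii : ∀ k ∈ Ioc 0 N, IntegrableOn ((Set.Iic (Real.log (N/k))).indicator (fun w => Λ k * g w)) (Set.Ioc 0 V) := fun k _ =>
    (hVi.const_mul (Λ k)).indicator measurableSet_Iic
  calc _ ≤ ∑ k ∈ Ioc 0 N, (Λ k * K + ∫ w in Set.Ioc 0 V, (Set.Iic (Real.log (N/k))).indicator (fun w => Λ k * g w) w) := Finset.sum_le_sum hk
    _ = (∑ k ∈ Ioc 0 N, Λ k) * K + ∫ w in Set.Ioc 0 V, ∑ k ∈ Ioc 0 N, (Set.Iic (Real.log (N/k))).indicator (fun w => Λ k * g w) w := by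
        rw [Finset.sum_add_distrib, ← Finset.sum_mul, integral_finset_sum _ hii]
    _ ≤ 6 * N * K + ∫ w in Set.Ioc 0 V, 6 * N * 3 * ‖DD f η B w‖ := by
        refine add_le_add (mul_le_mul_of_nonneg_right hpsi hK0.le) ?_
        exact setIntegral_mono_on (integrable_finset_sum _ hii) (iD.const_mul _) measurableSet_Ioc hpt
    _ = _ := by rw [integral_const_mul]; ring

end

section
open Filter Topology Finset MeasureTheory ComplexConjugate ArithmeticFunction

lemma halasz_step {f : ℕ →*₀ ℂ} (hf : ∀ n, ‖f n‖ ≤ 1) {η ε : ℝ} (h1 : η ≤ 1) (M' : ℕ) (hM : 1 ≤ M') (hε : 0 < ε)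
    (N : ℕ) (hN : 0 < N) (hV : 0 < Real.log N) (hVη : η = 1 / Real.log N) 
    (hEi : Integrable (fun w => ‖EE f η ((2*M':ℝ)^2) w‖^2)) (hE : ∫ w, ‖EE f η ((2*M':ℝ)^2) w‖^2 ≤ ε^4 / η^3) :
    Real.log N * ‖∑ n ∈ Ioc 0 N, f n‖ ≤ N * (37 + 12 * M' * (11 * Real.exp 4 + 3 * (ε * Real.log N * (11 * Real.exp 4 + 1) + 11 * Real.exp 4 / ε)) + 6 / M' * (Real.log N + 6)) := by
  have hM0 : (1:ℝ) ≤ M' := by exact_mod_cast hM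
  have hN' : (0:ℝ) < N := by exact_mod_cast hN
  have h0 : 0 < η := by rw [hVη]; positivity
  set B := (2*M':ℝ)^2 with hBd
  have hB : 1 ≤ B := by nlinarith
  have a1 := norm_sum_log_diff hf N hN
  rw [sum_flog] at a1
  have a2 : ∀ k ∈ Ioc 0 N, ‖f k * ((Λ k : ℝ) : ℂ) * ∑ m ∈ Ioc 0 (N/k), f m‖ ≤
      2 * M' * (Λ k * ∫ w in Set.Iic (Real.log (N/k)), Real.exp ((1+η) * w) * ‖DD f η B w‖) + (6 * Λ k + 6 * N / M' * (Λ k / k)) := by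
    intro k hk
    simp at hk
    have hk' : (0:ℝ) < k := by exact_mod_cast hk.1
    have hy : (0:ℝ) < N / k := by positivity
    have hs := smooth hf h0 h1 M' hM hy
    rw [Nat.floor_div_natCast, Nat.floor_natCast] at hs
    have hl := vonMangoldt_nonneg (n := k)
    rw [norm_mul, norm_mul, Complex.norm_real, Real.norm_of_nonneg hl]
    have hI : ‖∫ w in Set.Iic (Real.log (N/k)), ((Real.exp ((1+η) * w) : ℝ) : ℂ) * DD f η B w‖ ≤ ∫ w in Set.Iic (Real.log (N/k)), Real.exp ((1+η) * w) * ‖DD f η B w‖ := by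
      refine (norm_integral_le_integral_norm _).trans (le_of_eq ?_)
      congr 1; ext w; rw [norm_mul, Complex.norm_real, Real.norm_of_nonneg (Real.exp_pos _).le]
    set II := ∫ w in Set.Iic (Real.log (N/k)), Real.exp ((1+η) * w) * ‖DD f η B w‖
    have hG := Gs_inv_le (η := η) M' hM
    have hG0 := Gs_pos (by linarith : 0 < B) (1+η)
    have hb : ‖∑ m ∈ Ioc 0 (N/k), f m‖ ≤ 2 * M' * II + (6 + 6 * (N/k) / M') := by
      have h3 : ‖(((Gs B (1+η))⁻¹ : ℝ) : ℂ) * ∫ w in Set.Iic (Real.log (N/k)), ((Real.exp ((1+η) * w) : ℝ) : ℂ) * DD f η B w‖ ≤ 2 * M' * II := by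
        rw [norm_mul, Complex.norm_real, Real.norm_of_nonneg (inv_pos.2 hG0).le]
        gcongr
      have h4 := norm_add_le (∑ m ∈ Ioc 0 (N/k), f m - (((Gs B (1+η))⁻¹ : ℝ) : ℂ) * ∫ w in Set.Iic (Real.log (N/k)), ((Real.exp ((1+η) * w) : ℝ) : ℂ) * DD f η B w) ((((Gs B (1+η))⁻¹ : ℝ) : ℂ) * ∫ w in Set.Iic (Real.log (N/k)), ((Real.exp ((1+η) * w) : ℝ) : ℂ) * DD f η B w)
      rw [sub_add_cancel] at h4
      linarith
    calc _ ≤ 1 * Λ k * (2 * M' * II + (6 + 6 * (N/k) / M')) := by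
          gcongr; exact hf k
      _ = _ := by ring
  have hpsi : ∑ k ∈ Ioc 0 N, Λ k ≤ 6 * N := by
    have := sum_Lam_le N hN'; rwa [Nat.floor_natCast] at this
  have hdiv := sum_Lam_div N hN
  have hintegr := sum_Lam_int hf h1 hB N hV hVη hN
  have hsh := int_D_short hf h1 hB hε hV hVη hEi hE
  have a3 : ‖∑ k ∈ Ioc 0 N, f k * ((Λ k : ℝ) : ℂ) * ∑ m ∈ Ioc 0 (N/k), f m‖ ≤ 
      2 * M' * (6 * N * (11 * Real.exp 4 + 3 * (ε * Real.log N * (11 * Real.exp 4 + 1) + 11 * Real.exp 4 / ε))) + (6 * (6 * N) + 6 * N / M' * (Real.log N + 6)) := by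
    refine (norm_sum_le_of_le _ a2).trans ?_
    rw [Finset.sum_add_distrib, Finset.sum_add_distrib, ← Finset.mul_sum, ← Finset.mul_sum, ← Finset.mul_sum]
    gcongr
    refine hintegr.trans ?_
    gcongr
  refine a1.trans ((add_le_add_right a3 _).trans (le_of_eq ?_))
  ring

theorem halasz {f : ℕ →*₀ ℂ} (hf : ∀ n, ‖f n‖ ≤ 1)
    (hR : ∀ T ε : ℝ, 0 < ε → ∃ δ, 0 < δ ∧ ∀ σ : ℝ, 1 < σ → σ < 1 + δ → ∀ t : ℝ, |t| ≤ T → ‖FH f σ t‖ * (σ - 1) ≤ ε)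
    {ε : ℝ} (hε : 0 < ε) : ∃ N0 : ℕ, ∀ N : ℕ, N0 ≤ N → ‖∑ n ∈ Ioc 0 N, f n‖ ≤ ε * N := by
  obtain ⟨M', hM'⟩ := exists_nat_ge (24/ε + 1)
  have hM1 : (1:ℝ) ≤ M' := by have : 0 < 24/ε := by positivity
                              linarith
  have hM : 1 ≤ M' := by exact_mod_cast hM1
  set K := 11 * Real.exp 4 with hK
  have hK0 : 0 < K := by positivity
  set κ := ε / (4 * (36 * M' * (K+1))) with hκ
  have hκ0 : 0 < κ := by positivity
  have hB : 1 ≤ (2*M':ℝ)^2 := by nlinarith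
  obtain ⟨η0, hη0, h⟩ := EE_sq hf hR hB (δ := κ^4) (by positivity)
  set C := 37 + 12 * M' * (K + 3 * (K/κ)) + 6/M' * 6 with hC
  have ht : Tendsto (fun N : ℕ => Real.log N) atTop atTop := Real.tendsto_log_atTop.comp tendsto_natCast_atTop_atTop
  have hev := ((ht.eventually_gt_atTop (1/η0 + 1)).and (ht.eventually_ge_atTop (2*C/ε))).and (eventually_gt_atTop 0)
  obtain ⟨N0, hN0⟩ := eventually_atTop.1 hev
  refine ⟨N0, fun N hN => ?_⟩
  obtain ⟨⟨g1, g2⟩, g3⟩ := hN0 N hN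
  set V := Real.log N
  have hi : 0 < 1/η0 := by positivity
  have hV : 1 < V := by linarith
  have hV0 : 0 < V := by linarith
  have hlt : 1/V < η0 := by
    rw [one_div_lt hV0 hη0]; linarith
  obtain ⟨e1, e2⟩ := h (1/V) (by positivity) hlt
  have hs := halasz_step hf (by rw [div_le_one hV0]; exact hV.le) M' hM hκ0 N g3 hV0 rfl e1 e2
  have hN' : (0:ℝ) < N := by exact_mod_cast g3
  have hfin : 37 + 12 * M' * (K + 3 * (κ * V * (K + 1) + K / κ)) + 6 / M' * (V + 6) ≤ ε * V := by
    have b1 : 12 * M' * 3 * (κ * V * (K+1)) = ε / 4 * V := by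
      rw [hκ]; field_simp; ring
    have b2 : 6/M' ≤ ε/4 := by
      rw [div_le_iff₀ (by linarith)]
      have : 24/ε ≤ M' := by linarith
      rw [div_le_iff₀ hε] at this; linarith
    have b3 : C ≤ ε/2 * V := by
      rw [div_le_iff₀ hε] at g2; linarith
    have b4 : 6/M' * V ≤ ε/4 * V := by gcongr
    have e : 37 + 12 * M' * (K + 3 * (κ * V * (K + 1) + K / κ)) + 6 / M' * (V + 6) = C + 12 * M' * 3 * (κ * V * (K+1)) + 6/M' * V := by rw [hC]; ring
    rw [e]; linarith
  have : V * ‖∑ n ∈ Ioc 0 N, f n‖ ≤ V * (ε * N) := by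
    calc _ ≤ _ := hs
      _ ≤ N * (ε * V) := by gcongr
      _ = _ := by ring
  exact le_of_mul_le_mul_left this hV0

end

section
open Filter Topology Finset MeasureTheory ComplexConjugate ArithmeticFunction

lemma A_def (n : ℕ) : A n = (n.primeFactorsList.map (Nat.cast : ℕ → ℤ)).sum := by
  unfold A
  congr 1
  simp [List.map_eq_flatMap]

lemma A_mul {m n : ℕ} (hm : m ≠ 0) (hn : n ≠ 0) : A (m * n) = A m + A n := by
  rw [A_def, A_def, A_def, ((Nat.perm_primeFactorsList_mul hm hn).map _).sum_eq, List.map_append, List.sum_append]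

lemma A_one : A 1 = 0 := by simp [A]
lemma A_prime {p : ℕ} (hp : p.Prime) : A p = p := by simp [A, Nat.primeFactorsList_prime hp]

/-- additive character -/
noncomputable def ee (θ : ℝ) : ℂ := Complex.exp (2 * Real.pi * θ * Complex.I)

lemma ee_add (a b : ℝ) : ee (a + b) = ee a * ee b := by
  unfold ee; rw [← Complex.exp_add]; congr 1; push_cast; ring
lemma ee_norm (a : ℝ) : ‖ee a‖ = 1 := by
  unfold ee
  have := Complex.norm_exp_ofReal_mul_I (2 * Real.pi * a)
  push_cast at this; exact this
lemma ee_zero : ee 0 = 1 := by simp [ee]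
lemma ee_eq_one (a : ℝ) : ee a = 1 ↔ ∃ n : ℤ, a = n := by
  unfold ee
  rw [Complex.exp_eq_one_iff]
  constructor
  · rintro ⟨n, hn⟩
    refine ⟨n, ?_⟩
    have h : (2 * Real.pi * Complex.I : ℂ) ≠ 0 := by simp [Real.pi_ne_zero]
    have : (2 * Real.pi * Complex.I : ℂ) * a = (2 * Real.pi * Complex.I : ℂ) * n := by linear_combination hn
    exact_mod_cast mul_left_cancel₀ h this
  · rintro ⟨n, rfl⟩
    exact ⟨n, by push_cast; ring⟩
lemma ee_int (n : ℤ) : ee n = 1 := (ee_eq_one _).2 ⟨n, rfl⟩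
lemma ee_mul_nat (k : ℕ) (a : ℝ) : ee (k * a) = ee a ^ k := by
  unfold ee; rw [← Complex.exp_nat_mul]; congr 1; push_cast; ring

noncomputable def fA (θ : ℝ) : ℕ →*₀ ℂ where
  toFun n := if n = 0 then 0 else ee (θ * A n)
  map_zero' := by simp
  map_one' := by simp [A_one, ee_zero]
  map_mul' m n := by
    by_cases hm : m = 0
    · simp [hm]
    by_cases hn : n = 0
    · simp [hn]
    simp only [hm, hn, mul_eq_zero, or_self, if_false]
    rw [A_mul hm hn, ← ee_add]; congr 1; push_cast; ring

lemma fA_apply (θ : ℝ) {n : ℕ} (hn : n ≠ 0) : fA θ n = ee (θ * A n) := by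
  change (if n = 0 then 0 else ee (θ * A n)) = _
  rw [if_neg hn]

lemma root_gap {z : ℂ} {d : ℕ} (hd : 0 < d) (h1 : ‖z‖ = 1) (hz : z ^ d = 1) (hne : z ≠ 1) : (1:ℝ) / d ≤ ‖1 - z‖ := by
  have hd' : (0:ℝ) < d := by exact_mod_cast hd
  have hs : ∑ k ∈ range d, z ^ k = 0 := by
    rw [geom_sum_eq hne, hz]; simp
  have e : (d:ℂ) = ∑ k ∈ range d, (1 - z ^ k) := by rw [Finset.sum_sub_distrib, hs]; simp
  have h2 : (d:ℝ) ≤ ∑ k ∈ range d, (d:ℝ) * ‖1 - z‖ := by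
    calc (d:ℝ) = ‖(d:ℂ)‖ := by simp
      _ = ‖∑ k ∈ range d, (1 - z ^ k)‖ := by rw [← e]
      _ ≤ _ := by
        refine norm_sum_le_of_le _ fun k hk => (norm_one_sub_pow z h1 k).trans ?_
        have : (k:ℝ) ≤ d := by exact_mod_cast (Finset.mem_range.1 hk).le
        gcongr
  simp at h2
  rw [div_le_iff₀ hd']
  by_contra hlt
  push Not at hlt
  nlinarith

theorem halasz_A {d r : ℕ} (hd : 2 ≤ d) (hr : r.Coprime d) {ε : ℝ} (hε : 0 < ε) :
    ∃ N0 : ℕ, ∀ N : ℕ, N0 ≤ N → ‖∑ n ∈ Ioc 0 N, fA (r/d) n‖ ≤ ε * N := by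
  have hd' : (0:ℝ) < d := by positivity
  have hn1 : ∀ n ≠ 0, ‖fA (r/d) n‖ = 1 := fun n hn => by rw [fA_apply _ hn, ee_norm]
  have hle : ∀ n, ‖fA (r/d) n‖ ≤ 1 := fun n => by
    by_cases h : n = 0
    · simp [h]
    · exact (hn1 n h).le
  have hpow : ∀ n ≠ 0, fA (r/d) n ^ d = 1 := fun n hn => by
    rw [fA_apply _ hn, ← ee_mul_nat, show (d:ℝ) * ((r:ℝ)/d * A n) = ((r * A n : ℤ) : ℝ) by push_cast; field_simp, ee_int]
  refine halasz hle (fun T ε hε => R_unif (fA (r/d)) hn1 (by omega) hpow (c := (1/d)^2) (by positivity) d (fun p hp hpd => ?_) T hε) hε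
  gcongr
  refine root_gap (by omega) (hn1 p hp.ne_zero) (hpow p hp.ne_zero) fun h => ?_
  rw [fA_apply _ hp.ne_zero, A_prime hp, ee_eq_one] at h
  obtain ⟨n, hn⟩ := h
  have h2 : ((r * p : ℕ) : ℤ) = d * n := by
    have : (r:ℝ) * p = d * n := by rw [← hn]; push_cast; field_simp
    exact_mod_cast this
  have h3 : d ∣ r * p := by exact_mod_cast Dvd.intro n h2.symm
  have h4 := (Nat.Coprime.dvd_mul_left hr.symm).1 h3
  rcases (Nat.dvd_prime hp).1 h4 with h | h <;> omega

theorem halasz_unif (d0 : ℕ) {ε : ℝ} (hε : 0 < ε) :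
    ∃ N0 : ℕ, ∀ d r : ℕ, 2 ≤ d → d < d0 → r < d → r.Coprime d → ∀ N : ℕ, N0 ≤ N → ‖∑ n ∈ Ioc 0 N, fA (r/d) n‖ ≤ ε * N := by
  have h : ∀ dr : ℕ × ℕ, ∃ N0 : ℕ, 2 ≤ dr.1 → dr.2.Coprime dr.1 → ∀ N : ℕ, N0 ≤ N → ‖∑ n ∈ Ioc 0 N, fA (dr.2/dr.1) n‖ ≤ ε * N := by
    intro dr
    by_cases h : 2 ≤ dr.1 ∧ dr.2.Coprime dr.1
    · obtain ⟨N0, h0⟩ := halasz_A h.1 h.2 hε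
      exact ⟨N0, fun _ _ => h0⟩
    · exact ⟨0, fun a b => absurd ⟨a, b⟩ h⟩
  choose F hF using h
  refine ⟨∑ dr ∈ range d0 ×ˢ range d0, F dr, fun d r hd hd0 hrd hr N hN => hF (d, r) hd hr N (le_trans ?_ hN)⟩
  exact Finset.single_le_sum (f := F) (fun _ _ => Nat.zero_le _) (by simp; omega)

end

section
open Filter Topology Finset ArithmeticFunction
open scoped ArithmeticFunction.Moebius ArithmeticFunction.zeta

lemma sum_moebius_ite {m g : ℕ} (hm : Squarefree m) :
    ∑ e ∈ m.divisors with g ∣ e, (μ e : ℝ) = if m = g then (μ g : ℝ) else 0 := by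
  have hm0 : m ≠ 0 := hm.ne_zero
  by_cases hg : g ∣ m
  · obtain ⟨k, rfl⟩ := hg
    have hg0 : g ≠ 0 := by rintro rfl; simp at hm0
    have hk0 : k ≠ 0 := by rintro rfl; simp at hm0
    have h1 : ∑ e ∈ (g * k).divisors with g ∣ e, (μ e : ℝ) = ∑ j ∈ k.divisors, (μ g : ℝ) * (μ j : ℝ) := by
      symm
      refine Finset.sum_bij (fun j _ => g * j) ?_ ?_ ?_ ?_
      · intro j hj
        simp only [mem_filter, Nat.mem_divisors] at hj ⊢
        exact ⟨⟨Nat.mul_dvd_mul_left g hj.1, hm0⟩, dvd_mul_right _ _⟩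
      · intro a _ b _ h
        exact Nat.eq_of_mul_eq_mul_left (Nat.pos_of_ne_zero hg0) h
      · intro b hb
        simp only [mem_filter, Nat.mem_divisors] at hb
        obtain ⟨⟨hb1, _⟩, j, rfl⟩ := hb
        exact ⟨j, by simp [hk0, Nat.dvd_of_mul_dvd_mul_left (Nat.pos_of_ne_zero hg0) hb1], rfl⟩
      · intro j hj
        have hj' := Nat.dvd_of_mem_divisors hj
        have hc : Nat.Coprime g j := by
          have : Nat.Coprime g k := Nat.coprime_of_squarefree_mul hm
          exact this.coprime_dvd_right hj'
        rw [isMultiplicative_moebius.map_mul_of_coprime hc]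
        push_cast; ring
    rw [h1, ← mul_sum]
    have h2 : ∑ j ∈ k.divisors, (μ j : ℝ) = if k = 1 then 1 else 0 := by
      have := congrArg (fun f : ArithmeticFunction ℤ => f k) moebius_mul_coe_zeta
      simp only [coe_mul_zeta_apply, one_apply] at this
      exact_mod_cast this
    rw [h2]
    by_cases hk : k = 1
    · simp [hk]
    · have : ¬ (g * k = g) := by
        intro h; apply hk
        exact Nat.eq_of_mul_eq_mul_left (Nat.pos_of_ne_zero hg0) (by omega)
      simp [hk, this]
      
  · rw [if_neg (by rintro rfl; exact hg dvd_rfl)]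
    apply Finset.sum_eq_zero
    intro e he
    simp only [mem_filter, Nat.mem_divisors] at he
    exact absurd (he.2.trans he.1.1) hg

/-- sifting moduli -/
def selS (q z : ℕ) : Finset ℕ := (Icc 1 z).filter (fun m => Squarefree m ∧ m.Coprime q)

noncomputable def selG (q z : ℕ) : ℝ := ∑ m ∈ selS q z, 1 / (m.totient : ℝ)

noncomputable def selLam (q z e : ℕ) : ℝ :=
  (μ e : ℝ) * e / selG q z * ∑ m ∈ selS q z with e ∣ m, 1 / (m.totient : ℝ)

lemma mem_selS {q z m : ℕ} : m ∈ selS q z ↔ (1 ≤ m ∧ m ≤ z) ∧ Squarefree m ∧ m.Coprime q := by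
  simp [selS]

lemma selS_dvd {q z m e : ℕ} (hm : m ∈ selS q z) (he : e ∣ m) : e ∈ selS q z := by
  rw [mem_selS] at hm ⊢
  exact ⟨⟨Nat.pos_of_dvd_of_pos he hm.1.1, (Nat.le_of_dvd hm.1.1 he).trans hm.1.2⟩,
    hm.2.1.squarefree_of_dvd he, hm.2.2.coprime_dvd_left he⟩

lemma one_mem_selS {q z : ℕ} (hz : 1 ≤ z) : 1 ∈ selS q z := by simp [mem_selS, hz]

lemma selG_pos {q z : ℕ} (hz : 1 ≤ z) : 0 < selG q z := by
  have : (1:ℝ) / (Nat.totient 1 : ℝ) ≤ selG q z :=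
    Finset.single_le_sum (f := fun m : ℕ => 1 / (m.totient : ℝ)) (fun i _ => by positivity) (one_mem_selS hz)
  simp at this
  linarith

lemma selLam_one {q z : ℕ} (hz : 1 ≤ z) : selLam q z 1 = 1 := by
  have := (selG_pos (q := q) hz).ne'
  have h : (selS q z).filter (fun m => 1 ∣ m) = selS q z := by simp
  rw [selLam, h]
  rw [← selG]
  simp [this]

lemma selLam_abs {q z : ℕ} (hz : 1 ≤ z) (e : ℕ) : |selLam q z e| ≤ e := by
  have hG := selG_pos (q := q) hz
  have h1 : ∑ m ∈ selS q z with e ∣ m, 1 / (m.totient : ℝ) ≤ selG q z :=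
    Finset.sum_le_sum_of_subset_of_nonneg (filter_subset _ _) (fun i _ _ => by positivity)
  have h0 : 0 ≤ ∑ m ∈ selS q z with e ∣ m, 1 / (m.totient : ℝ) := Finset.sum_nonneg (fun i _ => by positivity)
  have hmu : |(μ e : ℝ)| ≤ 1 := by exact_mod_cast abs_moebius_le_one
  rw [selLam, abs_mul, abs_div, abs_mul, abs_of_nonneg h0, abs_of_pos hG, Nat.abs_cast, div_mul_eq_mul_div,
    div_le_iff₀ hG]
  calc |(μ e : ℝ)| * e * _ ≤ 1 * e * selG q z := by gcongr
    _ = _ := by ring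

lemma selY {q z : ℕ} (g : ℕ) :
    ∑ e ∈ selS q z with g ∣ e, selLam q z e / e =
      if g ∈ selS q z then (μ g : ℝ) / (selG q z * g.totient) else 0 := by
  have h1 : ∀ e ∈ (selS q z).filter (fun e => g ∣ e), selLam q z e / e =
      ∑ m ∈ selS q z, if e ∣ m then (μ e : ℝ) / selG q z * (1 / (m.totient : ℝ)) else 0 := by
    intro e he
    have he1 : (e:ℝ) ≠ 0 := by
      have := (mem_selS.mp (mem_filter.mp he).1).1.1
      positivity
    rw [selLam, ← Finset.sum_filter, ← mul_sum]
    field_simp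
  rw [Finset.sum_congr rfl h1, Finset.sum_comm]
  have h2 : ∀ m ∈ selS q z, (∑ e ∈ selS q z with g ∣ e, if e ∣ m then (μ e : ℝ) / selG q z * (1 / (m.totient : ℝ)) else 0)
      = if m = g then (μ g : ℝ) / (selG q z * g.totient) else 0 := by
    intro m hm
    have hm' := mem_selS.mp hm
    rw [← Finset.sum_filter, filter_filter]
    have : (selS q z).filter (fun e => g ∣ e ∧ e ∣ m) = m.divisors.filter (fun e => g ∣ e) := by
      ext e
      simp only [mem_filter, Nat.mem_divisors]
      constructor
      · rintro ⟨_, h, h'⟩; exact ⟨⟨h', by omega⟩, h⟩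
      · rintro ⟨⟨h', _⟩, h⟩; exact ⟨selS_dvd hm h', h, h'⟩
    rw [this, ← Finset.sum_mul, ← Finset.sum_div, sum_moebius_ite hm'.2.1]
    split_ifs with h
    · subst h; field_simp
    · simp
  rw [Finset.sum_congr rfl h2, Finset.sum_ite_eq']

lemma sel_quad {q z : ℕ} (hz : 1 ≤ z) :
    ∑ e ∈ selS q z, ∑ e' ∈ selS q z, selLam q z e * selLam q z e' / (Nat.lcm e e' : ℝ) = 1 / selG q z := by
  have hG := selG_pos (q := q) hz
  have h1 : ∀ e ∈ selS q z, ∀ e' ∈ selS q z, selLam q z e * selLam q z e' / (Nat.lcm e e' : ℝ) =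
      ∑ g ∈ selS q z, (g.totient : ℝ) * ((if g ∣ e then selLam q z e / e else 0) * (if g ∣ e' then selLam q z e' / e' else 0)) := by
    intro e he e' he'
    have h0 := (mem_selS.mp he).1.1
    have h0' := (mem_selS.mp he').1.1
    have h2 : ∑ g ∈ selS q z, (g.totient : ℝ) * ((if g ∣ e then selLam q z e / e else 0) * (if g ∣ e' then selLam q z e' / e' else 0))
       = ∑ g ∈ (Nat.gcd e e').divisors, (g.totient : ℝ) * (selLam q z e / e * (selLam q z e' / e')) := by
      have : (Nat.gcd e e').divisors = (selS q z).filter (fun g => g ∣ e ∧ g ∣ e') := by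
        ext g
        simp only [mem_filter, Nat.mem_divisors, Nat.dvd_gcd_iff]
        constructor
        · rintro ⟨⟨h, h'⟩, _⟩; exact ⟨selS_dvd he h, h, h'⟩
        · rintro ⟨_, h⟩; exact ⟨h, (Nat.gcd_pos_of_pos_left _ h0).ne'⟩
      rw [this, Finset.sum_filter]
      apply Finset.sum_congr rfl
      intro g _
      by_cases h : g ∣ e <;> by_cases h' : g ∣ e' <;> simp [h, h']
    rw [h2, ← Finset.sum_mul, ← Nat.cast_sum, Nat.sum_totient]
    have h3 : ((Nat.gcd e e' : ℕ) : ℝ) * (Nat.lcm e e' : ℕ) = e * e' := by exact_mod_cast Nat.gcd_mul_lcm e e'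
    have h4 : ((Nat.lcm e e' : ℕ) : ℝ) ≠ 0 := by
      have := Nat.lcm_pos h0 h0'; positivity
    field_simp
    linear_combination (-(selLam q z e * selLam q z e')) * h3
  rw [Finset.sum_congr rfl (fun e he => Finset.sum_congr rfl (h1 e he))]
  have h2 : (∑ e ∈ selS q z, ∑ e' ∈ selS q z, ∑ g ∈ selS q z, (g.totient : ℝ) * ((if g ∣ e then selLam q z e / e else 0) * (if g ∣ e' then selLam q z e' / e' else 0)))
     = ∑ g ∈ selS q z, (g.totient : ℝ) * (∑ e ∈ selS q z with g ∣ e, selLam q z e / e)^2 := by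
    rw [Finset.sum_congr rfl (fun e _ => Finset.sum_comm), Finset.sum_comm]
    apply Finset.sum_congr rfl
    intro g _
    rw [Finset.sum_filter, sq, Finset.sum_mul_sum, mul_sum]
    apply Finset.sum_congr rfl
    intro e _
    rw [mul_sum]
  rw [h2]
  have h3 : ∀ g ∈ selS q z, (g.totient : ℝ) * (∑ e ∈ selS q z with g ∣ e, selLam q z e / e)^2 = 1 / (g.totient : ℝ) / selG q z ^ 2 := by
    intro g hg
    rw [selY, if_pos hg]
    have hmu : (μ g : ℝ)^2 = 1 := by exact_mod_cast moebius_sq_eq_one_of_squarefree (mem_selS.mp hg).2.1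
    have : (g.totient : ℝ) ≠ 0 := by
      have := Nat.totient_pos.mpr (mem_selS.mp hg).1.1; positivity
    rw [div_pow, hmu]
    field_simp
  rw [Finset.sum_congr rfl h3, ← Finset.sum_div, ← selG]
  field_simp

end

section
open Filter Topology Finset

lemma count_modEq_abs (u H r : ℕ) (hr : 0 < r) (v : ℕ) :
    |((((Ioc u (u+H)).filter (fun n => n ≡ v [MOD r])).card : ℕ) : ℝ) - H / r| ≤ 1 := by
  have h := Nat.Ioc_filter_modEq_card u (u+H) hr v
  have hrr : (0:ℚ) < r := by exact_mod_cast hr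
  have hle : ⌊((u:ℚ) - v) / r⌋ ≤ ⌊(((u+H : ℕ):ℚ) - v) / r⌋ := by
    apply Int.floor_le_floor
    push_cast
    gcongr
    have : (0:ℚ) ≤ H := by positivity
    linarith
  rw [max_eq_left (by linarith)] at h
  have h' : ((((Ioc u (u+H)).filter (fun n => n ≡ v [MOD r])).card : ℕ) : ℚ) = (⌊(((u+H : ℕ):ℚ) - v) / r⌋ : ℚ) - (⌊((u:ℚ) - v) / r⌋ : ℚ) := by
    exact_mod_cast h
  have e1 := Int.floor_le ((((u+H : ℕ):ℚ) - v) / r)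
  have e2 := Int.lt_floor_add_one ((((u+H : ℕ):ℚ) - v) / r)
  have e3 := Int.floor_le (((u:ℚ) - v) / r)
  have e4 := Int.lt_floor_add_one (((u:ℚ) - v) / r)
  have e5 : (((u+H : ℕ):ℚ) - v) / r = ((u:ℚ) - v) / r + H / r := by push_cast; ring
  have : |((((Ioc u (u+H)).filter (fun n => n ≡ v [MOD r])).card : ℕ) : ℚ) - H / r| ≤ 1 := by
    rw [h', abs_le]
    constructor <;> linarith
  have h6 : ((|((((Ioc u (u+H)).filter (fun n => n ≡ v [MOD r])).card : ℕ) : ℚ) - H / r| : ℚ) : ℝ) ≤ ((1:ℚ):ℝ) := Rat.cast_le.mpr this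
  push_cast at h6
  exact h6

lemma count_two (u H q l : ℕ) (hq : 0 < q) (hl : 0 < l) (hc : l.Coprime q) (v : ℕ) :
    |((((Ioc u (u+H)).filter (fun n => n ≡ v [MOD q] ∧ l ∣ n)).card : ℕ) : ℝ) - H / (q * l)| ≤ 1 := by
  obtain ⟨c, hc1, hc2⟩ := Nat.chineseRemainder hc.symm v 0
  have : (Ioc u (u+H)).filter (fun n => n ≡ v [MOD q] ∧ l ∣ n) = (Ioc u (u+H)).filter (fun n => n ≡ c [MOD (q*l)]) := by
    ext n
    simp only [mem_filter, and_congr_right_iff]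
    intro _
    rw [← Nat.modEq_and_modEq_iff_modEq_mul hc.symm]
    constructor
    · rintro ⟨h1, h2⟩
      exact ⟨h1.trans hc1.symm, ((Nat.modEq_zero_iff_dvd.mpr h2)).trans hc2.symm⟩
    · rintro ⟨h1, h2⟩
      exact ⟨h1.trans hc1, Nat.modEq_zero_iff_dvd.mp (h2.trans hc2)⟩
  rw [this]
  have := count_modEq_abs u H (q*l) (by positivity) c
  push_cast at this
  exact this

theorem sel_sieve (q z u H v : ℕ) (hq : 0 < q) (hz : 1 ≤ z) :
    ((((Ioc u (u+H)).filter (fun p => p.Prime ∧ z < p ∧ p ≡ v [MOD q])).card : ℕ) : ℝ) ≤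
      H / q / selG q z + (z:ℝ)^4 := by
  set S := selS q z with hS
  set lam := selLam q z with hlam
  set N := (Ioc u (u+H)).filter (fun n => n ≡ v [MOD q]) with hN
  have h1 : ((((Ioc u (u+H)).filter (fun p => p.Prime ∧ z < p ∧ p ≡ v [MOD q])).card : ℕ) : ℝ) ≤
      ∑ n ∈ N, (∑ e ∈ S with e ∣ n, lam e)^2 := by
    rw [Finset.card_eq_sum_ones]
    push_cast
    have : (Ioc u (u+H)).filter (fun p => p.Prime ∧ z < p ∧ p ≡ v [MOD q]) ⊆ N := by
      intro p hp
      simp only [hN, mem_filter] at hp ⊢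
      exact ⟨hp.1, hp.2.2.2⟩
    refine le_trans ?_ (Finset.sum_le_sum_of_subset_of_nonneg this (fun i _ _ => sq_nonneg _))
    apply Finset.sum_le_sum
    intro p hp
    simp only [mem_filter] at hp
    obtain ⟨_, hp, hzp, _⟩ := hp
    have : S.filter (fun e => e ∣ p) = {1} := by
      ext e
      simp only [mem_filter, mem_singleton]
      constructor
      · rintro ⟨h1, h2⟩
        rcases (Nat.dvd_prime hp).mp h2 with h | h
        · exact h
        · have := (mem_selS.mp h1).1.2
          omega
      · rintro rfl; exact ⟨one_mem_selS hz, one_dvd _⟩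
    rw [this, sum_singleton, hlam, selLam_one hz]; norm_num
  have h2 : ∑ n ∈ N, (∑ e ∈ S with e ∣ n, lam e)^2 = ∑ e ∈ S, ∑ e' ∈ S, lam e * lam e' *
      ((((Ioc u (u+H)).filter (fun n => n ≡ v [MOD q] ∧ Nat.lcm e e' ∣ n)).card : ℕ) : ℝ) := by
    have : ∀ n ∈ N, (∑ e ∈ S with e ∣ n, lam e)^2 = ∑ e ∈ S, ∑ e' ∈ S, if Nat.lcm e e' ∣ n then lam e * lam e' else 0 := by
      intro n _
      rw [Finset.sum_filter, sq, Finset.sum_mul_sum]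
      apply Finset.sum_congr rfl; intro e _
      apply Finset.sum_congr rfl; intro e' _
      by_cases h : e ∣ n <;> by_cases h' : e' ∣ n <;> simp [h, h', Nat.lcm_dvd_iff]
    rw [Finset.sum_congr rfl this, Finset.sum_comm]
    apply Finset.sum_congr rfl; intro e _
    rw [Finset.sum_comm]
    apply Finset.sum_congr rfl; intro e' _
    rw [← Finset.sum_filter, sum_const, hN, filter_filter, nsmul_eq_mul, mul_comm]
  rw [h2] at h1
  refine h1.trans ?_
  have h3 : ∀ e ∈ S, ∀ e' ∈ S, lam e * lam e' *
      ((((Ioc u (u+H)).filter (fun n => n ≡ v [MOD q] ∧ Nat.lcm e e' ∣ n)).card : ℕ) : ℝ) ≤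
      H / q * (lam e * lam e' / (Nat.lcm e e' : ℝ)) + (z:ℝ)^2 := by
    intro e he e' he'
    have me := mem_selS.mp he
    have me' := mem_selS.mp he'
    have hb := count_two u H q (Nat.lcm e e') hq (Nat.lcm_pos me.1.1 me'.1.1)
      (Nat.Coprime.coprime_dvd_left (Nat.lcm_dvd_mul e e') (Nat.Coprime.mul_left me.2.2 me'.2.2)) v
    set c : ℝ := ((((Ioc u (u+H)).filter (fun n => n ≡ v [MOD q] ∧ Nat.lcm e e' ∣ n)).card : ℕ) : ℝ)
    have : lam e * lam e' * c = H / q * (lam e * lam e' / (Nat.lcm e e' : ℝ)) + lam e * lam e' * (c - H / (q * (Nat.lcm e e' : ℕ))) := by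
      field_simp; ring
    rw [this]
    gcongr
    have a1 : |lam e| ≤ z := (selLam_abs hz e).trans (by exact_mod_cast me.1.2)
    have a2 : |lam e'| ≤ z := (selLam_abs hz e').trans (by exact_mod_cast me'.1.2)
    calc _ ≤ |lam e * lam e' * (c - H / (q * (Nat.lcm e e' : ℕ)))| := le_abs_self _
      _ = |lam e| * |lam e'| * |c - H / (q * (Nat.lcm e e' : ℕ))| := by rw [abs_mul, abs_mul]
      _ ≤ z * z * 1 := by gcongr
      _ = _ := by ring
  refine (Finset.sum_le_sum (fun e he => Finset.sum_le_sum (h3 e he))).trans ?_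
  simp_rw [sum_add_distrib, ← mul_sum]
  rw [sel_quad hz]
  have hcard : (#S : ℝ) ≤ z := by
    have : #S ≤ #(Icc 1 z) := card_filter_le _ _
    simp at this
    exact_mod_cast this
  have : ∑ x ∈ S, ∑ i ∈ S, (z:ℝ)^2 ≤ (z:ℝ)^4 := by
    simp only [sum_const, nsmul_eq_mul]
    calc (#S:ℝ) * (#S * (z:ℝ)^2) ≤ z * (z * (z:ℝ)^2) := by gcongr
      _ = _ := by ring
  calc _ = H / q / selG q z + ∑ x ∈ S, ∑ i ∈ S, (z:ℝ)^2 := by ring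
    _ ≤ _ := by linarith

/-- the divisor sum -/
noncomputable def LL (q : ℕ) : ℝ := ∑ k ∈ q.divisors, 1 / (k:ℝ)

lemma one_le_LL {q : ℕ} (hq : 0 < q) : 1 ≤ LL q := by
  have := Finset.single_le_sum (f := fun k : ℕ => 1 / (k:ℝ)) (fun i _ => by positivity) (Nat.one_mem_divisors.mpr hq.ne')
  simpa [LL] using this

lemma selG_lower (q z : ℕ) (hq : 0 < q) (hz : 1 ≤ z) : Real.log z ≤ 2 * LL q * selG q z := by
  have h1 : Real.log z ≤ ∑ n ∈ Icc 1 z, 1 / (n:ℝ) := by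
    have := log_add_one_le_harmonic z
    rw [harmonic_eq_sum_Icc] at this
    push_cast at this
    refine le_trans (Real.log_le_log (by positivity) (by push_cast; linarith)) (this.trans (le_of_eq ?_))
    simp
  choose m s hms hm using Nat.sq_mul_squarefree
  have hpos : ∀ n ∈ Icc 1 z, 0 < m n ∧ 0 < s n ∧ m n ≤ z ∧ s n ≤ z := by
    intro n hn
    rw [mem_Icc] at hn
    have h0 := hms n
    have hm0 : 0 < m n := by
      rcases Nat.eq_zero_or_pos (m n) with h | h
      · rw [h] at h0; simp at h0; omega
      · exact h
    have hs0 : 0 < s n := by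
      rcases Nat.eq_zero_or_pos (s n) with h | h
      · rw [h] at h0; simp at h0; omega
      · exact h
    refine ⟨hm0, hs0, ?_, ?_⟩
    · have : m n ≤ n := by
        conv_rhs => rw [← h0]
        exact Nat.le_mul_of_pos_left _ (by positivity)
      omega
    · have : s n ≤ n := by
        conv_rhs => rw [← h0]
        nlinarith
      omega
  set φ : ℕ → ℕ × ℕ × ℕ := fun n => (Nat.gcd (m n) q, m n / Nat.gcd (m n) q, s n) with hφ
  have key : ∀ n ∈ Icc 1 z, φ n ∈ q.divisors ×ˢ selS q z ×ˢ Icc 1 z := by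
    intro n hn
    obtain ⟨hm0, hs0, hmz, hsz⟩ := hpos n hn
    have hd : m n / Nat.gcd (m n) q ∣ m n := Nat.div_dvd_of_dvd (Nat.gcd_dvd_left _ _)
    simp only [hφ, mem_product, Nat.mem_divisors, mem_selS, mem_Icc]
    refine ⟨⟨Nat.gcd_dvd_right _ _, hq.ne'⟩, ⟨⟨Nat.pos_of_dvd_of_pos hd hm0, (Nat.le_of_dvd hm0 hd).trans hmz⟩,
      (hm n).squarefree_of_dvd hd, ?_⟩, hs0, hsz⟩
    have hprod : Nat.gcd (m n) q * (m n / Nat.gcd (m n) q) = m n := Nat.mul_div_cancel' (Nat.gcd_dvd_left _ _)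
    have hcop : Nat.Coprime (Nat.gcd (m n) q) (m n / Nat.gcd (m n) q) :=
      Nat.coprime_of_squarefree_mul (by rw [hprod]; exact hm n)
    have h3 : Nat.gcd (m n / Nat.gcd (m n) q) q ∣ Nat.gcd (Nat.gcd (m n) q) (m n / Nat.gcd (m n) q) :=
      Nat.dvd_gcd (Nat.dvd_gcd ((Nat.gcd_dvd_left _ _).trans hd) (Nat.gcd_dvd_right _ _)) (Nat.gcd_dvd_left _ _)
    rw [hcop] at h3
    exact Nat.dvd_one.mp h3
  have hrec : ∀ n, (φ n).1 * (φ n).2.1 * (φ n).2.2 ^ 2 = n := by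
    intro n
    simp only [hφ]
    rw [Nat.mul_div_cancel' (Nat.gcd_dvd_left _ _), mul_comm, hms]
  have hinj : Set.InjOn φ (Icc 1 z : Finset ℕ) := by
    intro x _ y _ h
    rw [← hrec x, ← hrec y, h]
  set F : ℕ × ℕ × ℕ → ℝ := fun t => 1 / (t.1:ℝ) * (1 / (t.2.1:ℝ) * ((t.2.2:ℝ)^2)⁻¹) with hF
  have h2 : ∑ n ∈ Icc 1 z, 1 / (n:ℝ) = ∑ t ∈ (Icc 1 z).image φ, F t := by
    rw [Finset.sum_image hinj]
    apply Finset.sum_congr rfl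
    intro n _
    conv_lhs => rw [← hrec n]
    simp only [hF]
    push_cast
    rw [one_div, mul_inv, mul_inv]; ring
  have h3 : ∑ t ∈ (Icc 1 z).image φ, F t ≤ ∑ t ∈ q.divisors ×ˢ selS q z ×ˢ Icc 1 z, F t := by
    apply Finset.sum_le_sum_of_subset_of_nonneg
    · intro t ht
      obtain ⟨n, hn, rfl⟩ := mem_image.mp ht
      exact key n hn
    · intro t _ _; simp only [hF]; positivity
  have h4 : ∑ t ∈ q.divisors ×ˢ selS q z ×ˢ Icc 1 z, F t = LL q * ((∑ m ∈ selS q z, 1 / (m:ℝ)) * ∑ s ∈ Icc 1 z, ((s:ℝ)^2)⁻¹) := by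
    rw [Finset.sum_product, LL, Finset.sum_mul]
    apply Finset.sum_congr rfl; intro k _
    rw [Finset.sum_product, Finset.sum_mul_sum, Finset.mul_sum]
    apply Finset.sum_congr rfl; intro k _
    rw [Finset.mul_sum]
  have h5 : ∑ s ∈ Icc 1 z, ((s:ℝ)^2)⁻¹ ≤ 2 := by
    have := sum_Ioc_inv_sq_le_sub (α := ℝ) (k := 1) (n := z) one_ne_zero hz
    rw [← Finset.Ioc_insert_left hz, sum_insert (by simp)]
    have h0 : (0:ℝ) ≤ (z:ℝ)⁻¹ := by positivity
    simp only [Nat.cast_one, inv_one, one_pow] at this ⊢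
    linarith
  have h6 : ∑ m ∈ selS q z, 1 / (m:ℝ) ≤ selG q z := by
    apply Finset.sum_le_sum
    intro m hm
    have := (mem_selS.mp hm).1.1
    have h7 : 0 < m.totient := Nat.totient_pos.mpr this
    exact one_div_le_one_div_of_le (by exact_mod_cast h7) (by exact_mod_cast Nat.totient_le m)
  have hL := one_le_LL hq
  have hG := selG_pos (q := q) hz
  calc Real.log z ≤ _ := h1
    _ ≤ _ := h2.le.trans (h3.trans h4.le)
    _ ≤ LL q * (selG q z * 2) := by gcongr
    _ = _ := by ring

/-- Brun–Titchmarsh type bound -/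
theorem BT (q z u H v : ℕ) (hq : 0 < q) (hz : 2 ≤ z) :
    ((((Ioc u (u+H)).filter (fun p => p.Prime ∧ z < p ∧ p ≡ v [MOD q])).card : ℕ) : ℝ) ≤
      2 * LL q * H / (q * Real.log z) + (z:ℝ)^4 := by
  refine (sel_sieve q z u H v hq (by omega)).trans ?_
  gcongr ?_ + _
  have hl : 0 < Real.log z := Real.log_pos (by exact_mod_cast hz)
  have hG := selG_pos (q := q) (z := z) (by omega)
  have h := selG_lower q z hq (by omega)
  rw [div_div, div_le_div_iff₀ (by positivity) (by positivity)]
  calc (H:ℝ) * (q * Real.log z) ≤ H * (q * (2 * LL q * selG q z)) := by gcongr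
    _ = _ := by ring

end

section
open Filter Topology Finset ArithmeticFunction

lemma LL_le_exp {q : ℕ} (hq : 0 < q) : LL q ≤ Real.exp (2 * ∑ p ∈ q.primeFactors, 1 / (p:ℝ)) := by
  have hq0 : (q:ℝ) ≠ 0 := by positivity
  have h1 : LL q = (∑ d ∈ q.divisors, (d:ℝ)) / q := by
    have h := Nat.sum_div_divisors q (fun d => (d:ℝ))
    rw [← h, Finset.sum_div, LL]
    apply Finset.sum_congr rfl
    intro d hd
    have hd' := Nat.dvd_of_mem_divisors hd
    rw [Nat.cast_div hd' (by have := Nat.pos_of_mem_divisors hd; positivity)]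
    have := Nat.pos_of_mem_divisors hd
    field_simp
  have h2 : (∑ d ∈ q.divisors, (d:ℝ)) = ∏ p ∈ q.primeFactors, ∑ k ∈ Finset.range (q.factorization p + 1), (p:ℝ) ^ k := by
    have := congrArg (Nat.cast : ℕ → ℝ) (Nat.sum_divisors hq.ne')
    push_cast at this
    exact this
  have h3 : (q:ℝ) = ∏ p ∈ q.primeFactors, (p:ℝ)^(q.factorization p) := by
    conv_lhs => rw [← Nat.prod_factorization_pow_eq_self hq.ne']
    rw [Finsupp.prod, Nat.support_factorization]; push_cast; rfl
  rw [h1, h2]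
  refine le_of_eq_of_le (congrArg _ h3) ?_
  rw [← Finset.prod_div_distrib, Finset.mul_sum, Real.exp_sum]
  apply Finset.prod_le_prod
  · intro p _; positivity
  · intro p hp
    have hp' := (Nat.prime_of_mem_primeFactors hp).two_le
    have hp2 : (2:ℝ) ≤ p := by exact_mod_cast hp'
    refine le_trans ?_ (Real.add_one_le_exp _)
    set v := q.factorization p
    have hg := geom_sum_mul (p:ℝ) (v+1)
    rw [div_le_iff₀ (by positivity)]
    set s := ∑ k ∈ Finset.range (v+1), (p:ℝ)^k
    have hs : s ≤ (p:ℝ)^(v+1) / (p-1) := by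
      rw [le_div_iff₀ (by linarith)]; linarith
    refine hs.trans ?_
    rw [div_le_iff₀ (by linarith), pow_succ]
    have : (p:ℝ) ≤ (2 * (1 / p) + 1) * (p - 1) := by
      have : (2 * (1 / p) + 1) * (p - 1) = (p:ℝ) + (p - 2)/p := by field_simp; ring
      rw [this]
      have : 0 ≤ ((p:ℝ) - 2) / p := div_nonneg (by linarith) (by linarith)
      linarith
    have hpp : (0:ℝ) ≤ (p:ℝ)^v := by positivity
    nlinarith

lemma card_primeFactors_le {q : ℕ} (hq : 0 < q) : (#q.primeFactors : ℝ) ≤ 2 * Real.log q := by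
  have h1 : 2 ^ #q.primeFactors ≤ ∏ p ∈ q.primeFactors, p :=
    Finset.pow_card_le_prod _ _ _ (fun p hp => (Nat.prime_of_mem_primeFactors hp).two_le)
  have h2 : 2 ^ #q.primeFactors ≤ q := h1.trans (Nat.le_of_dvd hq (Nat.prod_primeFactors_dvd q))
  have h3 : (2:ℝ) ^ #q.primeFactors ≤ q := by exact_mod_cast h2
  have h4 := Real.log_le_log (by positivity) h3
  rw [Real.log_pow] at h4
  have := Real.log_two_gt_d9
  have h0 : (0:ℝ) ≤ #q.primeFactors := by positivity
  nlinarith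

theorem LL_bound : ∃ C : ℝ, 0 < C ∧ ∀ q Y : ℕ, 0 < q → 0 < Y → Real.log q ≤ Y → LL q ≤ C * (Y:ℝ) ^ (1/16 : ℝ) := by
  set T : ℕ := ⌈Real.exp 32⌉₊ with hT
  refine ⟨Real.exp (2 * (T + 6/32 + 2)), Real.exp_pos _, ?_⟩
  intro q Y hq hY hqY
  refine (LL_le_exp hq).trans ?_
  have hY' : (0:ℝ) < Y := by positivity
  rw [Real.rpow_def_of_pos hY', ← Real.exp_add]
  apply Real.exp_le_exp.mpr
  have hsplit : ∑ p ∈ q.primeFactors, 1 / (p:ℝ) ≤ ∑ p ∈ q.primeFactors, ((if p ∈ Ioc 0 T then 1 else 0) + (if p ∈ Ioc 0 Y then Λ p / p / 32 else 0) + 1 / Y) := by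
    apply Finset.sum_le_sum
    intro p hp
    have hpr := Nat.prime_of_mem_primeFactors hp
    have hp0 := hpr.pos
    have hp1 : (1:ℝ) ≤ p := by exact_mod_cast hp0
    have hYi : (0:ℝ) ≤ 1 / Y := by positivity
    have hLi : (0:ℝ) ≤ Λ p / p / 32 := by
      have := vonMangoldt_nonneg (n := p); positivity
    have hb : (0:ℝ) ≤ (if p ∈ Ioc 0 Y then Λ p / p / 32 else 0) := by split_ifs <;> simp [hLi]
    have ha : (0:ℝ) ≤ (if p ∈ Ioc 0 T then 1 else 0) := by split_ifs <;> simp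
    by_cases h1 : p ∈ Ioc 0 T
    · rw [if_pos h1]
      have : 1 / (p:ℝ) ≤ 1 := by rw [div_le_one (by linarith)]; exact hp1
      linarith
    · by_cases h2 : p ∈ Ioc 0 Y
      · rw [if_pos h2]
        have hTp : T < p := by simp at h1; exact h1 hp0
        have : Real.exp 32 ≤ p := (Nat.le_ceil _).trans (by exact_mod_cast hTp.le)
        have hlog : 32 ≤ Real.log p := by rwa [Real.le_log_iff_exp_le (by linarith)]
        rw [vonMangoldt_apply_prime hpr]
        have : 1 / (p:ℝ) ≤ Real.log p / p / 32 := by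
          rw [div_div, div_le_div_iff₀ (by positivity) (by positivity)]
          nlinarith
        linarith
      · have hTp : Y < p := by simp at h2; exact h2 hp0
        have : 1 / (p:ℝ) ≤ 1 / Y := one_div_le_one_div_of_le hY' (by exact_mod_cast hTp.le)
        linarith
  rw [sum_add_distrib, sum_add_distrib] at hsplit
  have b1 : ∑ p ∈ q.primeFactors, (if p ∈ Ioc 0 T then (1:ℝ) else 0) ≤ T := by
    rw [← Finset.sum_filter, sum_const, nsmul_eq_mul, mul_one]
    have : #(q.primeFactors.filter (fun p => p ∈ Ioc 0 T)) ≤ #(Ioc 0 T) := card_le_card (fun p hp => (mem_filter.mp hp).2)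
    simp only [Nat.card_Ioc] at this
    exact_mod_cast this
  have b2 : ∑ p ∈ q.primeFactors, (if p ∈ Ioc 0 Y then Λ p / p / 32 else 0) ≤ (Real.log Y + 6)/32 := by
    rw [← Finset.sum_filter]
    calc _ ≤ ∑ p ∈ Ioc 0 Y, Λ p / p / 32 := by
          apply Finset.sum_le_sum_of_subset_of_nonneg
          · intro p hp; exact (mem_filter.mp hp).2
          · intro p _ _; have := vonMangoldt_nonneg (n := p); positivity
      _ = (∑ p ∈ Ioc 0 Y, Λ p / p) / 32 := by rw [Finset.sum_div]
      _ ≤ _ := by have := sum_Lam_div Y hY; gcongr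
  have b3 : ∑ p ∈ q.primeFactors, 1 / (Y:ℝ) ≤ 2 := by
    rw [sum_const, nsmul_eq_mul, mul_one_div, div_le_iff₀ hY']
    have := card_primeFactors_le hq
    linarith
  linarith

lemma LL_dvd {d q : ℕ} (hq : 0 < q) (h : d ∣ q) : LL d ≤ LL q :=
  Finset.sum_le_sum_of_subset_of_nonneg (Nat.divisors_subset_of_dvd hq.ne' h) (fun i _ _ => by positivity)

end

section
open Filter Topology Finset

noncomputable def SS (C : Finset ℕ) (θ : ℝ) : ℂ := ∑ p ∈ C, ee (θ * p)

lemma SS_le (C : Finset ℕ) (θ : ℝ) : ‖SS C θ‖ ≤ #C := by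
  refine (norm_sum_le _ _).trans ?_
  simp [ee_norm]

lemma sum_ee_mod (d : ℕ) (hd : 0 < d) (a : ℤ) :
    ∑ r ∈ range d, ee ((r:ℝ) / d * a) = if (d:ℤ) ∣ a then (d:ℂ) else 0 := by
  have hd' : (d:ℝ) ≠ 0 := by positivity
  have h1 : ∀ r : ℕ, ee ((r:ℝ) / d * a) = ee ((a:ℝ)/d) ^ r := by
    intro r; rw [← ee_mul_nat]; congr 1; ring
  simp_rw [h1]
  split_ifs with h
  · obtain ⟨k, rfl⟩ := h
    have : ee (((d * k : ℤ) : ℝ) / d) = 1 := by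
      rw [ee_eq_one]; exact ⟨k, by push_cast; field_simp⟩
    rw [this]; simp
  · have hne : ee ((a:ℝ)/d) ≠ 1 := by
      rw [Ne, ee_eq_one]
      rintro ⟨n, hn⟩
      apply h
      refine ⟨n, ?_⟩
      have : (a:ℝ) = d * n := by field_simp at hn; linarith
      exact_mod_cast this
    have h2 : ee ((a:ℝ)/d) ^ d = 1 := by
      rw [← ee_mul_nat]
      rw [show (d:ℝ) * ((a:ℝ)/d) = ((a:ℤ):ℝ) by field_simp]
      exact ee_int a
    rw [geom_sum_eq hne, h2]; simp

lemma ee_conj (a : ℝ) : (starRingEnd ℂ) (ee a) = ee (-a) := by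
  have h : ee a * ee (-a) = 1 := by rw [← ee_add, add_neg_cancel, ee_zero]
  have h2 : ee a * (starRingEnd ℂ) (ee a) = 1 := by
    rw [Complex.mul_conj, Complex.normSq_eq_norm_sq, ee_norm]; simp
  have h0 : ee a ≠ 0 := by
    intro h0; rw [h0] at h; simp at h
  exact mul_left_cancel₀ h0 (h2.trans h.symm)

lemma parseval (C : Finset ℕ) (d : ℕ) (hd : 0 < d) :
    ∑ r ∈ range d, ‖SS C ((r:ℝ)/d)‖^2 = d * ∑ p ∈ C, (#(C.filter (fun p' => p' ≡ p [MOD d])) : ℝ) := by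
  have h : ((∑ r ∈ range d, ‖SS C ((r:ℝ)/d)‖^2 : ℝ) : ℂ) = ((d * ∑ p ∈ C, (#(C.filter (fun p' => p' ≡ p [MOD d])) : ℝ) : ℝ) : ℂ) := by
    push_cast
    have h1 : ∀ r ∈ range d, ((‖SS C ((r:ℝ)/d)‖ : ℂ))^2 = ∑ p ∈ C, ∑ p' ∈ C, ee ((r:ℝ)/d * ((p':ℤ) - (p:ℤ) : ℤ)) := by
      intro r _
      rw [← Complex.mul_conj', SS, map_sum, Finset.sum_mul_sum, Finset.sum_comm]
      apply Finset.sum_congr rfl; intro p _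
      apply Finset.sum_congr rfl; intro p' _
      rw [ee_conj, ← ee_add]; congr 1; push_cast; ring
    rw [Finset.sum_congr rfl h1, Finset.sum_comm, Finset.mul_sum]
    apply Finset.sum_congr rfl; intro p _
    rw [Finset.sum_comm]
    simp_rw [sum_ee_mod d hd]
    rw [← Finset.sum_filter, sum_const, nsmul_eq_mul, mul_comm]
    congr 3
    apply Finset.filter_congr
    intro p' _
    rw [← Nat.modEq_iff_dvd]
    exact ⟨Nat.ModEq.symm, Nat.ModEq.symm⟩
  exact_mod_cast h

/-- regular sets -/
def Reg (M : ℝ) (q : ℕ) (C : Finset ℕ) : Prop :=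
  ∀ d, d ∣ q → ∀ b : ℕ, (#(C.filter (fun p => p ≡ b [MOD d])) : ℝ) ≤ M * LL d * #C / d

lemma Reg.parseval {M : ℝ} {q : ℕ} {C : Finset ℕ} (h : Reg M q C) (hq : 0 < q) {d : ℕ} (hd : d ∣ q) :
    ∑ r ∈ range d, ‖SS C ((r:ℝ)/d)‖^2 ≤ M * LL d * (#C : ℝ)^2 := by
  have hd0 : 0 < d := Nat.pos_of_dvd_of_pos hd hq
  rw [_root_.parseval C d hd0]
  calc _ ≤ (d:ℝ) * ∑ p ∈ C, (M * LL d * #C / d) := by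
        gcongr with p _
        exact h d hd p
    _ = _ := by rw [sum_const, nsmul_eq_mul]; field_simp

lemma SS_mult (C : Finset ℕ) (θ η : ℝ) (h : (1 - η) * #C ≤ ‖SS C θ‖) (k : ℕ) :
    (1 - k^2 * η) * #C ≤ ‖SS C (k * θ)‖ := by
  obtain ⟨u, hu, hu2⟩ : ∃ u : ℂ, ‖u‖ = 1 ∧ u * SS C θ = ‖SS C θ‖ := by
    by_cases h0 : SS C θ = 0
    · exact ⟨1, by simp, by simp [h0]⟩
    · refine ⟨(starRingEnd ℂ) (SS C θ) / ‖SS C θ‖, ?_, ?_⟩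
      · simp [h0]
      · rw [div_mul_eq_mul_div, Complex.conj_mul']
        have : (‖SS C θ‖ : ℂ) ≠ 0 := by simpa using h0
        field_simp
  have hre : ∀ w : ℂ, ‖w‖ = 1 → ‖1 - w‖^2 = 2 * (1 - w.re) := by
    intro w hw
    rw [← Complex.normSq_eq_norm_sq, Complex.normSq_sub, Complex.normSq_eq_norm_sq w, hw]
    simp; ring
  have hw : ∀ p : ℕ, ‖u * ee (θ * p)‖ = 1 := by intro p; rw [norm_mul, hu, ee_norm]; simp
  have h1 : ∑ p ∈ C, ‖1 - u * ee (θ * p)‖^2 ≤ 2 * η * #C := by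
    rw [Finset.sum_congr rfl (fun p _ => hre _ (hw p)), ← Finset.mul_sum, Finset.sum_sub_distrib, ← Complex.re_sum, ← Finset.mul_sum]
    change 2 * (_ - (u * SS C θ).re) ≤ _
    rw [hu2]; simp; linarith
  have h2 : ∑ p ∈ C, ‖1 - (u * ee (θ * p))^k‖^2 ≤ k^2 * (2 * η * #C) := by
    calc _ ≤ ∑ p ∈ C, (k:ℝ)^2 * ‖1 - u * ee (θ * p)‖^2 := by
          apply Finset.sum_le_sum; intro p _
          rw [← mul_pow]
          gcongr
          exact norm_one_sub_pow _ (hw p) k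
      _ = k^2 * ∑ p ∈ C, ‖1 - u * ee (θ * p)‖^2 := by rw [Finset.mul_sum]
      _ ≤ _ := by gcongr
  have h3 : ∑ p ∈ C, ‖1 - (u * ee (θ * p))^k‖^2 = 2 * (#C - (u^k * SS C (k*θ)).re) := by
    rw [Finset.sum_congr rfl (fun p _ => hre _ (by rw [norm_pow, hw p, one_pow])), ← Finset.mul_sum, Finset.sum_sub_distrib, ← Complex.re_sum]
    congr 2
    · simp
    · rw [SS, Finset.mul_sum]
      congr 1
      apply Finset.sum_congr rfl; intro p _
      rw [mul_pow, ← ee_mul_nat]; congr 2; ring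
  have h4 : (u^k * SS C (k*θ)).re ≤ ‖SS C (k*θ)‖ := by
    refine (Complex.re_le_norm _).trans ?_
    rw [norm_mul, norm_pow, hu]; simp
  linarith

lemma SS_mod (C : Finset ℕ) (d : ℕ) (hd : 0 < d) (k : ℕ) : SS C ((k:ℝ)/d) = SS C (((k % d : ℕ) : ℝ)/d) := by
  unfold SS
  apply Finset.sum_congr rfl; intro p _
  have h : (k:ℝ) = (k % d : ℕ) + d * (k / d : ℕ) := by exact_mod_cast (Nat.mod_add_div k d).symm
  have hd' : (d:ℝ) ≠ 0 := by positivity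
  have : (k:ℝ)/d * p = ((k % d : ℕ):ℝ)/d * p + (((k/d * p : ℕ) : ℤ) : ℝ) := by
    conv_lhs => rw [h]
    rw [Int.cast_natCast, Nat.cast_mul]; field_simp
  rw [this, ee_add, ee_int, mul_one]

lemma Reg.sup {M : ℝ} {q : ℕ} {C : Finset ℕ} (h : Reg M q C) (hM : 0 < M) (hq : 0 < q) {d r : ℕ} (hd : d ∣ q)
    (hr : r.Coprime d) (hdM : 4 * M * LL d + 1 ≤ d) :
    ‖SS C ((r:ℝ)/d)‖ ≤ (1 - 1 / (2 * (4 * M * LL q + 1)^2)) * #C := by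
  have hd0 : 0 < d := Nat.pos_of_dvd_of_pos hd hq
  have hL := one_le_LL hd0
  have hLq := LL_dvd hq hd
  by_contra hcon
  rw [not_le] at hcon
  set η : ℝ := 1 / (2 * (4 * M * LL q + 1)^2)
  set k0 : ℕ := ⌊4 * M * LL d⌋₊ + 1 with hk0
  have hk0d : k0 ≤ d := by
    have : ((⌊4 * M * LL d⌋₊ : ℕ) : ℝ) ≤ 4 * M * LL d := Nat.floor_le (by positivity)
    have : ((k0 : ℕ) : ℝ) ≤ d := by rw [hk0]; push_cast; linarith
    exact_mod_cast this
  have hkl : 4 * M * LL d < k0 := by rw [hk0]; push_cast; exact Nat.lt_floor_add_one _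
  have hku : (k0:ℝ) ≤ 4 * M * LL q + 1 := by
    have : ((⌊4 * M * LL d⌋₊ : ℕ) : ℝ) ≤ 4 * M * LL d := Nat.floor_le (by positivity)
    rw [hk0]; push_cast
    nlinarith
  have hC : 0 < #C := by
    by_contra h0
    have : C = ∅ := by simpa using h0
    rw [this] at hcon; simp [SS] at hcon
  have hC' : (0:ℝ) < #C := by exact_mod_cast hC
  have h1 : ∀ k ∈ range k0, (#C:ℝ)/2 ≤ ‖SS C (((k * r % d : ℕ):ℝ)/d)‖ := by
    intro k hk
    rw [mem_range] at hk
    rw [← SS_mod C d hd0]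
    have := SS_mult C ((r:ℝ)/d) η hcon.le k
    have e : (k:ℝ) * ((r:ℝ)/d) = ((k * r : ℕ):ℝ)/d := by push_cast; ring
    rw [e] at this
    refine le_trans ?_ this
    have hk2 : (k:ℝ)^2 ≤ (4 * M * LL q + 1)^2 := by
      have : (k:ℝ) ≤ k0 := by exact_mod_cast hk.le
      gcongr; linarith
    have : (k:ℝ)^2 * η ≤ 1/2 := by
      have : 0 < 4 * M * LL q + 1 := by nlinarith
      simp only [η]
      rw [mul_one_div, div_le_iff₀ (by positivity)]; linarith
    nlinarith
  have hinj : Set.InjOn (fun k => k * r % d) (range k0 : Finset ℕ) := by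
    intro a ha b hb hab
    simp only [coe_range, Set.mem_Iio] at ha hb
    have : a * r ≡ b * r [MOD d] := hab
    have := Nat.ModEq.cancel_right_of_coprime (by rw [Nat.gcd_comm]; exact hr) this
    exact Nat.ModEq.eq_of_lt_of_lt this (by omega) (by omega)
  have h2 : ∑ k ∈ range k0, ‖SS C (((k * r % d : ℕ):ℝ)/d)‖^2 ≤ ∑ r ∈ range d, ‖SS C ((r:ℝ)/d)‖^2 := by
    rw [← Finset.sum_image (f := fun r : ℕ => ‖SS C ((r:ℝ)/d)‖^2) hinj]
    apply Finset.sum_le_sum_of_subset_of_nonneg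
    · intro s hs
      obtain ⟨k, _, rfl⟩ := mem_image.mp hs
      exact mem_range.mpr (Nat.mod_lt _ hd0)
    · intro i _ _; positivity
  have h3 : (k0:ℝ) * ((#C:ℝ)/2)^2 ≤ ∑ k ∈ range k0, ‖SS C (((k * r % d : ℕ):ℝ)/d)‖^2 := by
    have : ∑ k ∈ range k0, ((#C:ℝ)/2)^2 = (k0:ℝ) * ((#C:ℝ)/2)^2 := by simp
    rw [← this]
    apply Finset.sum_le_sum
    intro k hk
    have := h1 k hk
    gcongr
  have h4 := h.parseval hq hd
  have h5 : (k0:ℝ) * ((#C:ℝ)/2)^2 ≤ M * LL d * (#C : ℝ)^2 := by linarith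
  have h6 : 0 < (#C:ℝ)^2 := by positivity
  nlinarith

lemma sq_mul_le_half (a b : ℝ) : a * b ≤ a^2/2 + b^2/2 := by nlinarith [sq_nonneg (a-b)]

theorem fourier_key {M : ℝ} (hM : 0 < M) {d0 : ℕ} (hd0 : ∀ d : ℕ, d0 ≤ d → 4 * M * LL d + 1 ≤ d)
    {q J : ℕ} (hq : 0 < q) (C : Fin (J+2) → Finset ℕ) (hC : ∀ i, Reg M q (C i)) :
    ∑ r ∈ (range q).filter (fun r => d0 ≤ q / Nat.gcd r q), ∏ i, ‖SS (C i) ((r:ℝ)/q)‖ ≤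
      M * LL q * (1 - 1 / (2 * (4 * M * LL q + 1)^2))^J * ∏ i, (#(C i) : ℝ) := by
  set δ : ℝ := 1 - 1 / (2 * (4 * M * LL q + 1)^2) with hδ
  have hL := one_le_LL hq
  have hδ0 : 0 ≤ δ := by
    have h1 : 1 ≤ 4 * M * LL q + 1 := by nlinarith
    have : 1 / (2 * (4 * M * LL q + 1)^2) ≤ 1 := by
      rw [div_le_one (by positivity)]; nlinarith
    linarith
  have hsup : ∀ i, ∀ r ∈ (range q).filter (fun r => d0 ≤ q / Nat.gcd r q), ‖SS (C i) ((r:ℝ)/q)‖ ≤ δ * #(C i) := by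
    intro i r hr
    rw [mem_filter] at hr
    have hg : 0 < Nat.gcd r q := Nat.gcd_pos_of_pos_right _ hq
    have e : (r:ℝ)/q = ((r / Nat.gcd r q : ℕ):ℝ) / ((q / Nat.gcd r q : ℕ):ℝ) := by
      rw [Nat.cast_div (Nat.gcd_dvd_left _ _) (by positivity), Nat.cast_div (Nat.gcd_dvd_right _ _) (by positivity)]
      field_simp
    rw [e]
    exact (hC i).sup hM hq (Nat.div_dvd_of_dvd (Nat.gcd_dvd_right _ _)) (Nat.coprime_div_gcd_div_gcd hg) (hd0 _ hr.2)
  by_cases hne : ∀ i, (C i).Nonempty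
  swap
  · simp only [not_forall, not_nonempty_iff_eq_empty] at hne
    obtain ⟨i, hi⟩ := hne
    have h1 : ∏ i, (#(C i) : ℝ) = 0 := Finset.prod_eq_zero (mem_univ i) (by simp [hi])
    rw [h1, mul_zero]
    apply le_of_eq
    apply Finset.sum_eq_zero; intro r _
    exact Finset.prod_eq_zero (mem_univ i) (by simp [hi, SS])
  have hpos : ∀ i, (0:ℝ) < #(C i) := fun i => by exact_mod_cast (hne i).card_pos
  have hterm : ∀ r ∈ (range q).filter (fun r => d0 ≤ q / Nat.gcd r q), ∏ i, ‖SS (C i) ((r:ℝ)/q)‖ ≤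
      ((‖SS (C 0) ((r:ℝ)/q)‖^2 / (#(C 0):ℝ)^2 + ‖SS (C (Fin.succ 0)) ((r:ℝ)/q)‖^2 / (#(C (Fin.succ 0)):ℝ)^2)/2) * (δ^J * ∏ i, (#(C i) : ℝ)) := by
    intro r hr
    rw [Fin.prod_univ_succ, Fin.prod_univ_succ, Fin.prod_univ_succ (n := J+1), Fin.prod_univ_succ (n := J)]
    have h1 : ∏ i : Fin J, ‖SS (C i.succ.succ) ((r:ℝ)/q)‖ ≤ δ^J * ∏ i : Fin J, (#(C i.succ.succ):ℝ) := by
      calc _ ≤ ∏ i : Fin J, (δ * #(C i.succ.succ)) := Finset.prod_le_prod (fun i _ => norm_nonneg _) (fun i _ => hsup _ r hr)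
        _ = _ := by rw [Finset.prod_mul_distrib]; simp
    set P := ∏ i : Fin J, (#(C i.succ.succ):ℝ)
    have hP : 0 ≤ P := Finset.prod_nonneg (fun i _ => by positivity)
    have p0 := hpos 0
    have p1 := hpos (Fin.succ 0)
    set a := ‖SS (C 0) ((r:ℝ)/q)‖
    set b := ‖SS (C (Fin.succ 0)) ((r:ℝ)/q)‖
    set A0 := (#(C 0):ℝ)
    set B0 := (#(C (Fin.succ 0)):ℝ)
    have ha : 0 ≤ a := norm_nonneg _
    have hb : 0 ≤ b := norm_nonneg _
    have h2 := sq_mul_le_half (a/A0) (b/B0)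
    calc a * (b * ∏ i : Fin J, ‖SS (C i.succ.succ) ((r:ℝ)/q)‖) ≤ a * (b * (δ^J * P)) := by gcongr
      _ = (a/A0 * (b/B0)) * (δ^J * (A0 * (B0 * P))) := by field_simp
      _ ≤ ((a/A0)^2/2 + (b/B0)^2/2) * (δ^J * (A0 * (B0 * P))) := by gcongr
      _ = _ := by rw [div_pow, div_pow]; ring
  refine (Finset.sum_le_sum hterm).trans ?_
  rw [← Finset.sum_mul, ← Finset.sum_div, Finset.sum_add_distrib, ← Finset.sum_div, ← Finset.sum_div]
  have hpar : ∀ i, (∑ r ∈ (range q).filter (fun r => d0 ≤ q / Nat.gcd r q), ‖SS (C i) ((r:ℝ)/q)‖^2) / (#(C i):ℝ)^2 ≤ M * LL q := by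
    intro i
    have := hpos i
    rw [div_le_iff₀ (by positivity)]
    refine le_trans ?_ ((hC i).parseval hq dvd_rfl)
    exact Finset.sum_le_sum_of_subset_of_nonneg (filter_subset _ _) (fun _ _ _ => by positivity)
  have hPP : 0 ≤ δ^J * ∏ i, (#(C i) : ℝ) := mul_nonneg (pow_nonneg hδ0 _) (Finset.prod_nonneg (fun i _ => by positivity))
  have a1 := hpar 0
  have a2 := hpar (Fin.succ 0)
  calc _ ≤ (M * LL q) * (δ^J * ∏ i, (#(C i) : ℝ)) := by gcongr; linarith
    _ = _ := by ring

end

section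
open Filter Topology Finset

section ram
variable {J : ℕ} (P : Fin J → Finset ℕ)

def omg (i : Fin J) (m : ℕ) : ℕ := #((P i).filter (fun p => p ∣ m))
noncomputable def wt (m : ℕ) : ℝ := ∏ i, 1 / ((omg P i m : ℝ) + 1)

lemma wt_nonneg (m : ℕ) : 0 ≤ wt P m := Finset.prod_nonneg (fun i _ => by positivity)

variable {P}

lemma tprod_dvd_iff (hprime : ∀ i, ∀ p ∈ P i, p.Prime) (hdisj : ∀ i j, i ≠ j → Disjoint (P i) (P j))
    {t : Fin J → ℕ} (ht : t ∈ Fintype.piFinset P) (n : ℕ) : ∏ i, t i ∣ n ↔ ∀ i, t i ∣ n := by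
  rw [Fintype.mem_piFinset] at ht
  constructor
  · intro h i
    exact (Finset.dvd_prod_of_mem t (mem_univ i)).trans h
  · intro h
    apply Finset.prod_dvd_of_isRelPrime
    · intro i _ j _ hij
      have hne : t i ≠ t j := by
        intro he
        exact Finset.disjoint_left.mp (hdisj i j hij) (ht i) (he ▸ ht j)
      exact Nat.coprime_iff_isRelPrime.mp ((Nat.coprime_primes (hprime i _ (ht i)) (hprime j _ (ht j))).mpr hne)
    · intro i _; exact h i

lemma omg_le (hprime : ∀ i, ∀ p ∈ P i, p.Prime) (hdisj : ∀ i j, i ≠ j → Disjoint (P i) (P j))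
    {t : Fin J → ℕ} (ht : t ∈ Fintype.piFinset P) (m : ℕ) (i : Fin J) :
    omg P i (m * ∏ i, t i) ≤ omg P i m + 1 := by
  rw [Fintype.mem_piFinset] at ht
  have : (P i).filter (fun p => p ∣ m * ∏ i, t i) ⊆ insert (t i) ((P i).filter (fun p => p ∣ m)) := by
    intro p hp
    rw [mem_filter] at hp
    have hpp := hprime i p hp.1
    rw [mem_insert, mem_filter]
    rcases (hpp.dvd_mul).mp hp.2 with h | h
    · exact Or.inr ⟨hp.1, h⟩
    · obtain ⟨j, _, hj⟩ := (Prime.dvd_finset_prod_iff hpp.prime _).mp h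
      have he := (Nat.prime_dvd_prime_iff_eq hpp (hprime j _ (ht j))).mp hj
      by_cases hij : i = j
      · subst hij; exact Or.inl he
      · exact absurd (he ▸ ht j) (Finset.disjoint_left.mp (hdisj i j hij) hp.1)
  exact (card_le_card this).trans (card_insert_le _ _)

lemma omg_eq (hprime : ∀ i, ∀ p ∈ P i, p.Prime) (hdisj : ∀ i j, i ≠ j → Disjoint (P i) (P j))
    {t : Fin J → ℕ} (ht : t ∈ Fintype.piFinset P) (m : ℕ) (i : Fin J)
    (hsq : ∀ i, ∀ p ∈ P i, ¬ p^2 ∣ m * ∏ i, t i) :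
    omg P i (m * ∏ i, t i) = omg P i m + 1 := by
  apply le_antisymm (omg_le hprime hdisj ht m i)
  rw [Fintype.mem_piFinset] at ht
  have hti : t i ∣ ∏ i, t i := Finset.dvd_prod_of_mem t (mem_univ i)
  have hnot : t i ∉ (P i).filter (fun p => p ∣ m) := by
    intro h
    rw [mem_filter] at h
    apply hsq i _ (ht i)
    rw [sq]
    exact Nat.mul_dvd_mul h.2 hti
  rw [omg, ← card_insert_of_notMem hnot]
  apply card_le_card
  intro p hp
  rw [mem_insert, mem_filter] at hp
  rw [mem_filter]
  rcases hp with rfl | h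
  · exact ⟨ht i, hti.mul_left m⟩
  · exact ⟨h.1, h.2.mul_right _⟩

variable (P)
noncomputable def WW (key : ℕ → ℕ) (ρ : ℝ) (N n : ℕ) : ℝ :=
  ∑ t ∈ Fintype.piFinset P with (∏ i, t i ∣ n ∧ ((n / ∏ i, t i : ℕ) : ℝ) * (∏ i, (key (t i) : ℝ)) * ρ ≤ N), wt P (n / ∏ i, t i)

def badP (ρ : ℝ) (N n : ℕ) : Prop :=
  (N:ℝ) < n * ρ ∨ (∃ i, ∀ p ∈ P i, ¬ p ∣ n) ∨ (∃ i, ∃ p ∈ P i, p^2 ∣ n)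

variable {P}

lemma WW_nonneg (key : ℕ → ℕ) (ρ : ℝ) (N n : ℕ) : 0 ≤ WW P key ρ N n :=
  Finset.sum_nonneg (fun t _ => wt_nonneg P _)

lemma card_dvd (hprime : ∀ i, ∀ p ∈ P i, p.Prime) (hdisj : ∀ i j, i ≠ j → Disjoint (P i) (P j)) (n : ℕ) :
    #((Fintype.piFinset P).filter (fun t => ∏ i, t i ∣ n)) = ∏ i, omg P i n := by
  have : (Fintype.piFinset P).filter (fun t => ∏ i, t i ∣ n) = Fintype.piFinset (fun i => (P i).filter (fun p => p ∣ n)) := by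
    ext t
    simp only [mem_filter, Fintype.mem_piFinset]
    constructor
    · rintro ⟨h1, h2⟩ i
      exact ⟨h1 i, (tprod_dvd_iff hprime hdisj (Fintype.mem_piFinset.mpr h1) n).mp h2 i⟩
    · intro h
      exact ⟨fun i => (h i).1, (tprod_dvd_iff hprime hdisj (Fintype.mem_piFinset.mpr (fun i => (h i).1)) n).mpr (fun i => (h i).2)⟩
  rw [this, Fintype.card_piFinset]; rfl

lemma WW_le_one (hprime : ∀ i, ∀ p ∈ P i, p.Prime) (hdisj : ∀ i j, i ≠ j → Disjoint (P i) (P j))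
    (key : ℕ → ℕ) (ρ : ℝ) (N n : ℕ) : WW P key ρ N n ≤ 1 := by
  have h1 : WW P key ρ N n ≤ ∑ t ∈ Fintype.piFinset P with ∏ i, t i ∣ n, ∏ i, 1 / (omg P i n : ℝ) := by
    unfold WW
    refine le_trans (Finset.sum_le_sum (g := fun _ => ∏ i, 1 / (omg P i n : ℝ)) ?_)
      (Finset.sum_le_sum_of_subset_of_nonneg ?_ ?_)
    · intro t ht
      rw [mem_filter] at ht
      apply Finset.prod_le_prod
      · intro i _; positivity
      · intro i _
        have hti := Fintype.mem_piFinset.mp ht.1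
        have h0 : 0 < omg P i n := by
          apply Finset.card_pos.mpr
          exact ⟨t i, mem_filter.mpr ⟨hti i, (tprod_dvd_iff hprime hdisj ht.1 n).mp ht.2.1 i⟩⟩
        have := omg_le hprime hdisj ht.1 (n / ∏ i, t i) i
        rw [Nat.div_mul_cancel ht.2.1] at this
        exact one_div_le_one_div_of_le (by exact_mod_cast h0) (by exact_mod_cast this)
    · intro t ht
      rw [mem_filter] at ht ⊢
      exact ⟨ht.1, ht.2.1⟩
    · intro t _ _
      exact Finset.prod_nonneg (fun i _ => by positivity)
  refine h1.trans ?_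
  rw [sum_const, nsmul_eq_mul, card_dvd hprime hdisj]
  push_cast
  rw [← Finset.prod_mul_distrib]
  apply Finset.prod_le_one
  · intro i _; positivity
  · intro i _
    rw [mul_one_div]; exact div_self_le_one _

lemma WW_eq_one (hprime : ∀ i, ∀ p ∈ P i, p.Prime) (hdisj : ∀ i j, i ≠ j → Disjoint (P i) (P j))
    (key : ℕ → ℕ) (hkey : ∀ i, ∀ p ∈ P i, key p ≤ p) (ρ : ℝ) (hρ : 0 ≤ ρ) (N n : ℕ) (h : ¬ badP P ρ N n) : WW P key ρ N n = 1 := by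
  simp only [badP, not_or, not_exists, not_lt, not_forall, not_and, not_not] at h
  obtain ⟨hn, h2, h3⟩ := h
  have hf : (Fintype.piFinset P).filter (fun t => ∏ i, t i ∣ n ∧ ((n / ∏ i, t i : ℕ) : ℝ) * (∏ i, (key (t i) : ℝ)) * ρ ≤ N)
      = (Fintype.piFinset P).filter (fun t => ∏ i, t i ∣ n) := by
    apply Finset.filter_congr
    intro t ht
    rw [Fintype.mem_piFinset] at ht
    constructor
    · exact fun h => h.1
    · intro h
      refine ⟨h, le_trans ?_ hn⟩
      gcongr
      calc ((n / ∏ i, t i : ℕ) : ℝ) * (∏ i, (key (t i) : ℝ)) ≤ ((n / ∏ i, t i : ℕ) : ℝ) * (∏ i, (t i : ℝ)) := by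
            gcongr with i _
            exact hkey i _ (ht i)
        _ = n := by rw [← Nat.cast_prod, ← Nat.cast_mul, Nat.div_mul_cancel h]
  unfold WW
  rw [hf]
  have h4 : ∀ t ∈ (Fintype.piFinset P).filter (fun t => ∏ i, t i ∣ n), wt P (n / ∏ i, t i) = ∏ i, 1 / (omg P i n : ℝ) := by
    intro t ht
    rw [mem_filter] at ht
    unfold wt
    apply Finset.prod_congr rfl
    intro i _
    have := omg_eq hprime hdisj ht.1 (n / ∏ i, t i) i (by rw [Nat.div_mul_cancel ht.2]; exact h3)
    rw [Nat.div_mul_cancel ht.2] at this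
    rw [this]; push_cast; rfl
  rw [Finset.sum_congr rfl h4, sum_const, nsmul_eq_mul, card_dvd hprime hdisj]
  push_cast
  rw [← Finset.prod_mul_distrib]
  apply Finset.prod_eq_one
  intro i _
  obtain ⟨p, hp, hpn⟩ := h2 i
  have h0 : 0 < omg P i n := Finset.card_pos.mpr ⟨p, mem_filter.mpr ⟨hp, hpn⟩⟩
  have : (omg P i n : ℝ) ≠ 0 := by positivity
  field_simp

/-- swapping -/
lemma WW_sum (hprime : ∀ i, ∀ p ∈ P i, p.Prime)
    (key : ℕ → ℕ) (ρ1 : ℝ) (hkey : ∀ i, ∀ p ∈ P i, (p:ℝ) ≤ ρ1 * key p) (N : ℕ) (f : ℕ → ℂ) :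
    ∑ n ∈ Ioc 0 N, (WW P key (ρ1^J) N n : ℂ) * f n =
      ∑ m ∈ Ioc 0 N, (wt P m : ℂ) * ∑ t ∈ Fintype.piFinset P with (m : ℝ) * (∏ i, (key (t i) : ℝ)) * ρ1^J ≤ N, f (m * ∏ i, t i) := by
  have hL : ∑ n ∈ Ioc 0 N, (WW P key (ρ1^J) N n : ℂ) * f n = ∑ t ∈ Fintype.piFinset P,
      ∑ n ∈ (Ioc 0 N).filter (fun n => ∏ i, t i ∣ n ∧ ((n / ∏ i, t i : ℕ) : ℝ) * (∏ i, (key (t i) : ℝ)) * ρ1^J ≤ N), (wt P (n / ∏ i, t i) : ℂ) * f n := by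
    simp_rw [WW, Complex.ofReal_sum, Finset.sum_mul, Finset.sum_filter]
    exact Finset.sum_comm
  have hR : ∑ m ∈ Ioc 0 N, (wt P m : ℂ) * ∑ t ∈ Fintype.piFinset P with (m : ℝ) * (∏ i, (key (t i) : ℝ)) * ρ1^J ≤ N, f (m * ∏ i, t i)
     = ∑ t ∈ Fintype.piFinset P, ∑ m ∈ (Ioc 0 N).filter (fun m : ℕ => (m : ℝ) * (∏ i, (key (t i) : ℝ)) * ρ1^J ≤ N), (wt P m : ℂ) * f (m * ∏ i, t i) := by
    simp_rw [Finset.mul_sum, Finset.sum_filter]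
    exact Finset.sum_comm
  rw [hL, hR]
  apply Finset.sum_congr rfl
  intro t ht
  rw [Fintype.mem_piFinset] at ht
  have hpos : 0 < ∏ i, t i := Finset.prod_pos (fun i _ => (hprime i _ (ht i)).pos)
  symm
  refine Finset.sum_bij (fun m _ => m * ∏ i, t i) ?_ ?_ ?_ ?_
  · intro m hm
    simp only [mem_filter, mem_Ioc] at hm ⊢
    refine ⟨⟨Nat.mul_pos hm.1.1 hpos, ?_⟩, dvd_mul_left _ _, ?_⟩
    · have : ((m * ∏ i, t i : ℕ) : ℝ) ≤ N := by
        refine le_trans ?_ hm.2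
        push_cast
        rw [mul_assoc]
        gcongr
        calc ∏ i, (t i : ℝ) ≤ ∏ i, (ρ1 * key (t i)) := Finset.prod_le_prod (fun i _ => by positivity) (fun i _ => hkey i _ (ht i))
          _ = _ := by rw [Finset.prod_mul_distrib]; simp; ring
      exact_mod_cast this
    · rw [Nat.mul_div_cancel _ hpos]; exact hm.2
  · intro a _ b _ h
    exact Nat.eq_of_mul_eq_mul_right hpos h
  · intro n hn
    simp only [mem_filter, mem_Ioc] at hn
    refine ⟨n / ∏ i, t i, ?_, Nat.div_mul_cancel hn.2.1⟩
    simp only [mem_filter, mem_Ioc]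
    exact ⟨⟨Nat.div_pos (Nat.le_of_dvd hn.1.1 hn.2.1) hpos, (Nat.div_le_self _ _).trans hn.1.2⟩, hn.2.2⟩
  · intro m _
    rw [Nat.mul_div_cancel _ hpos]

end ram

end

section
open Filter Topology Finset

lemma sum_keys {𝕜 : Type*} [CommSemiring 𝕜] {J : ℕ} (P : Fin J → Finset ℕ) (key : ℕ → ℕ) (Q : (Fin J → ℕ) → Prop) [DecidablePred Q]
    (g : ℕ → 𝕜) :
    ∑ t ∈ Fintype.piFinset P with Q (fun i => key (t i)), ∏ i, g (t i) =
      ∑ κ ∈ Fintype.piFinset (fun i => (P i).image key) with Q κ, ∏ i, ∑ p ∈ (P i).filter (fun p => key p = κ i), g p := by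
  rw [← Finset.sum_fiberwise_of_maps_to (s := (Fintype.piFinset P).filter (fun t => Q (fun i => key (t i))))
    (t := (Fintype.piFinset (fun i => (P i).image key)).filter Q) (g := fun t i => key (t i))]
  · apply Finset.sum_congr rfl
    intro κ hκ
    rw [mem_filter] at hκ
    rw [Finset.prod_univ_sum]
    apply Finset.sum_congr _ (fun _ _ => rfl)
    ext t
    simp only [mem_filter, Fintype.mem_piFinset]
    constructor
    · rintro ⟨⟨h1, h2⟩, h3⟩ i
      exact ⟨h1 i, congrFun h3 i⟩
    · intro h
      have : (fun i => key (t i)) = κ := funext (fun i => (h i).2)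
      exact ⟨⟨fun i => (h i).1, by rw [this]; exact hκ.2⟩, this⟩
  · intro t ht
    simp only [mem_filter, Fintype.mem_piFinset] at ht ⊢
    exact ⟨fun i => mem_image_of_mem _ (ht.1 i), ht.2⟩

theorem large_freq {M : ℝ} (hM : 0 < M) {d0 : ℕ} (hd0 : ∀ d : ℕ, d0 ≤ d → 4 * M * LL d + 1 ≤ d)
    {q J : ℕ} (hq : 0 < q) (P : Fin (J+2) → Finset ℕ) (hprime : ∀ i, ∀ p ∈ P i, p.Prime)
    (hdisj : ∀ i j, i ≠ j → Disjoint (P i) (P j)) (key : ℕ → ℕ) (ρ1 : ℝ)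
    (hkey : ∀ i, ∀ p ∈ P i, (p:ℝ) ≤ ρ1 * key p)
    (hreg : ∀ i y, Reg M q ((P i).filter (fun p => key p = y))) (N : ℕ) :
    ∑ r ∈ (range q).filter (fun r => d0 ≤ q / Nat.gcd r q), ‖∑ n ∈ Ioc 0 N, (WW P key (ρ1^(J+2)) N n : ℂ) * fA ((r:ℝ)/q) n‖ ≤
      M * LL q * (1 - 1 / (2 * (4 * M * LL q + 1)^2))^J * N := by
  classical
  set err := M * LL q * (1 - 1 / (2 * (4 * M * LL q + 1)^2))^J with herr
  set Q : ℕ → (Fin (J+2) → ℕ) → Prop := fun m κ => (m : ℝ) * (∏ i, (κ i : ℝ)) * ρ1^(J+2) ≤ N with hQ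
  set KK := Fintype.piFinset (fun i => (P i).image key) with hKK
  have hb : ∀ r : ℕ, ‖∑ n ∈ Ioc 0 N, (WW P key (ρ1^(J+2)) N n : ℂ) * fA ((r:ℝ)/q) n‖ ≤
      ∑ m ∈ Ioc 0 N, wt P m * ∑ κ ∈ KK with Q m κ, ∏ i, ‖SS ((P i).filter (fun p => key p = κ i)) ((r:ℝ)/q)‖ := by
    intro r
    rw [WW_sum hprime key ρ1 hkey N]
    apply norm_sum_le_of_le
    intro m hm
    have hm0 : m ≠ 0 := by simp at hm; omega
    rw [norm_mul, Complex.norm_real, Real.norm_of_nonneg (wt_nonneg P m)]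
    apply mul_le_mul_of_nonneg_left _ (wt_nonneg P m)
    have h1 : ∑ t ∈ Fintype.piFinset P with (m : ℝ) * (∏ i, (key (t i) : ℝ)) * ρ1^(J+2) ≤ N, fA ((r:ℝ)/q) (m * ∏ i, t i)
        = fA ((r:ℝ)/q) m * ∑ κ ∈ KK with Q m κ, ∏ i, SS ((P i).filter (fun p => key p = κ i)) ((r:ℝ)/q) := by
      have h2 := sum_keys P key (Q m) (fun p => ee ((r:ℝ)/q * p))
      unfold SS
      rw [← h2, Finset.mul_sum]
      apply Finset.sum_congr
      · rfl
      intro t ht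
      rw [mem_filter, Fintype.mem_piFinset] at ht
      rw [map_mul, map_prod]
      congr 1
      apply Finset.prod_congr rfl
      intro i _
      have hp := hprime i _ (ht.1 i)
      rw [fA_apply _ hp.ne_zero, A_prime hp]; simp
    rw [h1, norm_mul, fA_apply _ hm0, ee_norm, one_mul]
    apply norm_sum_le_of_le
    intro κ _
    rw [norm_prod]
  have h1 : ∑ m ∈ Ioc 0 N, wt P m * ∑ κ ∈ KK with Q m κ, ∏ i, (#((P i).filter (fun p => key p = κ i)) : ℝ) ≤ N := by
    have h2 := WW_sum hprime key ρ1 hkey N (fun _ => 1)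
    have h3 : ∀ m, ∑ κ ∈ KK with Q m κ, ∏ i, (#((P i).filter (fun p => key p = κ i)) : ℂ) =
        ∑ t ∈ Fintype.piFinset P with (m : ℝ) * (∏ i, (key (t i) : ℝ)) * ρ1^(J+2) ≤ N, (1:ℂ) := by
      intro m
      have h2 := sum_keys P key (Q m) (fun p => (1:ℂ))
      simp only [Finset.prod_const_one] at h2
      refine Eq.trans ?_ h2.symm
      apply Finset.sum_congr rfl
      intro κ _
      apply Finset.prod_congr rfl; intro i _; simp
    have h4 : ((∑ m ∈ Ioc 0 N, wt P m * ∑ κ ∈ KK with Q m κ, ∏ i, (#((P i).filter (fun p => key p = κ i)) : ℝ) : ℝ) : ℂ) =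
        ((∑ n ∈ Ioc 0 N, WW P key (ρ1^(J+2)) N n : ℝ) : ℂ) := by
      push_cast
      simp only [mul_one] at h2
      rw [h2]
      apply Finset.sum_congr rfl; intro m _
      rw [h3]
    have h5 := Complex.ofReal_injective h4
    rw [h5]
    calc _ ≤ ∑ n ∈ Ioc 0 N, (1:ℝ) := Finset.sum_le_sum (fun n _ => WW_le_one hprime hdisj key _ N n)
      _ = N := by simp
  have herr0 : 0 ≤ err := by
    have hL := one_le_LL hq
    have h1 : 1 ≤ 4 * M * LL q + 1 := by nlinarith
    have : 1 / (2 * (4 * M * LL q + 1)^2) ≤ 1 := by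
      rw [div_le_one (by positivity)]; nlinarith
    have : 0 ≤ 1 - 1 / (2 * (4 * M * LL q + 1)^2) := by linarith
    positivity
  calc _ ≤ ∑ r ∈ (range q).filter (fun r => d0 ≤ q / Nat.gcd r q), ∑ m ∈ Ioc 0 N, wt P m * ∑ κ ∈ KK with Q m κ, ∏ i, ‖SS ((P i).filter (fun p => key p = κ i)) ((r:ℝ)/q)‖ :=
        Finset.sum_le_sum (fun r _ => hb r)
    _ = ∑ m ∈ Ioc 0 N, wt P m * ∑ κ ∈ KK with Q m κ, ∑ r ∈ (range q).filter (fun r => d0 ≤ q / Nat.gcd r q), ∏ i, ‖SS ((P i).filter (fun p => key p = κ i)) ((r:ℝ)/q)‖ := by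
        rw [Finset.sum_comm]
        apply Finset.sum_congr rfl; intro m _
        rw [← Finset.mul_sum, Finset.sum_comm]
    _ ≤ ∑ m ∈ Ioc 0 N, wt P m * ∑ κ ∈ KK with Q m κ, err * ∏ i, (#((P i).filter (fun p => key p = κ i)) : ℝ) := by
        apply Finset.sum_le_sum; intro m _
        apply mul_le_mul_of_nonneg_left _ (wt_nonneg P m)
        apply Finset.sum_le_sum; intro κ _
        exact fourier_key hM hd0 hq (fun i => (P i).filter (fun p => key p = κ i)) (fun i => hreg i _)
    _ = err * ∑ m ∈ Ioc 0 N, wt P m * ∑ κ ∈ KK with Q m κ, ∏ i, (#((P i).filter (fun p => key p = κ i)) : ℝ) := by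
        rw [Finset.mul_sum]
        apply Finset.sum_congr rfl; intro m _
        rw [← Finset.mul_sum]; ring
    _ ≤ err * N := by gcongr

lemma card_small_freq (q d0 : ℕ) (hq : 0 < q) : #((range q).filter (fun r => q / Nat.gcd r q < d0)) ≤ d0 ^ 2 := by
  have : #((range q).filter (fun r => q / Nat.gcd r q < d0)) ≤ #(range d0 ×ˢ range d0) := by
    apply Finset.card_le_card_of_injOn (fun r => (q / Nat.gcd r q, r / Nat.gcd r q))
    · intro r hr
      simp only [coe_filter, mem_range, Set.mem_setOf_eq, coe_product, coe_range, Set.mem_prod, Set.mem_Iio] at hr ⊢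
      exact ⟨hr.2, (Nat.div_le_div_right hr.1.le).trans_lt hr.2⟩
    · intro r _ s _ h
      simp only [Prod.mk.injEq] at h
      have e1 := Nat.div_mul_cancel (Nat.gcd_dvd_right r q)
      have e2 := Nat.div_mul_cancel (Nat.gcd_dvd_right s q)
      have e3 := Nat.div_mul_cancel (Nat.gcd_dvd_left r q)
      have e4 := Nat.div_mul_cancel (Nat.gcd_dvd_left s q)
      have hpos : 0 < q / Nat.gcd r q := Nat.div_pos (Nat.le_of_dvd hq (Nat.gcd_dvd_right r q)) (Nat.gcd_pos_of_pos_right _ hq)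
      have hg : Nat.gcd r q = Nat.gcd s q := by
        apply Nat.eq_of_mul_eq_mul_left hpos
        rw [e1, h.1, e2]
      rw [← e3, ← e4, h.2, hg]
  simpa [sq] using this

open Classical in
theorem assembly {M : ℝ} (hM : 0 < M) {d0 : ℕ} (hd0 : ∀ d : ℕ, d0 ≤ d → 4 * M * LL d + 1 ≤ d)
    {q J : ℕ} (hq : 0 < q) (P : Fin (J+2) → Finset ℕ) (hprime : ∀ i, ∀ p ∈ P i, p.Prime)
    (hdisj : ∀ i j, i ≠ j → Disjoint (P i) (P j)) (key : ℕ → ℕ) (ρ1 : ℝ) (hρ1 : 0 ≤ ρ1)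
    (hkey : ∀ i, ∀ p ∈ P i, (p:ℝ) ≤ ρ1 * key p) (hkey' : ∀ i, ∀ p ∈ P i, key p ≤ p)
    (hreg : ∀ i y, Reg M q ((P i).filter (fun p => key p = y))) (N : ℕ) (ε1 : ℝ) (hε1 : 0 ≤ ε1)
    (hH : ∀ r ∈ range q, r ≠ 0 → q / Nat.gcd r q < d0 → ‖∑ n ∈ Ioc 0 N, fA ((r:ℝ)/q) n‖ ≤ ε1 * N) (a : ℤ) :
    |(#((Ioc 0 N).filter (fun n => A n ≡ a [ZMOD (q:ℤ)])) : ℝ) - N / q| ≤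
      #((Ioc 0 N).filter (fun n => A n ≡ a [ZMOD (q:ℤ)] ∧ badP P (ρ1^(J+2)) N n)) +
      (1 / q) * ((1 + d0^2) * #((Ioc 0 N).filter (fun n => badP P (ρ1^(J+2)) N n)) +
        M * LL q * (1 - 1 / (2 * (4 * M * LL q + 1)^2))^J * N + d0^2 * (ε1 * N)) := by
  set ρ := ρ1^(J+2) with hρ
  have hρ0 : 0 ≤ ρ := by positivity
  set W : ℕ → ℝ := fun n => WW P key ρ N n with hW
  have hW0 : ∀ n, 0 ≤ W n := fun n => WW_nonneg key ρ N n
  have hW1 : ∀ n, W n ≤ 1 := fun n => WW_le_one hprime hdisj key ρ N n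
  have hWb : ∀ n, 1 - W n ≤ if badP P ρ N n then 1 else 0 := by
    intro n
    split_ifs with h
    · have := hW0 n; linarith
    · have : W n = 1 := WW_eq_one hprime hdisj key hkey' ρ hρ0 N n h
      linarith
  have hq' : (0:ℝ) < q := by exact_mod_cast hq
  set Bad1 : ℝ := (#((Ioc 0 N).filter (fun n => badP P ρ N n)) : ℝ) with hBad1
  have hdef : ∑ n ∈ Ioc 0 N, (1 - W n) ≤ Bad1 := by
    refine (Finset.sum_le_sum (fun n _ => hWb n)).trans ?_
    rw [← Finset.sum_filter]; simp [hBad1]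
  -- character sums
  set T : ℕ → ℂ := fun r => ∑ n ∈ Ioc 0 N, (W n : ℂ) * fA ((r:ℝ)/q) n with hT
  set V : ℝ := ∑ n ∈ (Ioc 0 N).filter (fun n => A n ≡ a [ZMOD (q:ℤ)]), W n with hV
  have hVT : (q:ℂ) * V = ∑ r ∈ range q, ee (-((r:ℝ)/q * a)) * T r := by
    simp only [hT, Finset.mul_sum]
    rw [Finset.sum_comm, hV, Finset.sum_filter]
    push_cast
    rw [Finset.mul_sum]
    apply Finset.sum_congr rfl
    intro n hn
    have hn0 : n ≠ 0 := by simp at hn; omega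
    have h1 : ∀ r ∈ range q, ee (-((r:ℝ)/q * a)) * ((W n : ℂ) * fA ((r:ℝ)/q) n) = W n * ee ((r:ℝ)/q * ((A n - a : ℤ))) := by
      intro r _
      rw [fA_apply _ hn0, show ((r:ℝ)/q * ((A n - a : ℤ))) = -((r:ℝ)/q * a) + (r:ℝ)/q * A n by push_cast; ring, ee_add]
      ring
    rw [Finset.sum_congr rfl h1, ← Finset.mul_sum, sum_ee_mod q hq]
    have : (q:ℤ) ∣ A n - a ↔ A n ≡ a [ZMOD (q:ℤ)] := by
      rw [Int.modEq_comm, Int.modEq_iff_dvd]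
    by_cases h : A n ≡ a [ZMOD (q:ℤ)]
    · rw [if_pos h, if_pos (this.mpr h), mul_comm]
    · rw [if_neg h, if_neg (fun h' => h (this.mp h'))]; simp
  have hT0 : T 0 = ((∑ n ∈ Ioc 0 N, W n : ℝ) : ℂ) := by
    simp only [hT]
    push_cast
    apply Finset.sum_congr rfl
    intro n hn
    have hn0 : n ≠ 0 := by simp at hn; omega
    rw [fA_apply _ hn0]; simp [ee_zero]
  have hsum : ‖(q:ℂ) * V - T 0‖ ≤ ∑ r ∈ (range q).erase 0, ‖T r‖ := by
    rw [hVT, ← Finset.add_sum_erase _ _ (mem_range.mpr hq)]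
    have : ee (-(((0:ℕ):ℝ)/q * a)) = 1 := by simp [ee_zero]
    rw [this, one_mul, add_sub_cancel_left]
    apply norm_sum_le_of_le
    intro r _
    rw [norm_mul, ee_norm, one_mul]
  have hTs : ∀ r ∈ range q, r ≠ 0 → q / Nat.gcd r q < d0 → ‖T r‖ ≤ ε1 * N + Bad1 := by
    intro r hr hr0 hrd
    have h1 : T r = ∑ n ∈ Ioc 0 N, fA ((r:ℝ)/q) n - ∑ n ∈ Ioc 0 N, ((1 - W n : ℝ) : ℂ) * fA ((r:ℝ)/q) n := by
      rw [← Finset.sum_sub_distrib]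
      apply Finset.sum_congr rfl; intro n _; push_cast; ring
    rw [h1]
    refine (norm_sub_le _ _).trans (add_le_add (hH r hr hr0 hrd) (le_trans ?_ hdef))
    apply norm_sum_le_of_le
    intro n hn
    have hn0 : n ≠ 0 := by simp at hn; omega
    rw [norm_mul, Complex.norm_real, Real.norm_of_nonneg (by linarith [hW1 n]), fA_apply _ hn0, ee_norm, mul_one]
  have hB0 : 0 ≤ Bad1 := by rw [hBad1]; positivity
  have hsum2 : ∑ r ∈ (range q).erase 0, ‖T r‖ ≤ M * LL q * (1 - 1 / (2 * (4 * M * LL q + 1)^2))^J * N + d0^2 * (ε1 * N + Bad1) := by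
    rw [← Finset.sum_filter_add_sum_filter_not _ (fun r => d0 ≤ q / Nat.gcd r q)]
    apply add_le_add
    · refine le_trans ?_ (large_freq hM hd0 hq P hprime hdisj key ρ1 hkey hreg N)
      apply Finset.sum_le_sum_of_subset_of_nonneg
      · intro r hr
        rw [mem_filter] at hr ⊢
        exact ⟨mem_of_mem_erase hr.1, hr.2⟩
      · intro _ _ _; positivity
    · calc _ ≤ ∑ r ∈ ((range q).erase 0).filter (fun r => ¬ d0 ≤ q / Nat.gcd r q), (ε1 * N + Bad1) := by
            apply Finset.sum_le_sum; intro r hr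
            rw [mem_filter, mem_erase] at hr
            exact hTs r hr.1.2 hr.1.1 (not_le.mp hr.2)
        _ = #(((range q).erase 0).filter (fun r => ¬ d0 ≤ q / Nat.gcd r q)) * (ε1 * N + Bad1) := by rw [sum_const, nsmul_eq_mul]
        _ ≤ _ := by
            have h1 : #(((range q).erase 0).filter (fun r => ¬ d0 ≤ q / Nat.gcd r q)) ≤ d0^2 := by
              refine le_trans (card_le_card ?_) (card_small_freq q d0 hq)
              intro r hr
              rw [mem_filter, mem_erase] at hr
              rw [mem_filter]
              exact ⟨hr.1.2, not_le.mp hr.2⟩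
            have : (#(((range q).erase 0).filter (fun r => ¬ d0 ≤ q / Nat.gcd r q)) : ℝ) ≤ (d0:ℝ)^2 := by exact_mod_cast h1
            gcongr
  have hfin : |(q:ℝ) * V - ∑ n ∈ Ioc 0 N, W n| ≤ M * LL q * (1 - 1 / (2 * (4 * M * LL q + 1)^2))^J * N + d0^2 * (ε1 * N + Bad1) := by
    refine le_trans (le_of_eq ?_) (hsum.trans hsum2)
    rw [hT0, ← Complex.ofReal_natCast, ← Complex.ofReal_mul, ← Complex.ofReal_sub, Complex.norm_real, Real.norm_eq_abs]
  set c : ℝ := (#((Ioc 0 N).filter (fun n => A n ≡ a [ZMOD (q:ℤ)])) : ℝ) with hc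
  set Bq : ℝ := (#((Ioc 0 N).filter (fun n => A n ≡ a [ZMOD (q:ℤ)] ∧ badP P ρ N n)) : ℝ) with hBq
  have hc1 : |c - V| ≤ Bq := by
    have : c - V = ∑ n ∈ (Ioc 0 N).filter (fun n => A n ≡ a [ZMOD (q:ℤ)]), (1 - W n) := by
      rw [Finset.sum_sub_distrib, hc, hV]; simp
    rw [this, abs_of_nonneg (Finset.sum_nonneg (fun n _ => by linarith [hW1 n]))]
    refine (Finset.sum_le_sum (fun n _ => hWb n)).trans ?_
    rw [← Finset.sum_filter, filter_filter]; simp [hBq]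
  have hWN : |∑ n ∈ Ioc 0 N, W n - N| ≤ Bad1 := by
    have : (N:ℝ) - ∑ n ∈ Ioc 0 N, W n = ∑ n ∈ Ioc 0 N, (1 - W n) := by
      rw [Finset.sum_sub_distrib]; simp
    rw [abs_sub_comm, this, abs_of_nonneg (Finset.sum_nonneg (fun n _ => by linarith [hW1 n]))]
    exact hdef
  have hsplit : c - N / q = (c - V) + (1/q) * (((q:ℝ) * V - ∑ n ∈ Ioc 0 N, W n) + (∑ n ∈ Ioc 0 N, W n - N)) := by
    field_simp; ring
  rw [hsplit]
  refine (abs_add_le _ _).trans (add_le_add hc1 ?_)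
  rw [abs_mul, abs_of_pos (show (0:ℝ) < 1/q by positivity)]
  gcongr
  refine (abs_add_le _ _).trans ((add_le_add hfin hWN).trans (le_of_eq ?_))
  ring

end

section
open Filter Topology Finset
open scoped Classical

lemma harm_le (N : ℕ) : ∑ n ∈ Ioc 0 N, 1 / (n:ℝ) ≤ 1 + Real.log N := by
  have := harmonic_le_one_add_log N
  rw [harmonic_eq_sum_Icc] at this
  push_cast at this
  refine le_trans (le_of_eq ?_) this
  apply Finset.sum_congr
  · ext n; simp; omega
  · intro n _; simp

lemma sum_card_divisors_le (N : ℕ) : ∑ n ∈ Ioc 0 N, (#n.divisors : ℝ) ≤ N * (1 + Real.log N) := by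
  have h1 : ∑ n ∈ Ioc 0 N, (#n.divisors : ℝ) = ∑ d ∈ Ioc 0 N, (#((Ioc 0 N).filter (fun n => d ∣ n)) : ℝ) := by
    have : ∀ n ∈ Ioc 0 N, (#n.divisors : ℝ) = ∑ d ∈ Ioc 0 N, if d ∣ n then 1 else 0 := by
      intro n hn
      rw [mem_Ioc] at hn
      rw [← Finset.sum_filter, sum_const, nsmul_eq_mul, mul_one]
      congr 2
      ext d
      simp only [Nat.mem_divisors, mem_filter, mem_Ioc]
      constructor
      · rintro ⟨h, _⟩
        exact ⟨⟨Nat.pos_of_dvd_of_pos h hn.1, (Nat.le_of_dvd hn.1 h).trans hn.2⟩, h⟩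
      · rintro ⟨_, h⟩; exact ⟨h, by omega⟩
    rw [Finset.sum_congr rfl this, Finset.sum_comm]
    apply Finset.sum_congr rfl; intro d _
    rw [← Finset.sum_filter]; simp
  rw [h1]
  calc _ ≤ ∑ d ∈ Ioc 0 N, (N:ℝ) * (1 / (d:ℝ)) := by
        apply Finset.sum_le_sum; intro d _
        rw [Nat.Ioc_filter_dvd_card_eq_div]
        rw [mul_one_div]; exact Nat.cast_div_le
    _ = (N:ℝ) * ∑ d ∈ Ioc 0 N, 1 / (d:ℝ) := by rw [Finset.mul_sum]
    _ ≤ _ := by gcongr; exact harm_le N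

lemma sum_sq_tail (R N : ℕ) (hR : 0 < R) : ∑ b ∈ Ioc R N, 1 / (b:ℝ)^2 ≤ 1 / (R:ℝ) := by
  by_cases h : R ≤ N
  · have := sum_Ioc_inv_sq_le_sub (α := ℝ) hR.ne' h
    have h0 : (0:ℝ) ≤ (N:ℝ)⁻¹ := by positivity
    simp only [one_div]
    linarith
  · rw [Finset.Ioc_eq_empty (by omega)]; simp

lemma count_sq_dvd (R N : ℕ) (hR : 0 < R) : (#((Ioc 0 N).filter (fun n => ∃ b, R < b ∧ b^2 ∣ n)) : ℝ) ≤ (N:ℝ) / R := by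
  have hsub : (Ioc 0 N).filter (fun n => ∃ b, R < b ∧ b^2 ∣ n) ⊆ (Ioc R N).biUnion (fun b => (Ioc 0 N).filter (fun n => b^2 ∣ n)) := by
    intro n hn
    rw [mem_filter] at hn
    obtain ⟨hn, b, hb, hbn⟩ := hn
    rw [mem_Ioc] at hn
    rw [mem_biUnion]
    refine ⟨b, ?_, by rw [mem_filter, mem_Ioc]; exact ⟨hn, hbn⟩⟩
    rw [mem_Ioc]
    refine ⟨hb, ?_⟩
    have := Nat.le_of_dvd hn.1 hbn
    nlinarith
  have h1 : (#((Ioc 0 N).filter (fun n => ∃ b, R < b ∧ b^2 ∣ n)) : ℝ) ≤ ∑ b ∈ Ioc R N, (#((Ioc 0 N).filter (fun n => b^2 ∣ n)) : ℝ) := by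
    exact_mod_cast (card_le_card hsub).trans card_biUnion_le
  refine h1.trans ?_
  calc _ ≤ ∑ b ∈ Ioc R N, (N:ℝ) * (1 / (b:ℝ)^2) := by
        apply Finset.sum_le_sum; intro d _
        rw [Nat.Ioc_filter_dvd_card_eq_div]
        rw [mul_one_div]
        exact_mod_cast Nat.cast_div_le (α := ℝ) (m := N) (n := d^2)
    _ = (N:ℝ) * ∑ b ∈ Ioc R N, 1 / (b:ℝ)^2 := by rw [Finset.mul_sum]
    _ ≤ (N:ℝ) * (1 / (R:ℝ)) := by gcongr; exact sum_sq_tail R N hR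
    _ = _ := by ring

lemma count_many (N k : ℕ) : (#((Ioc 0 N).filter (fun n => k ≤ #n.primeFactors)) : ℝ) ≤ N * (1 + Real.log N) / 2^k := by
  rw [le_div_iff₀ (by positivity)]
  refine le_trans ?_ (sum_card_divisors_le N)
  calc _ = ∑ n ∈ (Ioc 0 N).filter (fun n => k ≤ #n.primeFactors), (2:ℝ)^k := by simp
    _ ≤ ∑ n ∈ (Ioc 0 N).filter (fun n => k ≤ #n.primeFactors), (#n.divisors : ℝ) := by
        apply Finset.sum_le_sum
        intro n hn
        rw [mem_filter, mem_Ioc] at hn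
        have hn0 : n ≠ 0 := by omega
        have : 2^k ≤ #n.divisors := by
          rw [Nat.card_divisors hn0]
          calc 2^k ≤ 2^(#n.primeFactors) := Nat.pow_le_pow_right (by norm_num) hn.2
            _ ≤ _ := by
              apply Finset.pow_card_le_prod
              intro p hp
              have := (Nat.prime_of_mem_primeFactors hp).factorization_pos_of_dvd hn0 (Nat.dvd_of_mem_primeFactors hp)
              omega
        exact_mod_cast this
    _ ≤ _ := Finset.sum_le_sum_of_subset_of_nonneg (filter_subset _ _) (fun _ _ _ => by positivity)

theorem smooth_count (N z G R : ℕ) (hN : 0 < N) (hzN : z^(4*G) ≤ N) (hR : 0 < R) (hRN : R^8 ≤ N) :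
    (#((Ioc 0 N).filter (fun n => ∀ p, p.Prime → p ∣ n → p ≤ z)) : ℝ) ≤ 2 * ((N:ℝ) / R) + (N:ℝ) * (1 + Real.log N) / 2^G := by
  have hsub : (Ioc 0 N).filter (fun n => ∀ p, p.Prime → p ∣ n → p ≤ z) ⊆
      Ioc 0 (Nat.sqrt N) ∪ ((Ioc 0 N).filter (fun n => ∃ b, R < b ∧ b^2 ∣ n) ∪ (Ioc 0 N).filter (fun n => G ≤ #n.primeFactors)) := by
    intro n hn
    rw [mem_filter] at hn
    obtain ⟨hn, hs⟩ := hn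
    rw [mem_Ioc] at hn
    simp only [mem_union, mem_filter, mem_Ioc]
    by_contra hcon
    simp only [not_or, not_and, not_exists, not_le, hn, true_and, and_self, forall_true_left] at hcon
    obtain ⟨h1, h2, h3⟩ := hcon
    have h1' : N < n * n := Nat.sqrt_lt.mp h1
    obtain ⟨a, b, hab, ha⟩ := Nat.sq_mul_squarefree n
    have hb : b ≤ R := by
      by_contra hb
      exact h2 b (by omega) ⟨a, hab.symm⟩
    have han : a ∣ n := ⟨b^2, by rw [← hab]; ring⟩
    have hn0 : n ≠ 0 := by omega
    have haz : a ≤ z ^ (#a.primeFactors) := by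
      conv_lhs => rw [← Nat.prod_primeFactors_of_squarefree ha]
      apply Finset.prod_le_pow_card
      intro p hp
      exact hs p (Nat.prime_of_mem_primeFactors hp) ((Nat.dvd_of_mem_primeFactors hp).trans han)
    have hcard : #a.primeFactors ≤ #n.primeFactors := card_le_card (Nat.primeFactors_mono han hn0)
    have ha4 : a^4 ≤ N := by
      rcases Nat.eq_zero_or_pos z with hz | hz
      · have : a ≤ 1 := by
          rw [hz] at haz
          exact haz.trans (by rcases Nat.eq_zero_or_pos (#a.primeFactors) with h | h <;> simp [h, Nat.pos_iff_ne_zero.mp])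
        calc a^4 ≤ 1^4 := Nat.pow_le_pow_left this 4
          _ ≤ N := by omega
      · calc a^4 ≤ (z ^ (#a.primeFactors))^4 := Nat.pow_le_pow_left haz 4
          _ = z^(4 * #a.primeFactors) := by rw [← pow_mul, mul_comm]
          _ ≤ z^(4*G) := Nat.pow_le_pow_right hz (by omega)
          _ ≤ N := hzN
    have hb8 : b^8 ≤ N := (Nat.pow_le_pow_left hb 8).trans hRN
    have h4 : n^4 ≤ N * N := by
      calc n^4 = b^8 * a^4 := by rw [← hab]; ring
        _ ≤ N * N := Nat.mul_le_mul hb8 ha4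
    have h5 : N * N < (n*n)*(n*n) := Nat.mul_lt_mul'' h1' h1'
    have : (n*n)*(n*n) = n^4 := by ring
    omega
  have h1 := (card_le_card hsub).trans ((card_union_le _ _).trans (Nat.add_le_add_left (card_union_le _ _) _))
  have h2 : (#((Ioc 0 N).filter (fun n => ∀ p, p.Prime → p ∣ n → p ≤ z)) : ℝ) ≤ (Nat.sqrt N : ℝ) + ((#((Ioc 0 N).filter (fun n => ∃ b, R < b ∧ b^2 ∣ n)) : ℝ) + (#((Ioc 0 N).filter (fun n => G ≤ #n.primeFactors)) : ℝ)) := by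
    rw [Nat.card_Ioc] at h1
    exact_mod_cast h1
  have h3 : (Nat.sqrt N : ℝ) ≤ (N:ℝ) / R := by
    rw [le_div_iff₀ (by exact_mod_cast hR)]
    have e1 : R ≤ Nat.sqrt N := by
      rw [Nat.le_sqrt]
      calc R * R = R^2 := by ring
        _ ≤ R^8 := Nat.pow_le_pow_right hR (by norm_num)
        _ ≤ N := hRN
    have e2 : Nat.sqrt N * R ≤ N := (Nat.mul_le_mul_left _ e1).trans (Nat.sqrt_le N)
    exact_mod_cast e2
  have h4 := count_sq_dvd R N hR
  have h5 := count_many N G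
  linarith

end

section
open Filter Topology Finset
open scoped Classical

lemma bad_bt (q z0 : ℕ) (hq : 0 < q) (hz : 2 ≤ z0) (a : ℤ) (E : Finset ℕ) (hE : ∀ m ∈ E, 0 < m) (u H : ℕ → ℕ)
    (S : Finset ℕ) (hS : ∀ n ∈ S, A n ≡ a [ZMOD (q:ℤ)] ∧
      ∃ m ∈ E, ∃ p : ℕ, p.Prime ∧ z0 < p ∧ u m < p ∧ p ≤ u m + H m ∧ n = m * p) :
    (#S : ℝ) ≤ ∑ m ∈ E, (2 * LL q * H m / (q * Real.log z0) + (z0:ℝ)^4) := by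
  set v : ℕ → ℕ := fun m => ((a - A m) % (q:ℤ)).toNat with hv
  have hsub : S ⊆ E.biUnion (fun m => ((Ioc (u m) (u m + H m)).filter
      (fun p => p.Prime ∧ z0 < p ∧ p ≡ v m [MOD q])).image (fun p => m * p)) := by
    intro n hn
    obtain ⟨hA, m, hm, p, hp, hzp, h1, h2, rfl⟩ := hS n hn
    rw [mem_biUnion]
    refine ⟨m, hm, ?_⟩
    rw [mem_image]
    refine ⟨p, ?_, rfl⟩
    rw [mem_filter, mem_Ioc]
    refine ⟨⟨h1, h2⟩, hp, hzp, ?_⟩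
    rw [A_mul (hE m hm).ne' hp.ne_zero, A_prime hp] at hA
    rw [← Int.natCast_modEq_iff]
    have hnn : 0 ≤ (a - A m) % (q:ℤ) := Int.emod_nonneg _ (by omega)
    have : ((v m : ℕ) : ℤ) = (a - A m) % (q:ℤ) := by simp only [hv]; exact Int.toNat_of_nonneg hnn
    rw [this]
    refine Int.ModEq.trans ?_ (Int.mod_modEq _ _).symm
    have := hA.sub_right (A m)
    rwa [add_sub_cancel_left] at this
  have h1 : (#S : ℝ) ≤ ∑ m ∈ E, (#((Ioc (u m) (u m + H m)).filter
      (fun p => p.Prime ∧ z0 < p ∧ p ≡ v m [MOD q])) : ℝ) := by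
    have := ((card_le_card hsub).trans card_biUnion_le).trans (Finset.sum_le_sum (fun m _ => card_image_le))
    exact_mod_cast this
  refine h1.trans (Finset.sum_le_sum fun m _ => ?_)
  convert BT q z0 (u m) (H m) (v m) hq hz using 3

end

section
open Filter Topology Finset
open scoped Classical

/-- cell length -/
def hc (g k : ℕ) : ℕ := 2^(4*k-g)
def bk (p : ℕ) : ℕ := Nat.log 16 p
def keyc (g p : ℕ) : ℕ := hc g (bk p) * (p / hc g (bk p))
def cellc (g k y : ℕ) : Finset ℕ := (Ico y (y + hc g k)).filter Nat.Prime
def goodp (g p : ℕ) : Prop := hc g (bk p) ≤ 15 * (bk p + 1) * #(cellc g (bk p) (keyc g p))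
noncomputable def GP (g a b : ℕ) : Finset ℕ :=
  (range (16^b)).filter (fun p => p.Prime ∧ a ≤ bk p ∧ bk p < b ∧ goodp g p)

lemma hc_pos (g k : ℕ) : 0 < hc g k := by unfold hc; positivity
lemma hc_mul {g k : ℕ} (h : g ≤ 4*k) : hc g k * 2^g = 16^k := by
  unfold hc
  rw [← pow_add, Nat.sub_add_cancel h, pow_mul]; norm_num

lemma bk_eq {k p : ℕ} (h1 : 16^k ≤ p) (h2 : p < 16^(k+1)) : bk p = k :=
  (Nat.log_eq_iff (Or.inr ⟨by norm_num, by have : 0 < 16^k := by positivity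
                                           omega⟩)).mpr ⟨h1, h2⟩
lemma le_of_bk {p : ℕ} (hp : 0 < p) : 16^(bk p) ≤ p := Nat.pow_log_le_self _ hp.ne'
lemma lt_of_bk (p : ℕ) : p < 16^(bk p + 1) := Nat.lt_pow_succ_log_self (by norm_num) p

lemma keyc_le (g p : ℕ) : keyc g p ≤ p := Nat.mul_div_le _ _
lemma lt_keyc (g p : ℕ) : p < keyc g p + hc g (bk p) := by
  unfold keyc
  have := Nat.lt_mul_div_succ p (hc_pos g (bk p))
  rw [mul_add, mul_one] at this; exact this

lemma le_keyc {g p : ℕ} (hp : 0 < p) (h : g ≤ 4 * bk p) : 16^(bk p) ≤ keyc g p := by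
  rw [← hc_mul h]
  unfold keyc
  apply Nat.mul_le_mul_left
  rw [Nat.le_div_iff_mul_le (hc_pos _ _), mul_comm, hc_mul h]
  exact le_of_bk hp

lemma keyc_add_le {g p : ℕ} (h : g ≤ 4 * bk p) : keyc g p + hc g (bk p) ≤ 16^(bk p + 1) := by
  have e : 16^(bk p + 1) = hc g (bk p) * (2^g * 16) := by rw [pow_succ, ← hc_mul h]; ring
  have h1 := lt_of_bk p
  unfold keyc
  rw [e] at h1 ⊢
  rw [← Nat.mul_succ]
  apply Nat.mul_le_mul_left
  exact Nat.div_lt_of_lt_mul h1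

lemma bk_keyc {g p : ℕ} (hp : 0 < p) (h : g ≤ 4 * bk p) : bk (keyc g p) = bk p :=
  bk_eq (le_keyc hp h) ((keyc_le g p).trans_lt (lt_of_bk p))

lemma bk_cell {g p p' : ℕ} (hp : 0 < p) (h : g ≤ 4 * bk p) (h1 : keyc g p ≤ p') (h2 : p' < keyc g p + hc g (bk p)) :
    bk p' = bk p :=
  bk_eq ((le_keyc hp h).trans h1) (h2.trans_le (keyc_add_le h))

lemma keyc_cell {g p p' : ℕ} (hp : 0 < p) (h : g ≤ 4 * bk p) (h1 : keyc g p ≤ p') (h2 : p' < keyc g p + hc g (bk p)) :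
    keyc g p' = keyc g p := by
  have hb := bk_cell hp h h1 h2
  unfold keyc at h1 h2 ⊢
  rw [hb]
  congr 1
  apply Nat.div_eq_of_lt_le
  · rw [mul_comm]; exact h1
  · rw [mul_comm, Nat.mul_succ]; exact h2

lemma goodp_cell {g p p' : ℕ} (hp : 0 < p) (h : g ≤ 4 * bk p) (h1 : keyc g p ≤ p') (h2 : p' < keyc g p + hc g (bk p))
    (hg : goodp g p) : goodp g p' := by
  unfold goodp at *
  rw [bk_cell hp h h1 h2, keyc_cell hp h h1 h2]; exact hg

lemma GP_mem {g a b p : ℕ} : p ∈ GP g a b ↔ p.Prime ∧ a ≤ bk p ∧ bk p < b ∧ goodp g p := by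
  unfold GP
  rw [mem_filter, mem_range]
  constructor
  · exact fun h => h.2
  · intro h
    refine ⟨?_, h⟩
    exact (lt_of_bk p).trans_le (Nat.pow_le_pow_right (by norm_num) h.2.2.1)

lemma key_real {g p : ℕ} (hp : 0 < p) (h : g ≤ 4 * bk p) : (p:ℝ) ≤ (1 + 1/2^g) * keyc g p := by
  have h1 : (p:ℝ) ≤ keyc g p + hc g (bk p) := by exact_mod_cast (lt_keyc g p).le
  have h2 : (hc g (bk p) : ℝ) * 2^g ≤ keyc g p := by
    have := le_keyc hp h
    rw [← hc_mul h] at this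
    exact_mod_cast this
  have h3 : (hc g (bk p) : ℝ) ≤ keyc g p / 2^g := by
    rw [le_div_iff₀ (by positivity)]; exact h2
  have : (1 + 1/2^g) * (keyc g p : ℝ) = keyc g p + keyc g p / 2^g := by ring
  linarith

lemma GP_cell {g a b p : ℕ} (ha : g ≤ 4 * a) (hp : p ∈ GP g a b) :
    (GP g a b).filter (fun p' => keyc g p' = keyc g p) = cellc g (bk p) (keyc g p) := by
  have hp' := GP_mem.mp hp
  have hp0 := hp'.1.pos
  have hpa : g ≤ 4 * bk p := by omega
  ext p'
  unfold cellc
  rw [mem_filter, mem_filter, mem_Ico, GP_mem]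
  constructor
  · rintro ⟨⟨h1, h2, h3, h4⟩, h5⟩
    have hb : bk p' = bk p := by
      rw [← bk_keyc h1.pos (g := g) (by omega), h5, bk_keyc hp0 hpa]
    refine ⟨⟨h5 ▸ keyc_le g p', ?_⟩, h1⟩
    rw [← h5, ← hb]; exact lt_keyc g p'
  · rintro ⟨⟨h1, h2⟩, h3⟩
    have hb := bk_cell hp0 hpa h1 h2
    exact ⟨⟨h3, by omega, by omega, goodp_cell hp0 hpa h1 h2 hp'.2.2.2⟩, keyc_cell hp0 hpa h1 h2⟩

lemma pow_bound (k : ℕ) (hk : 20 ≤ k) : 15 * (k+1) ≤ 2^k := by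
  induction k, hk using Nat.le_induction with
  | base => norm_num
  | succ k hk ih => rw [pow_succ]; omega

lemma cell_reg {g p q d b : ℕ} (hp : p.Prime) (hg : g ≤ bk p) (hk : 20 ≤ bk p) (hq0 : 0 < q) (hq : q ≤ 2^(bk p))
    (hgood : goodp g p) (hd : d ∣ q) :
    (#((cellc g (bk p) (keyc g p)).filter (· ≡ b [MOD d])) : ℝ) ≤
      500 * LL d * #(cellc g (bk p) (keyc g p)) / d := by
  have hd0 : 0 < d := Nat.pos_of_dvd_of_pos hd hq0
  have hdq : d ≤ 2^(bk p) := (Nat.le_of_dvd hq0 hd).trans hq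
  have hL := one_le_LL hd0
  unfold goodp at hgood
  have hle := le_keyc hp.pos (g := g) (by omega)
  set y := keyc g p
  set k := bk p with hkdef
  set C := cellc g k y with hC
  have hy : 1 ≤ y := by
    have : 0 < 16^k := by positivity
    omega
  set z := 2^(k/4) with hz
  have hz2 : 2 ≤ z := by
    calc 2 = 2^1 := by norm_num
      _ ≤ 2^(k/4) := Nat.pow_le_pow_right (by norm_num) (by omega)
  have hzlt : z < y := by
    refine lt_of_lt_of_le ?_ hle
    calc z ≤ 2^k := Nat.pow_le_pow_right (by norm_num) (by omega)
      _ < 16^k := Nat.pow_lt_pow_left (by norm_num) (by omega)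
  have hsub : C.filter (· ≡ b [MOD d]) ⊆ (Ioc (y-1) ((y-1)+hc g k)).filter (fun p => p.Prime ∧ z < p ∧ p ≡ b [MOD d]) := by
    intro r hr
    rw [hC, mem_filter, cellc, mem_filter, mem_Ico] at hr
    rw [mem_filter, mem_Ioc]
    refine ⟨⟨by omega, by omega⟩, hr.1.2, by omega, hr.2⟩
  have hbt := BT d z (y-1) (hc g k) b hd0 hz2
  have h1 : (#(C.filter (· ≡ b [MOD d])) : ℝ) ≤ 2*LL d*(hc g k)/(d*Real.log z) + (z:ℝ)^4 := by
    refine le_trans ?_ hbt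
    have := card_le_card hsub
    convert (Nat.cast_le (α := ℝ)).mpr this using 3
  have hlog : ((k:ℝ)+1)/8 ≤ Real.log z := by
    rw [hz]; push_cast
    rw [Real.log_pow]
    have e1 : (k:ℝ)/4 - 3/4 ≤ ((k/4 : ℕ) : ℝ) := by
      have : k ≤ 4*(k/4) + 3 := by omega
      have : (k:ℝ) ≤ 4*((k/4:ℕ):ℝ) + 3 := by exact_mod_cast this
      linarith
    have e2 := Real.log_two_gt_d9
    have e3 : (20:ℝ) ≤ k := by exact_mod_cast hk
    nlinarith
  have hgoodR : (hc g k : ℝ) ≤ 15 * (k+1) * #C := by exact_mod_cast hgood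
  have hd0' : (0:ℝ) < d := by exact_mod_cast hd0
  have h2 : 2*LL d*(hc g k)/(d*Real.log z) ≤ 240 * LL d * #C / d := by
    calc 2*LL d*(hc g k)/(d*Real.log z) ≤ 2*LL d*(15 * (k+1) * #C)/(d*(((k:ℝ)+1)/8)) := by gcongr
      _ = 240 * LL d * #C / d := by field_simp; ring
  have h3 : (z:ℝ)^4 ≤ #C / d := by
    rw [le_div_iff₀ hd0']
    have hz4 : z^4 ≤ 2^k := by
      rw [hz, ← pow_mul]; exact Nat.pow_le_pow_right (by norm_num) (by omega)
    have hh : 2^k * 2^k * 2^k ≤ hc g k := by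
      unfold hc
      rw [← pow_add, ← pow_add]; exact Nat.pow_le_pow_right (by norm_num) (by omega)
    have hpb := pow_bound k hk
    have h5 : 2^k * 2^k * 2^k ≤ 2^k * #C := by
      calc _ ≤ hc g k := hh
        _ ≤ _ := hgood
        _ ≤ _ := Nat.mul_le_mul_right _ hpb
    have h6 : 2^k * 2^k ≤ #C := by
      rw [mul_assoc] at h5
      exact Nat.le_of_mul_le_mul_left h5 (by positivity)
    have h7 : z^4 * d ≤ #C := (Nat.mul_le_mul hz4 hdq).trans h6
    exact_mod_cast h7
  have h4 : (#C:ℝ)/d ≤ 1 * LL d * #C/d := by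
    gcongr; rw [one_mul]
    exact le_mul_of_one_le_left (by positivity) hL
  have h5 : 500 * LL d * #C / d = 240 * LL d * #C / d + 260 * (1 * LL d * #C/d) := by ring
  have h6 : 0 ≤ 1 * LL d * #C/d := by positivity
  linarith

lemma GP_reg {g a b q : ℕ} (ha : g ≤ a) (ha' : 20 ≤ a) (hq0 : 0 < q) (hq : q ≤ 2^a) (y : ℕ) :
    Reg 500 q ((GP g a b).filter (fun p => keyc g p = y)) := by
  intro d hd c
  by_cases he : ∃ p ∈ GP g a b, keyc g p = y
  · obtain ⟨p, hp, rfl⟩ := he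
    have h := GP_mem.mp hp
    rw [GP_cell (by omega) hp]
    exact cell_reg h.1 (by omega) (by omega) hq0 (hq.trans (Nat.pow_le_pow_right (by norm_num) h.2.1)) h.2.2.2 hd
  · have : (GP g a b).filter (fun p => keyc g p = y) = ∅ := by
      rw [filter_eq_empty_iff]; intro p hp h; exact he ⟨p, hp, h⟩
    rw [this]; simp

end

section
open Filter Topology Finset
open scoped Classical

noncomputable def blk (k : ℕ) : Finset ℕ := (Ico (16^k) (16^(k+1))).filter Nat.Prime

lemma blk_theta (k : ℕ) (hk : 0 < k) : ∑ p ∈ blk k, Real.log p = Chebyshev.theta ((16^(k+1) : ℕ):ℝ) - Chebyshev.theta ((16^k : ℕ):ℝ) := by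
  have e : ∀ j, 0 < j → Chebyshev.theta ((16^j : ℕ):ℝ) = ∑ p ∈ (range (16^j)).filter Nat.Prime, Real.log p := by
    intro j hj
    rw [Chebyshev.theta_eq_sum_primesLE_log]
    apply Finset.sum_congr _ (fun _ _ => rfl)
    ext p
    rw [Nat.mem_primesLE, mem_filter, mem_range]
    constructor
    · rintro ⟨h1, h2⟩
      refine ⟨lt_of_le_of_ne h1 ?_, h2⟩
      rintro rfl
      have h3 : 2 = 16^j := (Nat.prime_dvd_prime_iff_eq Nat.prime_two h2).mp (dvd_pow (by norm_num) hj.ne')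
      have h4 : 16^1 ≤ 16^j := Nat.pow_le_pow_right (by norm_num) hj
      omega
    · rintro ⟨h1, h2⟩; exact ⟨h1.le, h2⟩
  rw [e _ hk, e _ (Nat.succ_pos k), eq_sub_iff_add_eq]
  rw [← Finset.sum_union]
  · apply Finset.sum_congr _ (fun _ _ => rfl)
    ext p
    have : 16^k ≤ 16^(k+1) := Nat.pow_le_pow_right (by norm_num) (by omega)
    simp only [blk, mem_union, mem_filter, mem_Ico, mem_range]
    constructor
    · rintro (⟨⟨_, h⟩, h'⟩ | ⟨h, h'⟩)
      · exact ⟨h, h'⟩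
      · exact ⟨by omega, h'⟩
    · rintro ⟨h, h'⟩
      by_cases hh : p < 16^k
      · exact Or.inr ⟨hh, h'⟩
      · exact Or.inl ⟨⟨by omega, h⟩, h'⟩
  · rw [Finset.disjoint_left]
    intro p h1 h2
    simp only [blk, mem_filter, mem_Ico, mem_range] at h1 h2
    omega

lemma blk_small : ∃ k0 : ℕ, ∀ k ≥ k0, Real.log ((16:ℝ)^(k+1) + 1) + 2 * √((16:ℝ)^(k+1)) * Real.log ((16:ℝ)^(k+1)) ≤ (16:ℝ)^k / 2 := by
  refine ⟨20, fun k hk => ?_⟩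
  have hl16 : Real.log 16 ≤ 3 := by
    have : (16:ℝ) = 2^4 := by norm_num
    rw [this, Real.log_pow]
    have := Real.log_two_lt_d9
    norm_num; linarith
  have h1 : Real.log ((16:ℝ)^(k+1)) ≤ 3*(k+1) := by
    rw [Real.log_pow]; push_cast; 
    have : (0:ℝ) ≤ k + 1 := by positivity
    nlinarith
  have h2 : Real.log ((16:ℝ)^(k+1) + 1) ≤ 3*(k+2) := by
    calc _ ≤ Real.log ((16:ℝ)^(k+2)) := by
          apply Real.log_le_log (by positivity)
          have : (1:ℝ) ≤ 16^(k+1) := one_le_pow₀ (by norm_num)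
          rw [pow_succ (16:ℝ) (k+1)]; linarith
      _ ≤ _ := by
          rw [Real.log_pow]; push_cast
          have : (0:ℝ) ≤ k + 2 := by positivity
          nlinarith
  have h3 : √((16:ℝ)^(k+1)) = 4^(k+1) := by
    have : (16:ℝ)^(k+1) = (4^(k+1))^2 := by rw [← pow_mul, mul_comm, pow_mul]; norm_num
    rw [this, Real.sqrt_sq (by positivity)]
  rw [h3]
  have h4 : ∀ k : ℕ, 20 ≤ k → 100 * (k+2) ≤ 4^k := by
    intro k hk
    induction k, hk using Nat.le_induction with
    | base => norm_num
    | succ k hk ih => rw [pow_succ]; omega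
  have h5 : (100:ℝ) * (k+2) ≤ 4^k := by exact_mod_cast h4 k hk
  have h6 : (16:ℝ)^k = 4^k * 4^k := by rw [← mul_pow]; norm_num
  have h7 : (1:ℝ) ≤ 4^k := one_le_pow₀ (by norm_num)
  have h8 : 2 * (4:ℝ)^(k+1) * Real.log ((16:ℝ)^(k+1)) ≤ 2 * (4:ℝ)^(k+1) * (3*(k+1)) := by gcongr
  rw [h6]
  have h11 : (4:ℝ)^(k+1) = 4 * 4^k := by ring
  rw [h11] at h8 ⊢
  have h9 : (100:ℝ) * (k+2) * 4^k ≤ 4^k * 4^k := by gcongr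
  have h10 : (k:ℝ) + 2 ≤ (k+2) * 4^k := le_mul_of_one_le_right (by positivity) h7
  nlinarith

lemma blk_card : ∃ k0 : ℕ, ∀ k ≥ k0, (3:ℝ) * 16^k ≤ (k+1) * #(blk k) := by
  obtain ⟨k0, hk0⟩ := blk_small
  refine ⟨k0 + 1, fun k hk => ?_⟩
  have h1 := hk0 k (by omega)
  have h2 := blk_theta k (by omega)
  have h3 := Chebyshev.theta_ge (16^(k+1))
  have h4 := Chebyshev.theta_le_log4_mul_x (x := ((16^k:ℕ):ℝ)) (by positivity)
  have h5 : ∑ p ∈ blk k, Real.log p ≤ #(blk k) * (4 * (k+1) * Real.log 2) := by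
    rw [← nsmul_eq_mul]
    apply Finset.sum_le_card_nsmul
    intro p hp
    simp only [blk, mem_filter, mem_Ico] at hp
    calc Real.log p ≤ Real.log ((16:ℝ)^(k+1)) := by
          apply Real.log_le_log
          · exact_mod_cast hp.2.pos
          · exact_mod_cast hp.1.2.le
      _ = _ := by
          have : (16:ℝ) = 2^4 := by norm_num
          rw [this, ← pow_mul, Real.log_pow]; push_cast; ring
  have hl4 : Real.log 4 = 2 * Real.log 2 := by
    have : (4:ℝ) = 2^2 := by norm_num
    rw [this, Real.log_pow]; norm_num
  rw [hl4] at h4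
  push_cast at h3 h4 h2
  have hl := Real.log_two_gt_d9
  have h6 : (16:ℝ)^(k+1) = 16 * 16^k := by ring
  have hx : (0:ℝ) < 16^k := by positivity
  have h7 : (13:ℝ) * 16^k * Real.log 2 ≤ #(blk k) * (4 * (k+1) * Real.log 2) := by
    refine le_trans ?_ h5
    rw [h2]
    have h8 : (16:ℝ)^k / 2 ≤ 16^k * Real.log 2 := by nlinarith
    have h9 : (16:ℝ)^(k+1) * Real.log 2 = 16 * 16^k * Real.log 2 := by rw [h6]
    nlinarith
  have h8 : (13:ℝ) * 16^k ≤ #(blk k) * (4 * (k+1)) := by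
    by_contra hcon
    rw [not_le] at hcon
    have := mul_lt_mul_of_pos_right hcon (show 0 < Real.log 2 by linarith)
    linarith
  linarith

lemma bad_card {g k : ℕ} (h : g ≤ 4*k) : ((k:ℝ)+1) * #((blk k).filter (fun p => ¬ goodp g p)) ≤ 16^k := by
  set Bd := (blk k).filter (fun p => ¬ goodp g p) with hBd
  have hbk : ∀ p ∈ Bd, bk p = k ∧ p.Prime ∧ ¬ goodp g p := by
    intro p hp
    simp only [hBd, blk, mem_filter, mem_Ico] at hp
    exact ⟨bk_eq hp.1.1.1 hp.1.1.2, hp.1.2, hp.2⟩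
  have hmaps : ∀ p ∈ Bd, p / hc g k ∈ Ico (2^g) (16*2^g) := by
    intro p hp
    simp only [hBd, blk, mem_filter, mem_Ico] at hp
    obtain ⟨⟨⟨h1, h2⟩, -⟩, -⟩ := hp
    rw [mem_Ico, Nat.le_div_iff_mul_le (hc_pos g k)]
    constructor
    · rw [mul_comm, hc_mul h]; exact h1
    · apply Nat.div_lt_of_lt_mul
      rw [pow_succ, ← hc_mul h] at h2
      linarith
  have h1 := card_eq_sum_card_fiberwise hmaps
  have h2 : ∀ j ∈ Ico (2^g) (16*2^g), 15 * (k+1) * #(Bd.filter (fun p => p / hc g k = j)) ≤ hc g k := by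
    intro j _
    by_cases he : ∃ p ∈ Bd, p / hc g k = j
    · obtain ⟨p, hp, hpj⟩ := he
      obtain ⟨e1, e2, e3⟩ := hbk p hp
      unfold goodp at e3
      rw [not_le, e1] at e3
      refine le_trans (Nat.mul_le_mul_left _ (card_le_card ?_)) e3.le
      intro p' hp'
      rw [mem_filter] at hp'
      obtain ⟨f1, f2, f3⟩ := hbk p' hp'.1
      have hk' : keyc g p = keyc g p' := by
        unfold keyc; rw [e1, f1, hpj, hp'.2]
      unfold cellc
      rw [mem_filter, mem_Ico, hk', ← f1]
      exact ⟨⟨keyc_le g p', lt_keyc g p'⟩, f2⟩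
    · have : Bd.filter (fun p => p / hc g k = j) = ∅ := by
        rw [filter_eq_empty_iff]; intro p hp h; exact he ⟨p, hp, h⟩
      rw [this]; simp
  have h3 : 15 * (k+1) * #Bd ≤ 15 * 16^k := by
    rw [h1, Finset.mul_sum]
    refine (Finset.sum_le_sum h2).trans ?_
    rw [sum_const, Nat.card_Ico, smul_eq_mul, ← hc_mul h]
    apply le_of_eq
    have : 16 * 2^g - 2^g = 15 * 2^g := by omega
    rw [this]; ring
  have h4 : (k+1) * #Bd ≤ 16^k := by
    rw [mul_assoc] at h3
    exact Nat.le_of_mul_le_mul_left h3 (by norm_num)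
  exact_mod_cast h4

lemma GP_mass : ∃ k0 : ℕ, ∀ g a b : ℕ, k0 ≤ a → g ≤ a →
    ∑ k ∈ Ico a b, 1 / (8 * ((k:ℝ)+1)) ≤ ∑ p ∈ GP g a b, 1 / (p:ℝ) := by
  obtain ⟨k0, hk0⟩ := blk_card
  refine ⟨k0, fun g a b ha hg => ?_⟩
  have hmaps : ∀ p ∈ GP g a b, bk p ∈ Ico a b := by
    intro p hp
    have := GP_mem.mp hp
    rw [mem_Ico]; exact ⟨this.2.1, this.2.2.1⟩
  rw [← Finset.sum_fiberwise_of_maps_to hmaps]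
  apply Finset.sum_le_sum
  intro k hk
  rw [mem_Ico] at hk
  have hsub : (blk k).filter (fun p => goodp g p) ⊆ (GP g a b).filter (fun p => bk p = k) := by
    intro p hp
    simp only [blk, mem_filter, mem_Ico] at hp
    have := bk_eq hp.1.1.1 hp.1.1.2
    rw [mem_filter, GP_mem]
    exact ⟨⟨hp.1.2, by omega, by omega, hp.2⟩, this⟩
  refine le_trans ?_ (Finset.sum_le_sum_of_subset_of_nonneg hsub (fun _ _ _ => by positivity))
  have h1 := hk0 k (by omega)
  have h2 := bad_card (g := g) (k := k) (by omega)
  have h3 := Finset.card_filter_add_card_filter_not (s := blk k) (fun p => goodp g p)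
  have h3' : (#((blk k).filter (fun p => goodp g p)) : ℝ) + #((blk k).filter (fun p => ¬ goodp g p)) = #(blk k) := by
    exact_mod_cast h3
  set G := (blk k).filter (fun p => goodp g p)
  have h4 : (2:ℝ) * 16^k ≤ (k+1) * #G := by
    rw [← h3', mul_add] at h1; linarith
  have h5 : #G * (1/((16:ℝ)^(k+1))) ≤ ∑ p ∈ G, 1/(p:ℝ) := by
    rw [← nsmul_eq_mul]
    apply Finset.card_nsmul_le_sum
    intro p hp
    simp only [G, blk, mem_filter, mem_Ico] at hp
    apply one_div_le_one_div_of_le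
    · exact_mod_cast hp.1.2.pos
    · exact_mod_cast hp.1.1.2.le
  refine le_trans ?_ h5
  rw [mul_one_div, div_le_div_iff₀ (by positivity) (by positivity)]
  rw [pow_succ]; linarith

lemma dyad_sum (a g : ℕ) (ha : 0 < a) : (g:ℝ)/2 ≤ ∑ k ∈ Ico a (a*2^g), 1 / ((k:ℝ)+1) := by
  induction g with
  | zero => simp
  | succ g ih =>
    have h1 : a ≤ a*2^g := Nat.le_mul_of_pos_right _ (by positivity)
    have h2 : a*2^g ≤ a*2^(g+1) := Nat.mul_le_mul_left _ (Nat.pow_le_pow_right (by norm_num) (by omega))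
    rw [← Finset.sum_Ico_consecutive _ h1 h2]
    have h3 : (1:ℝ)/2 ≤ ∑ k ∈ Ico (a*2^g) (a*2^(g+1)), 1 / ((k:ℝ)+1) := by
      have : #(Ico (a*2^g) (a*2^(g+1))) • (1 / ((a:ℝ)*2^(g+1))) ≤ ∑ k ∈ Ico (a*2^g) (a*2^(g+1)), 1 / ((k:ℝ)+1) := by
        apply Finset.card_nsmul_le_sum
        intro k hk
        rw [mem_Ico] at hk
        apply one_div_le_one_div_of_le (by positivity)
        have : k + 1 ≤ a * 2^(g+1) := hk.2
        exact_mod_cast this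
      refine le_trans (le_of_eq ?_) this
      rw [Nat.card_Ico]
      have e : a*2^(g+1) - a*2^g = a * 2^g := by rw [pow_succ, ← mul_assoc]; omega
      rw [e, nsmul_eq_mul]
      push_cast
      have : (0:ℝ) < a := by exact_mod_cast ha
      field_simp
      rw [pow_succ]; ring
    push_cast; linarith

lemma GP_mass' : ∃ k0 : ℕ, ∀ g a : ℕ, k0 ≤ a → g ≤ a → (g:ℝ)/16 ≤ ∑ p ∈ GP g a (a*2^g), 1 / (p:ℝ) := by
  obtain ⟨k0, h⟩ := GP_mass
  refine ⟨k0+1, fun g a ha hg => ?_⟩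
  refine le_trans ?_ (h g a _ (by omega) hg)
  have := dyad_sum a g (by omega)
  have e : ∑ k ∈ Ico a (a*2^g), 1 / (8 * ((k:ℝ)+1)) = (1/8) * ∑ k ∈ Ico a (a*2^g), 1 / ((k:ℝ)+1) := by
    rw [Finset.mul_sum]; apply Finset.sum_congr rfl; intro k _; field_simp
  rw [e]; linarith

end

section
open Filter Topology Finset
open scoped Classical

lemma sieve_sum {N W : ℕ} {r : ℕ} (hN : 0 < N) (Pi : Finset ℕ) (hprime : ∀ p ∈ Pi, p.Prime)
    (Q : Fin r → Finset ℕ) (hQ : ∀ l, Q l ⊆ Pi) (hdisj : ∀ l l', l ≠ l' → Disjoint (Q l) (Q l'))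
    (hW : ∀ p ∈ Pi, p ≤ W) (hWN : W^r ≤ N) (μ : ℝ) (hμ : 0 < μ) (hmass : ∀ l, μ ≤ ∑ p ∈ Q l, 1/(p:ℝ))
    (E : Finset ℕ) (hE : ∀ m ∈ E, 0 < m ∧ m ≤ N ∧ ∀ p ∈ Pi, ¬ p ∣ m) :
    ∑ m ∈ E, 1/(m:ℝ) ≤ (1 + 2 * Real.log N) / μ^r := by
  rw [le_div_iff₀ (by positivity)]
  have h1 : μ^r ≤ ∏ l, ∑ p ∈ Q l, 1/(p:ℝ) := by
    calc μ^r = ∏ l : Fin r, μ := by simp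
      _ ≤ _ := Finset.prod_le_prod (fun _ _ => hμ.le) (fun l _ => hmass l)
  rw [Finset.prod_univ_sum] at h1
  have h0 : 0 ≤ ∑ m ∈ E, 1/(m:ℝ) := Finset.sum_nonneg (fun _ _ => by positivity)
  refine (mul_le_mul_of_nonneg_left h1 h0).trans ?_
  rw [Finset.sum_mul_sum, ← Finset.sum_product']
  have h2 : ∀ x ∈ E ×ˢ Fintype.piFinset Q, 1/(x.1:ℝ) * ∏ l, 1/(x.2 l : ℝ) = 1/((x.1 * ∏ l, x.2 l : ℕ):ℝ) := by
    intro x _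
    push_cast
    rw [Finset.prod_div_distrib, prod_const_one, div_mul_div_comm, one_mul]
  rw [Finset.sum_congr rfl h2]
  have hinj : Set.InjOn (fun x : ℕ × (Fin r → ℕ) => x.1 * ∏ l, x.2 l) (E ×ˢ Fintype.piFinset Q : Finset (ℕ × (Fin r → ℕ))) := by
    rintro ⟨m, t⟩ hx ⟨m', t'⟩ hx' heq
    rw [mem_coe, mem_product, Fintype.mem_piFinset] at hx hx'
    simp only at hx hx' heq
    have ht : t = t' := by
      funext l
      have hp := hprime _ (hQ l (hx.2 l))
      have hd : t l ∣ m' * ∏ l, t' l := by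
        rw [← heq]
        exact Dvd.dvd.mul_left (Finset.dvd_prod_of_mem t (mem_univ l)) m
      rcases hp.dvd_mul.mp hd with h | h
      · exact absurd h ((hE m' hx'.1).2.2 _ (hQ l (hx.2 l)))
      · obtain ⟨l', _, hl'⟩ := (hp.prime.dvd_finset_prod_iff _).mp h
        have he := (Nat.prime_dvd_prime_iff_eq hp (hprime _ (hQ l' (hx'.2 l')))).mp hl'
        by_cases hll : l = l'
        · rw [← hll] at he; exact he
        · exfalso
          exact Finset.disjoint_left.mp (hdisj l l' hll) (hx.2 l) (he ▸ hx'.2 l')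
    subst ht
    have hpos : 0 < ∏ l, t l := Finset.prod_pos (fun l _ => (hprime _ (hQ l (hx.2 l))).pos)
    have hm : m = m' := Nat.eq_of_mul_eq_mul_right hpos heq
    rw [hm]
  have h3 : ∑ x ∈ E ×ˢ Fintype.piFinset Q, 1/((x.1 * ∏ l, x.2 l : ℕ):ℝ)
      = ∑ n ∈ (E ×ˢ Fintype.piFinset Q).image (fun x : ℕ × (Fin r → ℕ) => x.1 * ∏ l, x.2 l), 1/(n:ℝ) := by
    rw [Finset.sum_image hinj]
  rw [h3]
  have h4 : (E ×ˢ Fintype.piFinset Q).image (fun x : ℕ × (Fin r → ℕ) => x.1 * ∏ l, x.2 l) ⊆ Ioc 0 (N*N) := by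
    intro n hn
    rw [mem_image] at hn
    obtain ⟨⟨m, t⟩, hx, rfl⟩ := hn
    rw [mem_product, Fintype.mem_piFinset] at hx
    simp only at hx ⊢
    rw [mem_Ioc]
    have hpos : 0 < ∏ l, t l := Finset.prod_pos (fun l _ => (hprime _ (hQ l (hx.2 l))).pos)
    refine ⟨Nat.mul_pos (hE m hx.1).1 hpos, Nat.mul_le_mul (hE m hx.1).2.1 ?_⟩
    refine le_trans ?_ hWN
    calc ∏ l, t l ≤ ∏ l : Fin r, W := Finset.prod_le_prod' (fun l _ => hW _ (hQ l (hx.2 l)))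
      _ = W^r := by simp
  refine (Finset.sum_le_sum_of_subset_of_nonneg h4 (fun _ _ _ => by positivity)).trans ?_
  refine (harm_le (N*N)).trans (le_of_eq ?_)
  have : (N:ℝ) ≠ 0 := by exact_mod_cast hN.ne'
  push_cast
  rw [Real.log_mul this this]; ring

lemma sq_sum {N R : ℕ} (hR : 0 < R) (E : Finset ℕ) (hE : ∀ m ∈ E, 0 < m ∧ m ≤ N ∧ ∃ b, R < b ∧ b^2 ∣ m) :
    ∑ m ∈ E, 1/(m:ℝ) ≤ (1 + Real.log N) / R := by
  have hsub : E ⊆ (Ioc R N ×ˢ Ioc 0 N).image (fun x => x.1^2 * x.2) := by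
    intro m hm
    obtain ⟨h1, h2, b, hb, c, hc⟩ := hE m hm
    rw [mem_image]
    have hb0 : 0 < b := by omega
    have hc0 : 0 < c := by
      rcases Nat.eq_zero_or_pos c with h | h
      · rw [h] at hc; omega
      · exact h
    refine ⟨(b, c), ?_, hc.symm⟩
    rw [mem_product, mem_Ioc, mem_Ioc]
    simp only
    have e1 : b ≤ m := by rw [hc]; nlinarith
    have e2 : c ≤ m := by rw [hc]; exact Nat.le_mul_of_pos_left _ (by positivity)
    omega
  refine (Finset.sum_le_sum_of_subset_of_nonneg hsub (fun _ _ _ => by positivity)).trans ?_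
  refine (Finset.sum_image_le_of_nonneg (fun _ _ => by positivity)).trans ?_
  have h1 : ∑ x ∈ Ioc R N ×ˢ Ioc 0 N, 1/((x.1^2*x.2 : ℕ):ℝ) = (∑ b ∈ Ioc R N, 1/(b:ℝ)^2) * ∑ c ∈ Ioc 0 N, 1/(c:ℝ) := by
    rw [Finset.sum_mul_sum, ← Finset.sum_product']
    apply Finset.sum_congr rfl; intro x _
    push_cast; rw [div_mul_div_comm, one_mul]
  rw [h1]
  have h2 := sum_sq_tail R N hR
  have h3 := harm_le N
  have h4 : 0 ≤ ∑ c ∈ Ioc 0 N, 1/(c:ℝ) := Finset.sum_nonneg (fun _ _ => by positivity)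
  calc _ ≤ (1/(R:ℝ)) * (1 + Real.log N) := by
        apply mul_le_mul h2 h3 h4 (by positivity)
    _ = _ := by ring

lemma card_E {N z : ℕ} (E : Finset ℕ) (hE : E ⊆ Ioc 0 (N/z)) : (#E : ℝ) ≤ N/z := by
  have := card_le_card hE
  rw [Nat.card_Ioc] at this
  have h2 : (#E:ℝ) ≤ ((N/z : ℕ):ℝ) := by exact_mod_cast this
  exact h2.trans Nat.cast_div_le

lemma bad_gen {q z0 N : ℕ} (hq : 0 < q) (hz : 2 ≤ z0) (a : ℤ) (E : Finset ℕ) (hE : E ⊆ Ioc 0 (N/z0^8))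
    (S : Finset ℕ) (hS : ∀ n ∈ S, n ≤ N ∧ A n ≡ a [ZMOD (q:ℤ)] ∧ ∃ m ∈ E, ∃ p : ℕ, p.Prime ∧ z0^8 < p ∧ n = m * p) :
    (#S : ℝ) ≤ 2 * LL q * N / (q * Real.log z0) * ∑ m ∈ E, 1/(m:ℝ) + N/(z0:ℝ)^4 := by
  have hzz : z0 ≤ z0^8 := Nat.le_self_pow (by norm_num) z0
  have hz0 : (0:ℝ) < z0 := by exact_mod_cast (by omega : 0 < z0)
  have hlog : 0 < Real.log z0 := Real.log_pos (by exact_mod_cast (by omega : 1 < z0))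
  have hLL := one_le_LL hq
  have hEpos : ∀ m ∈ E, 0 < m := fun m hm => (mem_Ioc.mp (hE hm)).1
  have h := bad_bt q z0 hq hz a E hEpos (fun _ => 0) (fun m => N/m) S (by
    intro n hn
    obtain ⟨h0, h1, m, hm, p, hp, hzp, h2⟩ := hS n hn
    refine ⟨h1, m, hm, p, hp, by omega, hp.pos, ?_, h2⟩
    rw [zero_add, Nat.le_div_iff_mul_le (hEpos m hm), mul_comm, ← h2]; exact h0)
  refine h.trans ?_
  rw [Finset.sum_add_distrib]
  apply add_le_add
  · rw [Finset.mul_sum]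
    apply Finset.sum_le_sum; intro m hm
    have : ((N/m : ℕ):ℝ) ≤ N * (1/(m:ℝ)) := by rw [mul_one_div]; exact Nat.cast_div_le
    calc _ ≤ 2 * LL q * (N * (1/(m:ℝ))) / (q * Real.log z0) := by gcongr
      _ = _ := by ring
  · rw [sum_const, nsmul_eq_mul]
    have := card_E E hE
    push_cast at this
    calc _ ≤ (N/(z0:ℝ)^8) * (z0:ℝ)^4 := by gcongr
      _ = _ := by field_simp

lemma bad_short {q z0 N : ℕ} (hq : 0 < q) (hz : 2 ≤ z0) (a : ℤ) (ρ δ : ℝ) (hρ : 1 ≤ ρ) (hδ : 1 - 1/ρ ≤ δ)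
    (S : Finset ℕ) (hS : ∀ n ∈ S, n ≤ N ∧ A n ≡ a [ZMOD (q:ℤ)] ∧ (N:ℝ) < n * ρ ∧ ∃ m ∈ Ioc 0 (N/z0^8), ∃ p : ℕ, p.Prime ∧ z0^8 < p ∧ n = m * p) :
    (#S : ℝ) ≤ 2 * LL q * N / (q * Real.log z0) * (δ * (1 + Real.log N) + 1/(z0:ℝ)^8) + N/(z0:ℝ)^4 := by
  have hzz : z0 ≤ z0^8 := Nat.le_self_pow (by norm_num) z0
  have hz0 : (0:ℝ) < z0 := by exact_mod_cast (by omega : 0 < z0)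
  have hlog : 0 < Real.log z0 := Real.log_pos (by exact_mod_cast (by omega : 1 < z0))
  have hLL := one_le_LL hq
  have hρ0 : 0 < ρ := by linarith
  have hδ0 : 0 ≤ δ := le_trans (by rw [sub_nonneg, div_le_one hρ0]; exact hρ) hδ
  set E := Ioc 0 (N/z0^8) with hEdef
  have hEpos : ∀ m ∈ E, 0 < m := fun m hm => (mem_Ioc.mp hm).1
  set u : ℕ → ℕ := fun m => ⌊(N:ℝ)/(m*ρ)⌋₊ with hu
  have hule : ∀ m ∈ E, u m ≤ N/m := by
    intro m hm
    have hm0 : (0:ℝ) < m := by exact_mod_cast hEpos m hm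
    rw [← Nat.floor_div_eq_div (K := ℝ)]
    apply Nat.floor_mono
    gcongr
    exact le_mul_of_one_le_right hm0.le hρ
  have h := bad_bt q z0 hq hz a E hEpos u (fun m => N/m - u m) S (by
    intro n hn
    obtain ⟨h0, h1, h3, m, hm, p, hp, hzp, h2⟩ := hS n hn
    have hm0 : (0:ℝ) < m := by exact_mod_cast hEpos m hm
    refine ⟨h1, m, hm, p, hp, by omega, ?_, ?_, h2⟩
    · rw [hu]; simp only
      rw [Nat.floor_lt (by positivity), div_lt_iff₀ (by positivity)]
      rw [h2] at h3; push_cast at h3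
      linarith
    · have := hule m hm
      have e : u m + (N/m - u m) = N/m := by omega
      rw [e, Nat.le_div_iff_mul_le (hEpos m hm), mul_comm, ← h2]; exact h0)
  refine h.trans ?_
  rw [Finset.sum_add_distrib]
  have hcE := card_E E subset_rfl
  push_cast at hcE
  apply add_le_add
  · calc _ ≤ ∑ m ∈ E, 2 * LL q / (q * Real.log z0) * (N * δ * (1/(m:ℝ)) + 1) := by
          apply Finset.sum_le_sum; intro m hm
          have hm0 : (0:ℝ) < m := by exact_mod_cast hEpos m hm
          have e1 : ((N/m - u m : ℕ):ℝ) ≤ N * δ * (1/(m:ℝ)) + 1 := by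
            rw [Nat.cast_sub (hule m hm)]
            have e2 : ((N/m : ℕ):ℝ) ≤ N * (1/(m:ℝ)) := by rw [mul_one_div]; exact Nat.cast_div_le
            have e3 : (N:ℝ)/(m*ρ) < u m + 1 := Nat.lt_floor_add_one _
            have e4 : (N:ℝ)/(m*ρ) = N * (1/(m:ℝ)) * (1/ρ) := by field_simp
            have e5 : N * (1/(m:ℝ)) * (1 - 1/ρ) ≤ N * (1/(m:ℝ)) * δ := by gcongr
            nlinarith
          calc _ ≤ 2 * LL q * (N * δ * (1/(m:ℝ)) + 1) / (q * Real.log z0) := by gcongr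
            _ = _ := by ring
      _ = 2 * LL q / (q * Real.log z0) * (N * δ * ∑ m ∈ E, 1/(m:ℝ) + #E) := by
          rw [← Finset.mul_sum, Finset.sum_add_distrib, ← Finset.mul_sum]; simp
      _ ≤ 2 * LL q / (q * Real.log z0) * (N * δ * (1 + Real.log N) + N/(z0:ℝ)^8) := by
          gcongr
          refine le_trans ?_ (harm_le N)
          apply Finset.sum_le_sum_of_subset_of_nonneg _ (fun _ _ _ => by positivity)
          exact Ioc_subset_Ioc_right (Nat.div_le_self _ _)
      _ = _ := by ring
  · rw [sum_const, nsmul_eq_mul]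
    calc _ ≤ (N/(z0:ℝ)^8) * (z0:ℝ)^4 := by gcongr
      _ = _ := by field_simp

end

section
open Filter Topology Finset
open scoped Classical

theorem bad_total {q z0 N J G R R0 : ℕ} (hq : 0 < q) (hz : 2 ≤ z0) (hN : 0 < N) (a : ℤ)
    (hlog1 : 1 ≤ Real.log z0) (B : ℝ) (hB : 1 + 2 * Real.log N ≤ B * Real.log z0)
    (hG : (z0^8)^(4*G) ≤ N) (hR : 0 < R) (hRN : R^8 ≤ N) (hz8 : z0^8 ≤ N) (hR0 : 0 < R0)
    (P : Fin J → Finset ℕ) (hprime : ∀ i, ∀ p ∈ P i, p.Prime)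
    (hlo : ∀ i, ∀ p ∈ P i, R0 < p) (hhi : ∀ i, ∀ p ∈ P i, p ≤ z0)
    (μ : ℝ) (hμ : 0 < μ)
    (hQ : ∀ i, ∃ Q : Fin 7 → Finset ℕ, (∀ l, Q l ⊆ P i) ∧ (∀ l l', l ≠ l' → Disjoint (Q l) (Q l')) ∧
      ∀ l, μ ≤ ∑ p ∈ Q l, 1/(p:ℝ))
    (ρ δ : ℝ) (hρ : 1 ≤ ρ) (hδ : 1 - 1/ρ ≤ δ) :
    (#((Ioc 0 N).filter (fun n => A n ≡ a [ZMOD (q:ℤ)] ∧ badP P ρ N n)) : ℝ) ≤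
      N * (2/R + (1 + Real.log N)/2^G + (J+2)/(z0:ℝ)^4)
      + (2 * LL q * N / q) * (B * δ + 1/(z0:ℝ)^8 + J * (B/μ^7) + B/R0) := by
  have hLL := one_le_LL hq
  have hz0 : (0:ℝ) < z0 := by exact_mod_cast (by omega : 0 < z0)
  have hq0 : (0:ℝ) < q := by exact_mod_cast hq
  have hlN : 0 ≤ Real.log N := Real.log_natCast_nonneg N
  have hδ0 : 0 ≤ δ := le_trans (by rw [sub_nonneg, div_le_one (by linarith)]; exact hρ) hδ
  have hzz : z0 ≤ z0^8 := Nat.le_self_pow (by norm_num) z0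
  set NS : ℕ → Prop := fun n => ∃ m ∈ Ioc 0 (N/z0^8), ∃ p : ℕ, p.Prime ∧ z0^8 < p ∧ n = m * p with hNS
  set S0 := (Ioc 0 N).filter (fun n => ∀ p, p.Prime → p ∣ n → p ≤ z0^8) with hS0
  set S1 := (Ioc 0 N).filter (fun n => A n ≡ a [ZMOD (q:ℤ)] ∧ (N:ℝ) < n * ρ ∧ NS n) with hS1
  set S2 : Fin J → Finset ℕ := fun i => (Ioc 0 N).filter (fun n => A n ≡ a [ZMOD (q:ℤ)] ∧ (∀ p ∈ P i, ¬ p ∣ n) ∧ NS n) with hS2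
  set S3 := (Ioc 0 N).filter (fun n => A n ≡ a [ZMOD (q:ℤ)] ∧ (∃ i, ∃ p ∈ P i, p^2 ∣ n) ∧ NS n) with hS3
  have hsub : (Ioc 0 N).filter (fun n => A n ≡ a [ZMOD (q:ℤ)] ∧ badP P ρ N n) ⊆ S0 ∪ (S1 ∪ (univ.biUnion S2 ∪ S3)) := by
    intro n hn
    rw [mem_filter, mem_Ioc] at hn
    obtain ⟨hn, hA, hbad⟩ := hn
    by_cases hs : ∀ p, p.Prime → p ∣ n → p ≤ z0^8
    · exact mem_union_left _ (by rw [hS0, mem_filter, mem_Ioc]; exact ⟨hn, hs⟩)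
    · apply mem_union_right
      have hns : NS n := by
        simp only [not_forall, not_le] at hs
        obtain ⟨p, hp, ⟨m, hm⟩, hzp⟩ := hs
        have hm0 : 0 < m := by
          rcases Nat.eq_zero_or_pos m with h | h
          · rw [h] at hm; omega
          · exact h
        refine ⟨m, ?_, p, hp, hzp, by rw [hm, mul_comm]⟩
        rw [mem_Ioc]
        refine ⟨hm0, ?_⟩
        rw [Nat.le_div_iff_mul_le (by positivity)]
        calc m * z0^8 ≤ m * p := Nat.mul_le_mul_left _ hzp.le
          _ = n := by rw [hm, mul_comm]
          _ ≤ N := hn.2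
      rcases hbad with h | ⟨i, h⟩ | h
      · exact mem_union_left _ (by rw [hS1, mem_filter, mem_Ioc]; exact ⟨hn, hA, h, hns⟩)
      · apply mem_union_right; apply mem_union_left
        rw [mem_biUnion]
        exact ⟨i, mem_univ i, by rw [hS2, mem_filter, mem_Ioc]; exact ⟨hn, hA, h, hns⟩⟩
      · apply mem_union_right; apply mem_union_right
        rw [hS3, mem_filter, mem_Ioc]; exact ⟨hn, hA, h, hns⟩
  have hcard : (#((Ioc 0 N).filter (fun n => A n ≡ a [ZMOD (q:ℤ)] ∧ badP P ρ N n)) : ℝ) ≤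
      #S0 + (#S1 + (∑ i, (#(S2 i):ℝ) + #S3)) := by
    have := (card_le_card hsub).trans ((card_union_le _ _).trans (Nat.add_le_add_left
      ((card_union_le _ _).trans (Nat.add_le_add_left ((card_union_le _ _).trans
        (Nat.add_le_add_right card_biUnion_le _)) _)) _))
    exact_mod_cast this
  have h0 := smooth_count N (z0^8) G R hN hG hR hRN
  have h1 := bad_short hq hz a ρ δ hρ hδ S1 (by
    intro n hn
    rw [hS1, mem_filter, mem_Ioc] at hn
    exact ⟨hn.1.2, hn.2.1, hn.2.2.1, hn.2.2.2⟩)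
  set c := 2 * LL q * N / q with hc
  have hc0 : 0 ≤ c := by positivity
  have hcl : 2 * LL q * N / (q * Real.log z0) = c / Real.log z0 := by rw [hc]; field_simp
  rw [hcl] at h1
  have hgap : ∀ X Y : ℝ, X ≤ Y * Real.log z0 → c / Real.log z0 * X ≤ c * Y := by
    intro X Y h
    rw [div_mul_eq_mul_div, div_le_iff₀ (by linarith), mul_assoc]
    gcongr
  have h1' : (#S1:ℝ) ≤ c * (B * δ + 1/(z0:ℝ)^8) + N/(z0:ℝ)^4 := by
    refine h1.trans (add_le_add_left (hgap _ _ ?_) _)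
    have e1 : δ * (1 + Real.log N) ≤ δ * (B * Real.log z0) := by
      gcongr; linarith
    have e2 : 1/(z0:ℝ)^8 ≤ 1/(z0:ℝ)^8 * Real.log z0 := le_mul_of_one_le_right (by positivity) hlog1
    nlinarith
  have h2 : ∀ i, (#(S2 i):ℝ) ≤ c * (B/μ^7) + N/(z0:ℝ)^4 := by
    intro i
    set E := (Ioc 0 (N/z0^8)).filter (fun m => ∀ p ∈ P i, ¬ p ∣ m) with hE
    have e := bad_gen (N := N) hq hz a E (filter_subset _ _) (S2 i) (by
      intro n hn
      rw [hS2, mem_filter, mem_Ioc] at hn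
      obtain ⟨hn, hA, h, m, hm, p, hp, hzp, he⟩ := hn
      refine ⟨hn.2, hA, m, ?_, p, hp, hzp, he⟩
      rw [hE, mem_filter]
      exact ⟨hm, fun p hp hd => h p hp (he ▸ hd.mul_right _)⟩)
    rw [hcl] at e
    refine e.trans (add_le_add_left (hgap _ _ ?_) _)
    obtain ⟨Q, hQ1, hQ2, hQ3⟩ := hQ i
    have e2 := sieve_sum (N := N) (W := z0) hN (P i) (hprime i) Q hQ1 hQ2 (hhi i)
      (le_trans (Nat.pow_le_pow_right (by omega) (by norm_num)) hz8) μ hμ hQ3 E (by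
        intro m hm
        rw [hE, mem_filter, mem_Ioc] at hm
        exact ⟨hm.1.1, hm.1.2.trans (Nat.div_le_self _ _), hm.2⟩)
    refine e2.trans ?_
    rw [div_mul_eq_mul_div]
    gcongr
  have h3 : (#S3:ℝ) ≤ c * (B/R0) + N/(z0:ℝ)^4 := by
    set E := (Ioc 0 (N/z0^8)).filter (fun m => ∃ b, R0 < b ∧ b^2 ∣ m) with hE
    have e := bad_gen (N := N) hq hz a E (filter_subset _ _) S3 (by
      intro n hn
      rw [hS3, mem_filter, mem_Ioc] at hn
      obtain ⟨hn, hA, ⟨i, b, hb, hbn⟩, m, hm, p, hp, hzp, he⟩ := hn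
      refine ⟨hn.2, hA, m, ?_, p, hp, hzp, he⟩
      rw [hE, mem_filter]
      refine ⟨hm, b, hlo i b hb, ?_⟩
      rw [he] at hbn
      refine Nat.Coprime.dvd_of_dvd_mul_right ?_ hbn
      apply Nat.Coprime.pow_left
      rw [Nat.coprime_primes (hprime i b hb) hp]
      have := hhi i b hb
      omega)
    rw [hcl] at e
    refine e.trans (add_le_add_left (hgap _ _ ?_) _)
    have e2 := sq_sum (N := N) hR0 E (by
        intro m hm
        rw [hE, mem_filter, mem_Ioc] at hm
        exact ⟨hm.1.1, hm.1.2.trans (Nat.div_le_self _ _), hm.2⟩)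
    refine e2.trans ?_
    rw [div_mul_eq_mul_div]
    gcongr
    linarith
  have h2s : ∑ i, (#(S2 i):ℝ) ≤ J * (c * (B/μ^7) + N/(z0:ℝ)^4) := by
    refine (Finset.sum_le_sum (fun i _ => h2 i)).trans (le_of_eq ?_)
    simp only [sum_const, card_univ, Fintype.card_fin, nsmul_eq_mul]
  refine hcard.trans ?_
  have e0 : N * (2/R + (1 + Real.log N)/2^G + (J+2)/(z0:ℝ)^4) = 2 * ((N:ℝ)/R) + N * (1 + Real.log N)/2^G + (J+2) * (N/(z0:ℝ)^4) := by ring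
  rw [e0]
  linarith

end

section
open Filter Topology Finset
open scoped Classical

noncomputable def win (g i : ℕ) : Finset ℕ := GP g (2^(8*g^2+7*g*i)) (2^(8*g^2+7*g*i+7*g))

lemma GP_disj {g a b a' b' : ℕ} (h : b ≤ a') : Disjoint (GP g a b) (GP g a' b') := by
  rw [Finset.disjoint_left]
  intro p h1 h2
  have e1 := GP_mem.mp h1
  have e2 := GP_mem.mp h2
  omega

lemma GP_sub {g a b a' b' : ℕ} (h : a' ≤ a) (h' : b ≤ b') : GP g a b ⊆ GP g a' b' := by
  intro p hp
  have e1 := GP_mem.mp hp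
  exact GP_mem.mpr ⟨e1.1, by omega, by omega, e1.2.2.2⟩

lemma p2mono {a b : ℕ} (h : a ≤ b) : 2^a ≤ 2^b := Nat.pow_le_pow_right (by norm_num) h

lemma win_disj {g i j : ℕ} (h : i ≠ j) : Disjoint (win g i) (win g j) := by
  have key : ∀ i j, i < j → Disjoint (win g i) (win g j) := by
    intro i j hij
    apply GP_disj
    apply p2mono
    have : 7*g*(i+1) ≤ 7*g*j := Nat.mul_le_mul_left _ hij
    rw [mul_add, mul_one] at this
    omega
  rcases lt_or_gt_of_ne h with h | h
  · exact key i j h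
  · exact (key j i h).symm

lemma win_lo {g i : ℕ} (hg : 1 ≤ g) : g ≤ 2^(8*g^2+7*g*i) := by
  calc g ≤ 2^g := Nat.lt_two_pow_self.le
    _ ≤ _ := p2mono (by nlinarith [Nat.zero_le (g*i)])

lemma win_hi {g i p : ℕ} (hi : i < g) (hp : p ∈ win g i) : p < 16^(2^(15*g^2)) := by
  have e := GP_mem.mp hp
  refine (lt_of_bk p).trans_le (Nat.pow_le_pow_right (by norm_num) ?_)
  refine le_trans (Nat.succ_le_of_lt e.2.2.1) (p2mono ?_)
  have : 7*g*(i+1) ≤ 7*g*g := Nat.mul_le_mul_left _ hi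
  nlinarith

lemma win_gt {g i p : ℕ} (hg : 1 ≤ g) (hp : p ∈ win g i) : 2^g < p := by
  have e := GP_mem.mp hp
  have h1 := le_of_bk e.1.pos
  have h2 := (win_lo (i := i) hg).trans e.2.1
  have h3 : 2^g < 16^g := Nat.pow_lt_pow_left (by norm_num) (by omega)
  have h4 : 16^g ≤ 16^(bk p) := Nat.pow_le_pow_right (by norm_num) h2
  omega

lemma win_sub {g i k0 : ℕ} (hg : 1 ≤ g) (hk : k0 ≤ g)
    (hm : ∀ g a : ℕ, k0 ≤ a → g ≤ a → (g:ℝ)/16 ≤ ∑ p ∈ GP g a (a*2^g), 1 / (p:ℝ)) :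
    ∃ Q : Fin 7 → Finset ℕ, (∀ l, Q l ⊆ win g i) ∧ (∀ l l', l ≠ l' → Disjoint (Q l) (Q l')) ∧
      ∀ l, (g:ℝ)/16 ≤ ∑ p ∈ Q l, 1/(p:ℝ) := by
  refine ⟨fun l => GP g (2^(8*g^2+7*g*i+g*l)) (2^(8*g^2+7*g*i+g*l) * 2^g), ?_, ?_, ?_⟩
  · intro l
    apply GP_sub
    · exact p2mono (by omega)
    · rw [← pow_add]
      apply p2mono
      have : g * (l+1) ≤ g*7 := Nat.mul_le_mul_left _ l.2
      rw [mul_add] at this; omega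
  · have key : ∀ l l' : Fin 7, l < l' → Disjoint (GP g (2^(8*g^2+7*g*i+g*l)) (2^(8*g^2+7*g*i+g*l) * 2^g)) (GP g (2^(8*g^2+7*g*i+g*l')) (2^(8*g^2+7*g*i+g*l') * 2^g)) := by
      intro l l' hl
      apply GP_disj
      rw [← pow_add]
      apply p2mono
      have : g * ((l:ℕ)+1) ≤ g*l' := Nat.mul_le_mul_left _ hl
      rw [mul_add] at this; omega
    intro l l' h
    rcases lt_or_gt_of_ne h with h | h
    · exact key l l' h
    · exact (key l' l h).symm
  · intro l
    have : g ≤ 2^(8*g^2+7*g*i+g*l) := (win_lo (i := i) hg).trans (p2mono (by omega))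
    exact hm g _ (by omega) this

lemma rho_bound (g : ℕ) : 1 - 1/((1+1/2^g : ℝ)^g) ≤ (g:ℝ)/2^g := by
  have hD : (0:ℝ) < 2^g := by positivity
  have h1 := one_add_mul_le_pow (a := -(1/((2:ℝ)^g+1))) (by
    have : 1/((2:ℝ)^g+1) ≤ 1 := by rw [div_le_one (by positivity)]; linarith
    linarith) g
  have h2 : 1/((1+1/2^g : ℝ)^g) = (1 + -(1/((2:ℝ)^g+1)))^g := by
    rw [← one_div_pow]; congr 1; field_simp; ring
  rw [h2]
  have h3 : (g:ℝ) * (1/((2:ℝ)^g+1)) ≤ g/2^g := by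
    rw [mul_one_div]; gcongr; linarith
  linarith

theorem bad_bound {k0 : ℕ} (hm : ∀ g a : ℕ, k0 ≤ a → g ≤ a → (g:ℝ)/16 ≤ ∑ p ∈ GP g a (a*2^g), 1 / (p:ℝ))
    {g N z0 q T : ℕ} (hg : 1 ≤ g) (hk : k0 ≤ g) (h7 : g^7 ≤ 2^g) (hq : 0 < q) (hN : 0 < N)
    (hz0N : z0^(8*g^4) ≤ N) (hz0 : 16^(2^(15*g^2)) ≤ z0) (hB : 1 + 2 * Real.log N ≤ 64 * (g:ℝ)^4 * Real.log z0)
    (hT : g*(g+5)*2^T ≤ 2^(g^4/4)) (hqT : q * (1 + Real.log N) ≤ 2^T) (hLL : LL q ≤ g) (a : ℤ) :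
    (#((Ioc 0 N).filter (fun n => A n ≡ a [ZMOD (q:ℤ)] ∧ badP (fun i : Fin g => win g i) ((1+1/2^g : ℝ)^g) N n)) : ℝ) ≤
      N/q * (129*16^7/g) := by
  have hLL1 := one_le_LL hq
  have hg0 : (0:ℝ) < g := by exact_mod_cast hg
  have hq0 : (0:ℝ) < q := by exact_mod_cast hq
  have h16 : 16 ≤ z0 := by
    refine le_trans ?_ hz0
    calc 16 = 16^1 := by norm_num
      _ ≤ _ := Nat.pow_le_pow_right (by norm_num) (Nat.one_le_two_pow)
  have hlog1 : 1 ≤ Real.log z0 := by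
    rw [Real.le_log_iff_exp_le (by exact_mod_cast (by omega : 0 < z0))]
    have := Real.exp_one_lt_d9
    have h : (16:ℝ) ≤ z0 := by exact_mod_cast h16
    linarith
  have hg4 : 1 ≤ g^4 := Nat.one_le_pow _ _ hg
  have hz8 : z0^8 ≤ N := le_trans (Nat.pow_le_pow_right (by omega) (by omega)) hz0N
  have hb := bad_total (N := N) (J := g) (G := g^4/4) (R := z0) (R0 := 2^g) hq (by omega) hN a hlog1 (64 * (g:ℝ)^4) hB
    (by
      refine le_trans ?_ hz0N
      rw [← pow_mul]
      exact Nat.pow_le_pow_right (by omega) (by omega)) (by omega) hz8 hz8 (by positivity)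
    (fun i : Fin g => win g i) (fun i p hp => (GP_mem.mp hp).1) (fun i p hp => win_gt hg hp)
    (fun i p hp => (win_hi i.2 hp).le.trans hz0) (g/16) (by positivity) (fun i => win_sub hg hk hm)
    ((1+1/2^g : ℝ)^g) (g/2^g) (one_le_pow₀ (by
      have : (0:ℝ) < 1/2^g := by positivity
      linarith)) (rho_bound g)
  refine hb.trans ?_
  -- z0 ≥ 2^(g^4/4)
  have hzG : 2^(g^4/4) ≤ z0 := by
    refine le_trans ?_ hz0
    calc 2^(g^4/4) ≤ 2^(2^(15*g^2)) := by
          apply p2mono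
          have e1 : g^4 ≤ (2^g)^4 := Nat.pow_le_pow_left Nat.lt_two_pow_self.le 4
          have e2 : (2^g)^4 ≤ 2^(15*g^2) := by
            rw [← pow_mul]; apply p2mono; nlinarith
          omega
      _ ≤ _ := Nat.pow_le_pow_left (by norm_num) _
  set X : ℝ := 2^(g^4/4) with hX
  have hX0 : 0 < X := by positivity
  have hzX : X ≤ z0 := by rw [hX]; exact_mod_cast hzG
  have hzpos : (0:ℝ) < z0 := lt_of_lt_of_le hX0 hzX
  have hz1 : (1:ℝ) ≤ z0 := by exact_mod_cast (by omega : 1 ≤ z0)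
  have hlN : 0 ≤ Real.log N := Real.log_natCast_nonneg N
  have hTr : (g:ℝ)*(g+5)*2^T ≤ X := by rw [hX]; exact_mod_cast hT
  have hqT' : (q:ℝ) ≤ 2^T := le_trans (le_mul_of_one_le_right hq0.le (by linarith)) hqT
  -- first part
  have p1 : q * (2/(z0:ℝ) + (1 + Real.log N)/X + ((g:ℝ)+2)/(z0:ℝ)^4) ≤ 1/g := by
    have e1 : 2/(z0:ℝ) ≤ 2/X := by gcongr
    have e2 : ((g:ℝ)+2)/(z0:ℝ)^4 ≤ (g+2)/X := by
      gcongr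
      exact hzX.trans (le_self_pow₀ hz1 (by norm_num))
    calc _ ≤ q * (2/X + (1 + Real.log N)/X + (g+2)/X) := by gcongr
      _ = (q * (1 + Real.log N) + q * (g+4))/X := by ring
      _ ≤ (2^T + 2^T * (g+4))/X := by gcongr
      _ = (2^T * (g+5))/X := by ring
      _ ≤ 1/g := by
          rw [div_le_div_iff₀ hX0 hg0]; linarith
  have h7r : (g:ℝ)^7 ≤ 2^g := by exact_mod_cast h7
  have hD : (0:ℝ) < 2^g := by positivity
  have hg1 : (1:ℝ) ≤ g := by exact_mod_cast hg
  have q1 : g * (64 * (g:ℝ)^4 * (g/2^g)) ≤ 64/g := by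
    have : g * (64 * (g:ℝ)^4 * (g/2^g)) = 64 * g^6 / 2^g := by ring
    rw [this, div_le_div_iff₀ hD hg0]; nlinarith
  have q4 : g * (64 * (g:ℝ)^4 / ((2^g : ℕ):ℝ)) ≤ 64/g := by
    push_cast
    have : g * (64 * (g:ℝ)^4 / 2^g) = 64 * g^5 / 2^g := by ring
    rw [this, div_le_div_iff₀ hD hg0]
    have : (g:ℝ)^6 ≤ g^7 := pow_le_pow_right₀ hg1 (by norm_num)
    nlinarith
  have q2 : g * (1/(z0:ℝ)^8) ≤ 1/g := by
    rw [mul_one_div, div_le_div_iff₀ (by positivity) hg0]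
    have e1 : (z0:ℝ) ≤ z0^8 := le_self_pow₀ hz1 (by norm_num)
    have e2 : (1:ℝ) ≤ 2^T := one_le_pow₀ (by norm_num)
    have e3 : (g:ℝ)*(g+5) * 1 ≤ (g:ℝ)*(g+5)*2^T := by gcongr
    nlinarith
  have q3 : g * (g * (64 * (g:ℝ)^4/(g/16)^7)) = 64*16^7/g := by
    field_simp
  have p2 : 2 * LL q * (64 * (g:ℝ)^4 * (g/2^g) + 1/(z0:ℝ)^8 + g * (64 * (g:ℝ)^4/(g/16)^7) + 64 * (g:ℝ)^4/((2^g:ℕ):ℝ)) ≤ 2*(64+1+64*16^7+64)/g := by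
    calc _ ≤ 2 * g * (64 * (g:ℝ)^4 * (g/2^g) + 1/(z0:ℝ)^8 + g * (64 * (g:ℝ)^4/(g/16)^7) + 64 * (g:ℝ)^4/((2^g:ℕ):ℝ)) := by gcongr
      _ = 2 * (g * (64 * (g:ℝ)^4 * (g/2^g)) + g*(1/(z0:ℝ)^8) + g * (g * (64 * (g:ℝ)^4/(g/16)^7)) + g*(64 * (g:ℝ)^4/((2^g:ℕ):ℝ))) := by ring
      _ ≤ 2 * (64/g + 1/g + 64*16^7/g + 64/g) := by rw [q3]; gcongr
      _ = _ := by ring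
  have hNq : (N:ℝ) * (2/(z0:ℝ) + (1 + Real.log N)/X + ((g:ℝ)+2)/(z0:ℝ)^4) = N/q * (q * (2/(z0:ℝ) + (1 + Real.log N)/X + ((g:ℝ)+2)/(z0:ℝ)^4)) := by
    field_simp
  have hNq2 : ∀ Y : ℝ, 2 * LL q * N / q * Y = N/q * (2 * LL q * Y) := by intro Y; ring
  rw [hNq, hNq2, ← mul_add]
  gcongr
  refine (add_le_add p1 p2).trans ?_
  rw [← add_div]
  gcongr
  norm_num

end

section
open Filter Topology Finset
open scoped Classical

lemma decay {J g : ℕ} (hg : g = J + 2) (hg4 : 4 ≤ g) {lam : ℝ} (h1 : 1 ≤ lam) (h4 : lam^4 ≤ g) :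
    500 * lam * (1 - 1 / (2 * (4 * 500 * lam + 1)^2))^J ≤ (500*24*256*2001^8)/g := by
  set x : ℝ := 1 / (2 * (4 * 500 * lam + 1)^2) with hx
  have hg0 : (0:ℝ) < g := by exact_mod_cast (by omega : 0 < g)
  have hxlo : 1/(2*2001^2*lam^2) ≤ x := by
    rw [hx]
    apply one_div_le_one_div_of_le (by positivity)
    have : 4 * 500 * lam + 1 ≤ 2001*lam := by linarith
    calc 2 * (4 * 500 * lam + 1)^2 ≤ 2 * (2001*lam)^2 := by gcongr
      _ = _ := by ring
  have hx0 : 0 < x := by rw [hx]; positivity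
  have hx1 : x ≤ 1 := by
    rw [hx, div_le_one (by positivity)]
    nlinarith
  have hJ : (g:ℝ)/2 ≤ J := by
    have : g ≤ 2*J := by omega
    have : (g:ℝ) ≤ 2*J := by exact_mod_cast this
    linarith
  have e1 : (1-x)^J ≤ Real.exp (-(J*x)) := by
    have : 1 - x ≤ Real.exp (-x) := by linarith [Real.add_one_le_exp (-x)]
    calc (1-x)^J ≤ (Real.exp (-x))^J := by
          apply pow_le_pow_left₀ (by linarith) this
      _ = _ := by rw [← Real.exp_nat_mul]; congr 1; ring
  have e2 : (J*x)^4/24 ≤ Real.exp (J*x) := by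
    have := Real.pow_div_factorial_le_exp (J*x) (by positivity) 4
    simpa [Nat.factorial] using this
  have e3 : (g:ℝ)^2/(256*2001^8) ≤ (J*x)^4 := by
    have f1 : (g:ℝ)/2 * (1/(2*2001^2*lam^2)) ≤ J*x := by gcongr
    have f2 : ((g:ℝ)/2 * (1/(2*2001^2*lam^2)))^4 ≤ (J*x)^4 := by gcongr
    refine le_trans ?_ f2
    have f3 : ((g:ℝ)/2 * (1/(2*2001^2*lam^2)))^4 = g^4/(256*2001^8*(lam^4)^2) := by
      field_simp; norm_num
    rw [f3]
    have f4 : (lam^4)^2 ≤ (g:ℝ)^2 := by gcongr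
    calc (g:ℝ)^2/(256*2001^8) = g^4/(256*2001^8*(g:ℝ)^2) := by field_simp
      _ ≤ _ := by gcongr
  have e4 : (g:ℝ)^2/(24*256*2001^8) ≤ Real.exp (J*x) := by
    refine le_trans ?_ e2
    calc (g:ℝ)^2/(24*256*2001^8) = (g:ℝ)^2/(256*2001^8)/24 := by field_simp
      _ ≤ _ := by gcongr
  have e5 : Real.exp (-(J*x)) ≤ (24*256*2001^8)/(g:ℝ)^2 := by
    rw [Real.exp_neg, inv_le_comm₀ (Real.exp_pos _) (by positivity), inv_div]
    exact e4
  have e6 : lam ≤ g := le_trans (le_self_pow₀ h1 (by norm_num)) h4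
  calc 500 * lam * (1-x)^J ≤ 500 * g * ((24*256*2001^8)/(g:ℝ)^2) := by
        apply mul_le_mul _ (e1.trans e5) (pow_nonneg (by linarith) _) (by positivity)
        linarith
    _ = _ := by field_simp

lemma exists_d0 : ∃ d0 : ℕ, ∀ d : ℕ, d0 ≤ d → 4 * 500 * LL d + 1 ≤ d := by
  obtain ⟨C, hC, h⟩ := LL_bound
  refine ⟨⌈(2000*C+1)^2⌉₊ + 1, fun d hd => ?_⟩
  have hd1 : 1 ≤ d := by omega
  have hd2 : (2000*C+1)^2 ≤ d := by
    refine (Nat.le_ceil _).trans ?_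
    exact_mod_cast (by omega : ⌈(2000*C+1)^2⌉₊ ≤ d)
  have hd1' : (1:ℝ) ≤ d := by exact_mod_cast hd1
  have h1 := h d d hd1 hd1 (Real.log_le_self (by positivity))
  have h2 : (d:ℝ)^(1/16:ℝ) ≤ √d := by
    rw [Real.sqrt_eq_rpow]
    exact Real.rpow_le_rpow_of_exponent_le hd1' (by norm_num)
  have h3 : 2000*C+1 ≤ √d := Real.le_sqrt_of_sq_le hd2
  have h4 : √(d:ℝ) * √d = d := Real.mul_self_sqrt (by positivity)
  have h5 : LL d ≤ C * √d := h1.trans (by gcongr)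
  have h6 : 1 ≤ √(d:ℝ) := Real.one_le_sqrt.mpr hd1'
  nlinarith

lemma fin_ar {x b1 b2 V N q gg d e c1 c2 : ℝ} (hq : 0 < q) (hN : 0 ≤ N)
    (h : x ≤ b1 + 1/q*((1+d^2)*b2+V*N+d^2*(e*N))) (hb1 : b1 ≤ N/q*(c1/gg)) (hb2 : b2 ≤ N*(c1/gg)) (hV : V ≤ c2/gg) :
    x ≤ N/q*(((2+d^2)*c1+c2)/gg+d^2*e) := by
  have t1 : (1 + d^2) * b2 ≤ (1 + d^2) * (N * (c1/gg)) :=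
    mul_le_mul_of_nonneg_left hb2 (by positivity)
  have t2 : V * N ≤ c2/gg * N := mul_le_mul_of_nonneg_right hV hN
  have t3 := mul_le_mul_of_nonneg_left (add_le_add_left (add_le_add t1 t2) (d^2*(e*N))) (show (0:ℝ) ≤ 1/q by positivity)
  refine h.trans ((add_le_add hb1 t3).trans (le_of_eq ?_))
  ring

set_option maxHeartbeats 1000000 in
theorem core {d0 k0 : ℕ} (hd0 : ∀ d : ℕ, d0 ≤ d → 4 * 500 * LL d + 1 ≤ d)
    (hm : ∀ g a : ℕ, k0 ≤ a → g ≤ a → (g:ℝ)/16 ≤ ∑ p ∈ GP g a (a*2^g), 1 / (p:ℝ))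
    {ε1 : ℝ} (hε1 : 0 < ε1) {N0 : ℕ}
    (hHal : ∀ d r : ℕ, 2 ≤ d → d < d0 → r < d → r.Coprime d → ∀ N ≥ N0, ‖∑ n ∈ Ioc 0 N, fA ((r:ℝ)/d) n‖ ≤ ε1 * N)
    {g N z0 q T : ℕ} (hg : 20 ≤ g) (hk : k0 ≤ g) (h7 : g^7 ≤ 2^g) (hq : 0 < q) (hN : 0 < N) (hNN : N0 ≤ N)
    (hz0N : z0^(8*g^4) ≤ N) (hz0 : 16^(2^(15*g^2)) ≤ z0) (hB : 1 + 2 * Real.log N ≤ 64 * (g:ℝ)^4 * Real.log z0)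
    (hT : g*(g+5)*2^T ≤ 2^(g^4/4)) (hqT : q * (1 + Real.log N) ≤ 2^T) (hLL : (LL q)^4 ≤ g)
    (hq2 : q ≤ 2^(2^(8*g^2))) (a : ℤ) :
    |(#((Ioc 0 N).filter (fun n => A n ≡ a [ZMOD (q:ℤ)])) : ℝ) - N / q| ≤
      N/q * (((2 + d0^2) * (129*16^7) + 500*24*256*2001^8)/g + d0^2 * ε1) := by
  obtain ⟨J, hJ⟩ : ∃ J, g = J + 2 := ⟨g - 2, by omega⟩
  have hLL1 := one_le_LL hq
  have hLLg : LL q ≤ g := le_trans (le_self_pow₀ hLL1 (by norm_num)) hLL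
  have hlN : 0 ≤ Real.log N := Real.log_natCast_nonneg N
  have hq1 : (1:ℝ) ≤ q := by exact_mod_cast hq
  have b1 := bad_bound hm (by omega) hk h7 hq hN hz0N hz0 hB hT hqT hLLg a
  have b2 := bad_bound (q := 1) hm (by omega) hk h7 one_pos hN hz0N hz0 hB hT
    (by push_cast; exact le_trans (by gcongr) hqT) (by simp [LL]; omega) 0
  have e0 : ∀ n : ℕ, A n ≡ 0 [ZMOD ((1:ℕ):ℤ)] := fun n => by simpa using Int.modEq_one
  have e00 : (Ioc 0 N).filter (fun n => A n ≡ 0 [ZMOD ((1:ℕ):ℤ)] ∧ badP (fun i : Fin g => win g i) ((1+1/2^g : ℝ)^g) N n)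
      = (Ioc 0 N).filter (fun n => badP (fun i : Fin g => win g i) ((1+1/2^g : ℝ)^g) N n) := by
    apply Finset.filter_congr
    intro n _
    exact ⟨fun h => h.2, fun h => ⟨e0 n, h⟩⟩
  rw [e00, Nat.cast_one, div_one] at b2
  have dec := decay hJ (by omega) hLL1 hLL
  have wlo : ∀ i, g ≤ 2^(8*g^2+7*g*i) := fun i => win_lo (by omega)
  subst hJ
  have asm := assembly (M := 500) (by norm_num) hd0 hq (fun i : Fin (J+2) => win (J+2) i)
    (fun i p hp => (GP_mem.mp hp).1) (fun i j hij => win_disj (fun h => hij (Fin.ext h))) (keyc (J+2)) (1+1/2^(J+2))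
    (by positivity) (fun i p hp => by
      have e := GP_mem.mp hp
      have := wlo i
      exact key_real e.1.pos (by omega)) (fun i p hp => keyc_le _ p)
    (fun i y => by
      have e := wlo i
      refine GP_reg e (by omega) hq (hq2.trans (p2mono (p2mono (by omega)))) y)
    N ε1 hε1.le (by
      intro r hr hr0 hlt
      rw [mem_range] at hr
      set e := Nat.gcd r q with he
      have he0 : 0 < e := Nat.gcd_pos_of_pos_right _ hq
      have hrq : (r:ℝ)/q = ((r/e : ℕ):ℝ)/((q/e : ℕ):ℝ) := by
        have he' : (e:ℝ) ≠ 0 := by exact_mod_cast he0.ne'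
        rw [Nat.cast_div (Nat.gcd_dvd_left r q) he', Nat.cast_div (Nat.gcd_dvd_right r q) he', div_div_div_cancel_right₀ he']
      have hlt' : r/e < q/e := Nat.div_lt_div_of_lt_of_dvd (Nat.gcd_dvd_right r q) hr
      have hr1 : 0 < r/e := Nat.div_pos (Nat.le_of_dvd (by omega) (Nat.gcd_dvd_left r q)) he0
      rw [hrq]
      exact hHal (q/e) (r/e) (by omega) hlt hlt' (Nat.coprime_div_gcd_div_gcd he0) N hNN) a
  exact fin_ar (by linarith) (Nat.cast_nonneg N) asm b1 b2 dec

end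

section
open Filter Topology Finset
open scoped Classical

lemma exists_g (g0 : ℕ) : ∃ L0 : ℝ, 1 ≤ L0 ∧ ∀ L : ℝ, L0 ≤ L → ∃ g : ℕ, g0 ≤ g ∧ (2:ℝ)^(16*g^2) ≤ L ∧ L < (2:ℝ)^(16*(g+1)^2) := by
  refine ⟨(2:ℝ)^(16*g0^2), one_le_pow₀ (by norm_num), fun L hL => ?_⟩
  have hex : ∃ g : ℕ, L < (2:ℝ)^(16*(g+1)^2) := by
    obtain ⟨n, hn⟩ := pow_unbounded_of_one_lt L (by norm_num : (1:ℝ) < 2)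
    refine ⟨n, hn.trans_le (pow_le_pow_right₀ (by norm_num) ?_)⟩
    nlinarith
  have h1 := Nat.find_spec hex
  refine ⟨Nat.find hex, ?_, ?_, h1⟩
  · by_contra hlt
    rw [not_le] at hlt
    have : (2:ℝ)^(16*(Nat.find hex+1)^2) ≤ (2:ℝ)^(16*g0^2) := by
      apply pow_le_pow_right₀ (by norm_num)
      have : (Nat.find hex + 1)^2 ≤ g0^2 := Nat.pow_le_pow_left hlt 2
      omega
    linarith
  · rcases Nat.eq_zero_or_pos (Nat.find hex) with h | h
    · rw [h]; simp
      exact le_trans (one_le_pow₀ (by norm_num)) hL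
    · have := Nat.find_min hex (Nat.sub_lt h one_pos)
      rw [show Nat.find hex - 1 + 1 = Nat.find hex by omega, not_lt] at this
      exact this

lemma params (c : ℕ) (hc : 1 ≤ c) (C : ℝ) (hC : 0 < C) : ∃ g1 : ℕ, ∀ g ≥ g1, g^7 ≤ 2^g ∧
    g*(g+5)*2^(17*c*(g+1)^2) ≤ 2^(g^4/4) ∧ (17*c*(g+1)^2) ≤ 2^(8*g^2) ∧
    C^16 * ((17*c*(g+1)^2 : ℕ):ℝ) ≤ (g:ℝ)^4 := by
  have h7 : ∀ᶠ g : ℕ in atTop, g^7 ≤ 2^g := by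
    have := tendsto_pow_const_div_const_pow_of_one_lt 7 (by norm_num : (1:ℝ) < 2)
    filter_upwards [this.eventually (gt_mem_nhds (by norm_num : (0:ℝ) < 1))] with g hg
    rw [div_lt_one (by positivity)] at hg
    exact_mod_cast hg.le
  obtain ⟨g2, hg2⟩ := eventually_atTop.mp h7
  refine ⟨g2 + 300*c + ⌈C^16*68*c⌉₊, fun g hg => ?_⟩
  have hg300 : 300*c ≤ g := by omega
  have hg1 : 1 ≤ g := by omega
  have hT : 17*c*(g+1)^2 ≤ 68*c*g^2 := by
    have : (g+1)^2 ≤ (2*g)^2 := Nat.pow_le_pow_left (by omega) 2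
    calc 17*c*(g+1)^2 ≤ 17*c*(2*g)^2 := Nat.mul_le_mul_left _ this
      _ = _ := by ring
  have h3 : 300*c*g^2 ≤ g^3 := by
    calc 300*c*g^2 ≤ g*g^2 := Nat.mul_le_mul_right _ hg300
      _ = g^3 := by ring
  have h34 : g^3 ≤ g^4 := Nat.pow_le_pow_right hg1 (by norm_num)
  refine ⟨hg2 g (by omega), ?_, ?_, ?_⟩
  · have e1 : g ≤ 2^g := Nat.lt_two_pow_self.le
    have e2 : g + 5 ≤ 2^(g+5) := Nat.lt_two_pow_self.le
    calc g*(g+5)*2^(17*c*(g+1)^2) ≤ 2^g * 2^(g+5) * 2^(17*c*(g+1)^2) := Nat.mul_le_mul_right _ (Nat.mul_le_mul e1 e2)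
      _ = 2^(g+(g+5)+17*c*(g+1)^2) := by rw [← pow_add, ← pow_add]
      _ ≤ _ := by
        apply p2mono
        rw [Nat.le_div_iff_mul_le (by norm_num)]
        have e3 : g + (g+5) ≤ 7*c*g^2 := by
          have : g ≤ g^2 := Nat.le_self_pow (by norm_num) g
          have : g^2 ≤ c*g^2 := Nat.le_mul_of_pos_left _ hc
          nlinarith
        nlinarith
  · calc _ ≤ 68*c*g^2 := hT
      _ ≤ 300*c*g^2 := by gcongr; norm_num
      _ ≤ g^3 := h3
      _ ≤ (2^g)^3 := Nat.pow_le_pow_left Nat.lt_two_pow_self.le 3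
      _ = 2^(g*3) := by rw [← pow_mul]
      _ ≤ _ := p2mono (by nlinarith)
  · have e1 : C^16*68*c ≤ g := by
      refine (Nat.le_ceil _).trans ?_
      exact_mod_cast (by omega : ⌈C^16*68*c⌉₊ ≤ g)
    have e2 : ((17*c*(g+1)^2 : ℕ):ℝ) ≤ 68*c*(g:ℝ)^2 := by exact_mod_cast hT
    calc _ ≤ C^16 * (68*c*(g:ℝ)^2) := by gcongr
      _ = (C^16*68*c)*(g:ℝ)^2 := by ring
      _ ≤ g * (g:ℝ)^2 := by gcongr
      _ = (g:ℝ)^3 := by ring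
      _ ≤ (g:ℝ)^4 := by exact_mod_cast h34

lemma exists_z0 {g N : ℕ} (hg : 6 ≤ g) (hN : 0 < N) (hL : (2:ℝ)^(16*g^2) ≤ Real.log N) :
    ∃ z0 : ℕ, z0^(8*g^4) ≤ N ∧ 16^(2^(15*g^2)) ≤ z0 ∧ 1 + 2 * Real.log N ≤ 64 * (g:ℝ)^4 * Real.log z0 := by
  set L := Real.log N with hLdef
  have hN0 : (0:ℝ) < N := by exact_mod_cast hN
  have hg0 : (0:ℝ) < g := by exact_mod_cast (by omega : 0 < g)
  have hg64 : (64:ℝ) * (g:ℝ)^4 ≤ 2^(g^2) := by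
    have : 64 * g^4 ≤ 2^(g^2) := by
      calc 64 * g^4 = 2^6 * g^4 := by norm_num
        _ ≤ 2^6 * (2^g)^4 := by gcongr; exact Nat.lt_two_pow_self.le
        _ = 2^(6 + g*4) := by rw [← pow_mul, pow_add]
        _ ≤ _ := p2mono (by nlinarith)
    exact_mod_cast this
  have h1 : 4 * (2:ℝ)^(15*g^2) ≤ L/(16*(g:ℝ)^4) := by
    rw [le_div_iff₀ (by positivity)]
    calc 4 * (2:ℝ)^(15*g^2) * (16*(g:ℝ)^4) = (64 * (g:ℝ)^4) * 2^(15*g^2) := by ring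
      _ ≤ 2^(g^2) * 2^(15*g^2) := by gcongr
      _ = 2^(16*g^2) := by rw [← pow_add]; congr 1; ring
      _ ≤ L := hL
  have hp1 : (1:ℝ) ≤ 2^(15*g^2) := one_le_pow₀ (by norm_num)
  have h2 : L/(8*(g:ℝ)^4) = 2*(L/(16*(g:ℝ)^4)) := by field_simp; ring
  set y := Real.exp (L/(8*(g:ℝ)^4)) with hy
  have hy1 : 1 ≤ y := Real.one_le_exp (by rw [h2]; linarith)
  have hfl : y/2 ≤ ⌊y⌋₊ := by
    have a1 := Nat.lt_floor_add_one y
    have a2 : (1:ℝ) ≤ ⌊y⌋₊ := by exact_mod_cast Nat.one_le_floor_iff _ |>.mpr hy1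
    linarith
  have hlog : L/(16*(g:ℝ)^4) ≤ Real.log ⌊y⌋₊ := by
    calc L/(16*(g:ℝ)^4) ≤ Real.log (y/2) := by
          rw [Real.log_div (by positivity) (by norm_num), hy, Real.log_exp, h2]
          have := Real.log_two_lt_d9
          linarith
      _ ≤ _ := Real.log_le_log (by positivity) hfl
  have hfpos : (0:ℝ) < ⌊y⌋₊ := lt_of_lt_of_le (by positivity) hfl
  refine ⟨⌊y⌋₊, ?_, ?_, ?_⟩
  · have : ((⌊y⌋₊:ℝ))^(8*g^4) ≤ N := by
      calc ((⌊y⌋₊:ℝ))^(8*g^4) ≤ y^(8*g^4) := by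
            gcongr; exact Nat.floor_le (by positivity)
        _ = Real.exp L := by
            rw [hy, ← Real.exp_nat_mul]; congr 1; push_cast; field_simp
        _ = N := Real.exp_log hN0
    exact_mod_cast this
  · have : (16:ℝ)^(2^(15*g^2)) ≤ ⌊y⌋₊ := by
      rw [← Real.log_le_log_iff (by positivity) hfpos, Real.log_pow]
      refine le_trans ?_ hlog
      refine le_trans ?_ h1
      push_cast
      have : Real.log 16 ≤ 4 := by
        have e : (16:ℝ) = 2^4 := by norm_num
        rw [e, Real.log_pow]
        have := Real.log_two_lt_d9
        norm_num; linarith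
      rw [mul_comm]; gcongr
    exact_mod_cast this
  · have h3 : L = 16*(g:ℝ)^4 * (L/(16*(g:ℝ)^4)) := by field_simp
    have hL1 : 1 ≤ L := le_trans (one_le_pow₀ (by norm_num)) hL
    have h4 : L ≤ 16*(g:ℝ)^4 * Real.log ⌊y⌋₊ := by
      rw [h3]; gcongr
    linarith

lemma LL_pow {C : ℝ} (hC : 0 < C) (h : ∀ q Y : ℕ, 0 < q → 0 < Y → Real.log q ≤ Y → LL q ≤ C * (Y:ℝ) ^ (1/16 : ℝ))
    {q T g : ℕ} (hq : 0 < q) (hT : 0 < T) (hqT : q ≤ 2^T) (hg : C^16 * (T:ℝ) ≤ (g:ℝ)^4) : (LL q)^4 ≤ g := by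
  have h1 : Real.log q ≤ T := by
    calc Real.log q ≤ Real.log ((2:ℝ)^T) := Real.log_le_log (by exact_mod_cast hq) (by exact_mod_cast hqT)
      _ = T * Real.log 2 := Real.log_pow _ _
      _ ≤ T * 1 := by
        gcongr
        have := Real.log_two_lt_d9
        linarith
      _ = T := mul_one _
  have h2 := h q T hq hT h1
  have hL := one_le_LL hq
  have h3 : (LL q)^16 ≤ C^16 * T := by
    calc (LL q)^16 ≤ (C * (T:ℝ) ^ (1/16 : ℝ))^16 := by gcongr
      _ = C^16 * T := by
        rw [mul_pow, ← Real.rpow_natCast ((T:ℝ)^(1/16:ℝ)) 16, ← Real.rpow_mul (by positivity)]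
        norm_num
  have h4 : ((LL q)^4)^4 ≤ (g:ℝ)^4 := by
    rw [← pow_mul]; exact h3.trans hg
  exact le_of_pow_le_pow_left₀ (by norm_num) (by positivity) h4

lemma cnt_eq {x : ℝ} (hx : 0 ≤ x) (P : ℕ → Prop) : cnt x P = #((Ioc 0 ⌊x⌋₊).filter P) := by
  unfold cnt
  rw [← Set.ncard_coe_finset]
  congr 1
  ext n
  simp only [Set.mem_setOf_eq, coe_filter, mem_Ioc]
  rw [Nat.le_floor_iff hx, and_assoc]

lemma final_comb {ε q N x c3g M e2 : ℝ} (hε : 0 < ε) (hq : 0 < q) (hN : 0 ≤ N) (hNx : N ≤ x)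
    (hxN : x - N ≤ 1) (hx2 : 2/ε ≤ x) (h1 : c3g ≤ ε/4) (h2 : e2 ≤ ε/4)
    (hM : |M - N/q| ≤ N/q * (c3g + e2)) : |M - x/q| ≤ ε * (x/q) := by
  have hm2 : |M - N / q| ≤ ε/2 * (x/q) := by
    refine hM.trans ?_
    calc N/q * (c3g + e2) ≤ N/q * (ε/4+ε/4) := by gcongr
      _ ≤ x/q * (ε/4+ε/4) := by gcongr
      _ = _ := by ring
  have hm3 : |N/q - x/q| ≤ ε/2 * (x/q) := by
    rw [← sub_div, abs_div, abs_of_pos hq, abs_sub_comm, abs_of_nonneg (by linarith)]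
    rw [← mul_div_assoc]
    gcongr
    rw [div_le_iff₀ hε] at hx2
    linarith
  calc _ = |(M - N / q) + (N/q - x/q)| := by
        congr 1
        rw [sub_add_sub_cancel]
    _ ≤ _ := abs_add_le _ _
    _ ≤ ε/2 * (x/q) + ε/2 * (x/q) := add_le_add hm2 hm3
    _ = _ := by ring

set_option maxHeartbeats 1000000 in
theorem stmt18_aux (K : ℝ) (hK : 1 ≤ K) :
    ∀ ε : ℝ, 0 < ε → ∃ x₀ : ℝ, ∀ x : ℝ, x₀ ≤ x →
      ∀ q : ℕ, 0 < q → (q : ℝ) ≤ Real.log x ^ K →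
        ∀ a : ℤ,
          |(cnt x (fun n => A n ≡ a [ZMOD (q : ℤ)]) : ℝ) - x / q| ≤ ε * (x / q) := by
  intro ε hε
  obtain ⟨d0, hd0⟩ := exists_d0
  obtain ⟨k0, hm⟩ := GP_mass'
  obtain ⟨C, hC, hLLb⟩ := LL_bound
  set ε1 : ℝ := ε/(4*((d0:ℝ)^2+1)) with hε1
  have hεpos : 0 < ε1 := by positivity
  have hde : (d0:ℝ)^2*ε1 ≤ ε/4 := by
    rw [hε1, mul_div_assoc', div_le_div_iff₀ (by positivity) (by norm_num)]
    nlinarith [sq_nonneg (d0:ℝ)]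
  obtain ⟨N0, hHal⟩ := halasz_unif d0 hεpos
  set c := ⌈K⌉₊ + 1 with hc
  obtain ⟨g1, hg1⟩ := params c (by omega) C hC
  obtain ⟨c3, hc3⟩ : ∃ c3 : ℝ, c3 = ((2 + (d0:ℝ)^2) * (129*16^7) + 500*24*256*2001^8) := ⟨_, rfl⟩
  obtain ⟨L0, hL01, hL0⟩ := exists_g (g1 + k0 + 20 + ⌈4*c3/ε⌉₊)
  refine ⟨Real.exp L0 + N0 + 2/ε + 3, fun x hx q hq hqx a => ?_⟩
  have hexp : 0 < Real.exp L0 := Real.exp_pos L0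
  have hN0' : (0:ℝ) ≤ N0 := Nat.cast_nonneg N0
  have hε2 : 0 < 2/ε := by positivity
  have hx0 : 0 ≤ x := by linarith
  set N := ⌊x⌋₊ with hN
  have hNx : (N:ℝ) ≤ x := Nat.floor_le hx0
  have hNx' : x < N + 1 := Nat.lt_floor_add_one x
  have hN2 : (2:ℝ) ≤ N := by linarith
  have hN0'' : (0:ℝ) ≤ N := Nat.cast_nonneg N
  have hN2' : 2 ≤ N := by exact_mod_cast hN2
  have hNN : N0 ≤ N := by
    have : (N0:ℝ) ≤ N := by linarith
    exact_mod_cast this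
  have hLL0 : L0 ≤ Real.log N := by
    rw [Real.le_log_iff_exp_le (by linarith)]; linarith
  obtain ⟨g, hgg, hgl, hgu⟩ := hL0 _ hLL0
  obtain ⟨h7, hT, hT2, hT3⟩ := hg1 g (by omega)
  obtain ⟨z0, hz1, hz2, hz3⟩ := exists_z0 (N := N) (by omega : 6 ≤ g) (by omega) hgl
  set L := Real.log N with hLdef
  have hL1 : 1 ≤ L := by linarith
  have hlogx : Real.log x ≤ 2 * L := by
    have : Real.log x ≤ Real.log ((N:ℝ)^2) := Real.log_le_log (by linarith) (by nlinarith)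
    rwa [Real.log_pow] at this
  have hlogx1 : 1 ≤ Real.log x := le_trans hL1 (Real.log_le_log (by linarith) hNx)
  have hqp : (q:ℝ) ≤ (2*L)^(⌈K⌉₊) := by
    calc (q:ℝ) ≤ Real.log x ^ K := hqx
      _ ≤ Real.log x ^ ((⌈K⌉₊:ℕ):ℝ) := Real.rpow_le_rpow_of_exponent_le hlogx1 (Nat.le_ceil K)
      _ = Real.log x ^ (⌈K⌉₊) := Real.rpow_natCast _ _
      _ ≤ _ := by gcongr
  have hqT : q * (1 + L) ≤ 2^(17*c*(g+1)^2) := by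
    calc q * (1 + L) ≤ (2*L)^(⌈K⌉₊) * (2*L) := by gcongr; linarith
      _ = (2*L)^c := by rw [hc, pow_succ]
      _ ≤ (2 * 2^(16*(g+1)^2))^c := by gcongr
      _ = 2^((16*(g+1)^2+1)*c) := by rw [pow_mul _ (16*(g+1)^2+1) c, pow_succ _ (16*(g+1)^2), mul_comm (2:ℝ)]
      _ ≤ _ := by
        apply pow_le_pow_right₀ (by norm_num)
        have : 1 ≤ (g+1)^2 := Nat.one_le_pow _ _ (by omega)
        nlinarith
  have hq0 : (0:ℝ) < q := by exact_mod_cast hq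
  have hqT' : q ≤ 2^(17*c*(g+1)^2) := by
    have : (q:ℝ) ≤ 2^(17*c*(g+1)^2) := le_trans (le_mul_of_one_le_right hq0.le (by linarith)) hqT
    exact_mod_cast this
  have hTpos : 0 < 17*c*(g+1)^2 :=
    Nat.mul_pos (Nat.mul_pos (by norm_num) (Nat.succ_pos _)) (Nat.pow_pos (Nat.succ_pos g))
  have hLLq := LL_pow hC hLLb hq hTpos hqT' hT3
  have main := core hd0 hm hεpos hHal (by omega : 20 ≤ g) (by omega) h7 hq (by omega) hNN hz1 hz2 hz3 hT hqT hLLq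
    (hqT'.trans (p2mono hT2)) a
  rw [← hc3] at main
  rw [cnt_eq hx0]
  have hg0 : (0:ℝ) < g := by exact_mod_cast (by omega : 0 < g)
  have hcg : c3/g ≤ ε/4 := by
    have e1 : 4*c3/ε ≤ g := by
      refine (Nat.le_ceil _).trans ?_
      exact_mod_cast (by omega : ⌈4*c3/ε⌉₊ ≤ g)
    rw [div_le_iff₀ hε] at e1
    rw [div_le_iff₀ hg0]; linarith
  have hx2 : 2/ε ≤ x := by linarith
  have hxN : x - N ≤ 1 := by linarith
  have := final_comb hε hq0 hN0'' hNx hxN hx2 hcg hde main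
  convert this using 6

end

/-- **Theorem 6.1 for `A`.** Fix `K ≥ 1`. The sum of prime divisors function `A(n)` is
asymptotically uniformly distributed modulo `q`, uniformly for `q ≤ (log x)^K`. -/
theorem stmt18 (K : ℝ) (hK : 1 ≤ K) :
    ∀ ε : ℝ, 0 < ε → ∃ x₀ : ℝ, ∀ x : ℝ, x₀ ≤ x →
      ∀ q : ℕ, 0 < q → (q : ℝ) ≤ Real.log x ^ K →
        ∀ a : ℤ,
          |(cnt x (fun n => A n ≡ a [ZMOD (q : ℤ)]) : ℝ) - x / q| ≤ ε * (x / q) := by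
  exact stmt18_aux K hK
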